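/- Let n ≥ 1, suppose (1/p, 1/q) belongs to the interior of the triangle OAB, set α = α*(p,q) (defined by n/α*(p,q) = 1/q + n/p) and let s be given by 2s = n − (2/q + n/p). Then there is a constant C such that ‖ Σ_j λ_j |e^{itΔ}f_j|² ‖_{L^q(ℝ, L^p(ℝⁿ))} ≤ C ‖{λ_j}‖_{ℓ^α} for all families {f_j} orthonormal in Ḣ^s(ℝⁿ) and all {λ_j} ∈ ℓ^α; moreover, for every α > α*(p,q) no such finite constant exists. -/

import Mathlib

noncomputable section

open MeasureTheory ENNReal Real Set

namespace OS

/-- `ℝⁿ` as a Euclidean space. -/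
abbrev Rn (n : ℕ) := EuclideanSpace ℝ (Fin n)

/-- The real dot product `x·ξ`, viewed as a complex number. -/
def dotC {n : ℕ} (x ξ : Rn n) : ℂ := ((∑ i, x i * ξ i : ℝ) : ℂ)

/-- The Fourier transform `f̂(ξ) = ∫ f(x) e^{-i x·ξ} dx`. -/
def FT {n : ℕ} (f : Rn n → ℂ) (ξ : Rn n) : ℂ :=
  ∫ x : Rn n, Complex.exp (-(Complex.I * dotC x ξ)) * f x

/-- The propagator `e^{itΔ}` composed with a Fourier multiplier `m`:
`x ↦ (2π)^{-n} ∫ e^{i(x·ξ - t|ξ|²)} m(ξ) f̂(ξ) dξ`. -/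
def prop {n : ℕ} (m : Rn n → ℂ) (f : Rn n → ℂ) (t : ℝ) (x : Rn n) : ℂ :=
  ((2 * π : ℝ) ^ (-(n : ℝ)) : ℝ) •
    ∫ ξ : Rn n, Complex.exp (Complex.I * (dotC x ξ - (t : ℂ) * ((‖ξ‖ : ℝ) : ℂ) ^ 2)) *
      (m ξ * FT f ξ)

/-- The free Schrödinger propagator `e^{itΔ} f`, as a function of `(t, x)`. -/
def schrodinger {n : ℕ} (f : Rn n → ℂ) : ℝ → Rn n → ℂ := prop (fun _ => 1) f

/-- The Fourier multiplier `|ξ|^{-s} ψ(2^{-k}|ξ|)` of `(-Δ)^{-s/2} P_k`. -/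
def LPmult {n : ℕ} (s : ℝ) (ψ : ℝ → ℝ) (k : ℤ) (ξ : Rn n) : ℂ :=
  ((‖ξ‖ ^ (-s) * ψ ((2 : ℝ) ^ (-k) * ‖ξ‖) : ℝ) : ℂ)

/-- The Littlewood–Paley projection `P_k h`. -/
def LP {n : ℕ} (ψ : ℝ → ℝ) (k : ℤ) (h : Rn n → ℂ) (x : Rn n) : ℂ :=
  ((2 * π : ℝ) ^ (-(n : ℝ)) : ℝ) •
    ∫ ξ : Rn n, Complex.exp (Complex.I * dotC x ξ) *
      (((ψ ((2 : ℝ) ^ (-k) * ‖ξ‖) : ℝ) : ℂ) * FT h ξ)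

/-- The standing hypotheses on the Littlewood–Paley bump function `ψ`:
smooth, `[0,1]`-valued, supported in `[1/2,2]`, with `∑_{k∈ℤ} ψ(2^{-k} r) = 1` for `r ≠ 0`. -/
structure IsLPF (ψ : ℝ → ℝ) : Prop where
  smooth : ContDiff ℝ (⊤ : ℕ∞) ψ
  mem_Icc : ∀ r, ψ r ∈ Icc (0 : ℝ) 1
  supp : Function.support ψ ⊆ Icc (1 / 2 : ℝ) 2
  sum_one : ∀ r : ℝ, r ≠ 0 → ∑' k : ℤ, ψ ((2 : ℝ) ^ (-k) * r) = 1

/-- Orthonormality in `L²(ℝⁿ)`. -/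
def OrthonormalL2 {n : ℕ} (f : ℕ → Rn n → ℂ) : Prop :=
  ∀ j k, (∫ x : Rn n, f j x * (starRingEnd ℂ) (f k x)) = if j = k then 1 else 0

/-- Orthonormality in the homogeneous Sobolev space `Ḣ^s(ℝⁿ)`:
`(2π)^{-n} ∫ |ξ|^{2s} f̂_j(ξ) conj(f̂_k(ξ)) dξ = δ_{jk}`. -/
def OrthonormalHs {n : ℕ} (s : ℝ) (f : ℕ → Rn n → ℂ) : Prop :=
  ∀ j k, ((2 * π : ℝ) ^ (-(n : ℝ)) : ℝ) •
    (∫ ξ : Rn n, ((‖ξ‖ ^ (2 * s) : ℝ) : ℂ) * (FT (f j) ξ * (starRingEnd ℂ) (FT (f k) ξ)))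
      = if j = k then 1 else 0

/-- The density `Σ_j λ_j |u_j(t,x)|²` of a system of space-time functions. -/
def density2 {n : ℕ} (lam : ℕ → ℝ) (u : ℕ → ℝ → Rn n → ℂ) (t : ℝ) (x : Rn n) : ℝ :=
  ∑' j, lam j * ‖u j t x‖ ^ 2

/-- The density `Σ_j λ_j |e^{itΔ}f_j(x)|²`. -/
def density {n : ℕ} (lam : ℕ → ℝ) (f : ℕ → Rn n → ℂ) : ℝ → Rn n → ℝ :=
  density2 lam fun j => schrodinger (f j)

/-- The `L^q` norm (w.r.t. `μ`) of an `ℝ≥0∞`-valued function. -/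
def eLp {α : Type*} [MeasurableSpace α] (μ : Measure α) (q : ℝ≥0∞) (F : α → ℝ≥0∞) : ℝ≥0∞ :=
  if q = ∞ then essSup F μ
  else (∫⁻ t, F t ^ q.toReal ∂μ) ^ (1 / q.toReal)

/-- The Lorentz `L^{p,r}` (quasi)norm of an `ℝ≥0∞`-valued function, via the
distribution function.  For `r = ∞` this is the weak-`L^p` quasinorm
`sup_{s>0} s μ(G > s)^{1/p} = sup_{t>0} t^{1/p} G^*(t)`. -/
def lor {α : Type*} [MeasurableSpace α] (μ : Measure α) (p r : ℝ≥0∞) (G : α → ℝ≥0∞) : ℝ≥0∞ :=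
  if p = ∞ then essSup G μ
  else if r = ∞ then
    ⨆ (s : ℝ) (_ : 0 < s), ENNReal.ofReal s * μ {x | ENNReal.ofReal s < G x} ^ (1 / p.toReal)
  else
    (∫⁻ s in Ioi (0 : ℝ),
      (ENNReal.ofReal s * μ {x | ENNReal.ofReal s < G x} ^ (1 / p.toReal)) ^ r.toReal *
        (ENNReal.ofReal s)⁻¹) ^ (1 / r.toReal)

/-- The mixed norm `‖u‖_{L^q(ℝ, L^p(ℝⁿ))}`. -/
def mixedLp {n : ℕ} {E : Type*} [NormedAddCommGroup E] (q p : ℝ≥0∞)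
    (u : ℝ → Rn n → E) : ℝ≥0∞ :=
  eLp volume q fun t => eLpNorm (u t) p volume

/-- The mixed norm `‖u‖_{L^{q,∞}(ℝ, L^p(ℝⁿ))}` (weak in time). -/
def mixedWeakLp {n : ℕ} {E : Type*} [NormedAddCommGroup E] (q p : ℝ≥0∞)
    (u : ℝ → Rn n → E) : ℝ≥0∞ :=
  lor volume q ∞ fun t => eLpNorm (u t) p volume

/-- The weak `L^{p,∞}(ℝⁿ)` quasinorm. -/
def wLp {n : ℕ} {E : Type*} [NormedAddCommGroup E] (p : ℝ≥0∞) (g : Rn n → E) : ℝ≥0∞ :=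
  lor volume p ∞ fun x => (‖g x‖₊ : ℝ≥0∞)

/-- The mixed Lorentz norm `‖u‖_{L^{q,r}(ℝ, L^{p,r̃}(ℝⁿ))}`. -/
def mixedLorentz {n : ℕ} {E : Type*} [NormedAddCommGroup E] (q r p rt : ℝ≥0∞)
    (u : ℝ → Rn n → E) : ℝ≥0∞ :=
  lor volume q r fun t => lor volume p rt fun x => (‖u t x‖₊ : ℝ≥0∞)

/-- The `ℓ^a` norm of a sequence (with `ℓ^∞` the supremum norm). -/
def seqNormE (a : ℝ≥0∞) (lam : ℕ → ℝ) : ℝ≥0∞ :=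
  if a = ∞ then ⨆ j, ENNReal.ofReal |lam j|
  else (∑' j, ENNReal.ofReal |lam j| ^ a.toReal) ^ (1 / a.toReal)

/-- The decreasing rearrangement of a sequence: `seqRearr lam j` is the
`(j+1)`-th largest value of `|lam i|`. -/
def seqRearr (lam : ℕ → ℝ) (j : ℕ) : ℝ≥0∞ :=
  sInf {s : ℝ≥0∞ | Measure.count {i : ℕ | s < ENNReal.ofReal |lam i|} ≤ (j : ℝ≥0∞)}

/-- The Lorentz sequence norm `‖lam‖_{ℓ^{q,r}} = (Σ_j (j^{1/q} λ*_j)^r / j)^{1/r}`,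
parametrized by `qinv = 1/q` and a finite second exponent `r`. -/
def seqLor (qinv r : ℝ) (lam : ℕ → ℝ) : ℝ≥0∞ :=
  (∑' j : ℕ, (((j : ℝ≥0∞) + 1) ^ qinv * seqRearr lam j) ^ r * ((j : ℝ≥0∞) + 1)⁻¹) ^ (1 / r)

/-- The interior of the triangle `OAB`, in the coordinates `(a, b) = (1/p, 1/q)`. -/
def IntOAB (n : ℕ) (a b : ℝ) : Prop :=
  a ∈ Ioo (0 : ℝ) 1 ∧ b ∈ Ioo (0 : ℝ) 1 ∧ b < (n : ℝ) / (n - 1) * a ∧ 2 * b + n * a < n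

/-- The interior of the quadrilateral `OCDA`, in the coordinates `(a, b) = (1/p, 1/q)`. -/
def IntOCDA (n : ℕ) (a b : ℝ) : Prop :=
  a ∈ Ioo (0 : ℝ) 1 ∧ b ∈ Ioo (0 : ℝ) 1 ∧ (n : ℝ) / (n - 1) * a < b ∧ 2 * b + n * a < n

def ptO : ℝ × ℝ := (0, 0)
def ptA (n : ℕ) : ℝ × ℝ := (((n : ℝ) - 1) / (n + 1), (n : ℝ) / (n + 1))
def ptB : ℝ × ℝ := (1, 0)
def ptC : ℝ × ℝ := (0, 1)
def ptD (n : ℕ) : ℝ × ℝ := (((n : ℝ) - 2) / n, 1)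

/-- The closed triangle `OAB`. -/
def OAB (n : ℕ) : Set (ℝ × ℝ) := convexHull ℝ {ptO, ptA n, ptB}

/-- The closed quadrilateral `OCDA`. -/
def OCDA (n : ℕ) : Set (ℝ × ℝ) := convexHull ℝ {ptO, ptC, ptD n, ptA n}

/-- The half-open segment `[A, D)`. -/
def segAD (n : ℕ) : Set (ℝ × ℝ) := {x | ∃ t ∈ Ico (0 : ℝ) 1, x = (1 - t) • ptA n + t • ptD n}

/-- The Lebesgue exponent with reciprocal `a` (so `expOf 0 = ∞`). -/
def expOf (a : ℝ) : ℝ≥0∞ := (ENNReal.ofReal a)⁻¹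

/-- The weighted velocity average `∫ f(x - tv, v) |v|^{-2s} dv` of the solution of
the kinetic transport equation with datum `f`. -/
def velAvg {n : ℕ} (s : ℝ) (f : Rn n × Rn n → ℂ) (t : ℝ) (x : Rn n) : ℂ :=
  ∫ v : Rn n, ((‖v‖ ^ (-(2 * s)) : ℝ) : ℂ) * f (x - t • v, v)

end OS

open OS

namespace OS

variable {n : ℕ}

lemma dotC_eq_inner (x ξ : Rn n) : dotC x ξ = ((inner ℝ x ξ : ℝ) : ℂ) := by
  simp [dotC, PiLp.inner_apply, mul_comm]

/-- The plane wave `e^{i(x·ξ - t|ξ|²)}` damped by `e^{-ε|ξ|²/2}`. -/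
def wave (ε : ℝ) (t : ℝ) (x ξ : Rn n) : ℂ :=
  Complex.exp (Complex.I * (dotC x ξ - (t : ℂ) * ((‖ξ‖ : ℝ) : ℂ) ^ 2)) *
    ((rexp (-(ε / 2) * ‖ξ‖ ^ 2) : ℝ) : ℂ)

lemma norm_osc (t : ℝ) (x ξ : Rn n) :
    ‖Complex.exp (Complex.I * (dotC x ξ - (t : ℂ) * ((‖ξ‖ : ℝ) : ℂ) ^ 2))‖ = 1 := by
  rw [Complex.norm_exp]
  simp [dotC, ← Complex.ofReal_pow, ← Complex.ofReal_mul, ← Complex.ofReal_sub, -Complex.ofReal_sum]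

lemma norm_wave (ε t : ℝ) (x ξ : Rn n) : ‖wave ε t x ξ‖ = rexp (-(ε / 2) * ‖ξ‖ ^ 2) := by
  rw [wave, norm_mul, norm_osc, one_mul, Complex.norm_real, norm_of_nonneg (exp_pos _).le]

lemma continuous_wave (ε : ℝ) :
    Continuous fun z : (ℝ × Rn n) × Rn n => wave ε z.1.1 z.1.2 z.2 := by
  unfold wave dotC
  fun_prop

lemma wave_mul_conj (ε t t' : ℝ) (x x' ξ : Rn n) :
    wave ε t x ξ * (starRingEnd ℂ) (wave ε t' x' ξ) =
      Complex.exp (-((ε : ℂ) + Complex.I * (t - t')) * (‖ξ‖ : ℂ) ^ 2 +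
        Complex.I * ((inner ℝ (x - x') ξ : ℝ) : ℂ)) := by
  rw [wave, wave, map_mul, ← Complex.exp_conj, Complex.conj_ofReal, Complex.ofReal_exp,
    ← Complex.exp_add, ← Complex.exp_add, ← Complex.exp_add, inner_sub_left]
  simp only [dotC_eq_inner, map_mul, map_sub, map_pow, Complex.conj_ofReal, Complex.conj_I]
  congr 1
  push_cast
  ring

/-- The reproducing kernel of the damped waves. -/
def kern (ε : ℝ) (t : ℝ) (x : Rn n) : ℂ :=
  (π / ((ε : ℂ) + Complex.I * t)) ^ ((n : ℂ) / 2) *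
    Complex.exp (Complex.I ^ 2 * (‖x‖ : ℂ) ^ 2 / (4 * ((ε : ℂ) + Complex.I * t)))

lemma integral_wave_mul_conj {ε : ℝ} (hε : 0 < ε) (t t' : ℝ) (x x' : Rn n) :
    ∫ ξ, wave ε t x ξ * (starRingEnd ℂ) (wave ε t' x' ξ) = kern ε (t - t') (x - x') := by
  simp_rw [wave_mul_conj]
  rw [GaussianFourier.integral_cexp_neg_mul_sq_norm_add (by simpa using hε)]
  simp [kern]

lemma integrable_wave_sq {ε : ℝ} (hε : 0 < ε) :
    Integrable fun ξ : Rn n => rexp (-ε * ‖ξ‖ ^ 2) := by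
  have h := (GaussianFourier.integrable_cexp_neg_mul_sq_norm_add (V := Rn n) (b := (ε : ℂ))
    (by simpa using hε) 0 0).norm
  simpa [Complex.norm_exp, ← Complex.ofReal_pow, ← Complex.ofReal_mul] using h

lemma exp_half_sq (ε r : ℝ) : rexp (-(ε / 2) * r ^ 2) * rexp (-(ε / 2) * r ^ 2)
    = rexp (-ε * r ^ 2) := by
  rw [← Real.exp_add]; congr 1; ring

lemma memLp_exp {ε : ℝ} (hε : 0 < ε) :
    MemLp (fun ξ : Rn n => rexp (-(ε / 2) * ‖ξ‖ ^ 2)) 2 := by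
  rw [memLp_two_iff_integrable_sq (by fun_prop)]
  refine (integrable_wave_sq hε).congr (ae_of_all _ fun ξ => ?_)
  simp only [sq (rexp _), exp_half_sq]

lemma memLp_wave {ε : ℝ} (hε : 0 < ε) (t : ℝ) (x : Rn n) : MemLp (wave ε t x) 2 :=
  (memLp_exp hε).mono ((continuous_wave ε).comp (by fun_prop :
    Continuous fun ξ : Rn n => ((t, x), ξ))).aestronglyMeasurable
    (ae_of_all _ fun ξ => by rw [norm_wave, norm_of_nonneg (exp_pos _).le])

lemma norm_kern_zero {ε : ℝ} (hε : 0 < ε) (x : Rn n) :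
    ‖kern ε 0 x‖ = (π / ε) ^ ((n : ℝ) / 2) * rexp (-(1 / (4 * ε)) * ‖x‖ ^ 2) := by
  rw [kern, norm_mul]
  simp only [Complex.ofReal_zero, mul_zero, add_zero, Complex.I_sq]
  congr 1
  · rw [← Complex.ofReal_div, Complex.norm_cpow_eq_rpow_re_of_pos (by positivity)]
    simp
  · rw [Complex.norm_exp]
    congr 1
    rw [show (-1 * (‖x‖ : ℂ) ^ 2 / (4 * (ε : ℂ))) = ((-(1 / (4 * ε)) * ‖x‖ ^ 2 : ℝ) : ℂ) by
      push_cast; field_simp]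
    simp only [Complex.ofReal_re]

lemma norm_kern_le {ε t : ℝ} (hε : 0 < ε) (ht : t ≠ 0) (x : Rn n) :
    ‖kern ε t x‖ ≤ (π / |t|) ^ ((n : ℝ) / 2) := by
  have hb : 0 < ((ε : ℂ) + Complex.I * t).re := by simpa using hε
  have hb0 : ((ε : ℂ) + Complex.I * t) ≠ 0 := fun h => by simp [h] at hb
  have h1 : ‖(π / ((ε : ℂ) + Complex.I * t)) ^ ((n : ℂ) / 2)‖ ≤ (π / |t|) ^ ((n : ℝ) / 2) := by
    have : ((n : ℂ) / 2) = (((n : ℝ) / 2 : ℝ) : ℂ) := by push_cast; rfl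
    rw [this, Complex.norm_cpow_real]
    gcongr
    rw [norm_div, Complex.norm_real, norm_of_nonneg pi_pos.le]
    gcongr
    have := Complex.abs_im_le_norm ((ε : ℂ) + Complex.I * t)
    simpa using this
  have h2 : ‖Complex.exp (Complex.I ^ 2 * (‖x‖ : ℂ) ^ 2 / (4 * ((ε : ℂ) + Complex.I * t)))‖ ≤ 1 := by
    rw [Complex.norm_exp, Real.exp_le_one_iff]
    have : Complex.I ^ 2 * (‖x‖ : ℂ) ^ 2 / (4 * ((ε : ℂ) + Complex.I * t)) =
        ((-(‖x‖ ^ 2 / 4) : ℝ) : ℂ) * ((ε : ℂ) + Complex.I * t)⁻¹ := by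
      rw [Complex.I_sq]; push_cast; field_simp
    rw [this, Complex.re_ofReal_mul, Complex.inv_re]
    have := Complex.normSq_nonneg ((ε : ℂ) + Complex.I * t)
    have : 0 ≤ ((ε : ℂ) + Complex.I * t).re / Complex.normSq ((ε : ℂ) + Complex.I * t) := by positivity
    nlinarith [sq_nonneg ‖x‖]
  rw [kern, norm_mul]
  calc _ ≤ (π / |t|) ^ ((n : ℝ) / 2) * 1 := by gcongr
    _ = _ := mul_one _

lemma integral_norm_kern_zero {ε : ℝ} (hε : 0 < ε) :
    ∫⁻ x : Rn n, ‖kern ε 0 x‖ₑ = ENNReal.ofReal ((2 * π) ^ n) := by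
  simp_rw [← ofReal_norm, norm_kern_zero hε]
  rw [← ofReal_integral_eq_lintegral_ofReal ((integrable_wave_sq (by positivity)).const_mul _)
    (ae_of_all _ fun x => by positivity), integral_const_mul,
    GaussianFourier.integral_rexp_neg_mul_sq_norm (by positivity), finrank_euclideanSpace_fin,
    ← Real.mul_rpow (by positivity) (by positivity)]
  congr 1
  rw [show π / ε * (π / (1 / (4 * ε))) = (2 * π) ^ (2 : ℝ) by
    rw [Real.rpow_two]; field_simp; ring,
    ← Real.rpow_mul (by positivity), ← Real.rpow_natCast]
  congr 1
  ring

section Gram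
variable {X Ω : Type*} [MeasurableSpace X] [MeasurableSpace Ω] {μ : Measure X} {ν : Measure Ω}

lemma integrable_gram {k : X → Ω → ℂ} {w : Ω → ℝ} {h : X → ℂ}
    (hk : Measurable fun z : Ω × X => k z.2 z.1)
    (hkw : ∀ x ξ, ‖k x ξ‖ ≤ w ξ) (hw : Integrable (fun ξ => w ξ * w ξ) ν) (hh : Integrable h μ) :
    Integrable (fun z : Ω × (X × X) => k z.2.1 z.1 * h z.2.1 *
      (starRingEnd ℂ) (k z.2.2 z.1 * h z.2.2)) (ν.prod (μ.prod μ)) := by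
  have h1 : AEStronglyMeasurable (fun z : Ω × (X × X) => k z.2.1 z.1 * h z.2.1)
      (ν.prod (μ.prod μ)) :=
    (hk.comp (f := fun z : Ω × (X × X) => (z.1, z.2.1)) (by fun_prop)).aestronglyMeasurable.mul
      (hh.1.comp_quasiMeasurePreserving (Measure.quasiMeasurePreserving_fst.comp
        Measure.quasiMeasurePreserving_snd))
  have h2 : AEStronglyMeasurable (fun z : Ω × (X × X) => k z.2.2 z.1 * h z.2.2)
      (ν.prod (μ.prod μ)) :=
    (hk.comp (f := fun z : Ω × (X × X) => (z.1, z.2.2)) (by fun_prop)).aestronglyMeasurable.mul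
      (hh.1.comp_quasiMeasurePreserving (Measure.quasiMeasurePreserving_snd.comp
        Measure.quasiMeasurePreserving_snd))
  refine (hw.mul_prod (hh.norm.mul_prod hh.norm)).mono'
    (h1.mul (Complex.continuous_conj.comp_aestronglyMeasurable h2)) (ae_of_all _ fun z => ?_)
  rw [norm_mul, RCLike.norm_conj, norm_mul, norm_mul]
  have a := hkw z.2.1 z.1
  have b := hkw z.2.2 z.1
  have ha : 0 ≤ w z.1 := (norm_nonneg _).trans a
  calc _ ≤ w z.1 * ‖h z.2.1‖ * (w z.1 * ‖h z.2.2‖) := by gcongr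
    _ = _ := by ring

variable [SFinite μ] [SFinite ν]

lemma integral_gram {k : X → Ω → ℂ} {w : Ω → ℝ} {h : X → ℂ}
    (hk : Measurable fun z : Ω × X => k z.2 z.1)
    (hkw : ∀ x ξ, ‖k x ξ‖ ≤ w ξ) (hw : Integrable (fun ξ => w ξ * w ξ) ν) (hh : Integrable h μ)
    (A : Set (X × X)) :
    Integrable (fun ξ => ∫ z in A, k z.1 ξ * h z.1 * (starRingEnd ℂ) (k z.2 ξ * h z.2) ∂(μ.prod μ)) ν ∧
    Integrable (fun z : X × X => h z.1 * (starRingEnd ℂ) (h z.2) *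
      ∫ ξ, k z.1 ξ * (starRingEnd ℂ) (k z.2 ξ) ∂ν) (μ.prod μ) ∧
    ∫ ξ, ∫ z in A, k z.1 ξ * h z.1 * (starRingEnd ℂ) (k z.2 ξ * h z.2) ∂(μ.prod μ) ∂ν =
      ∫ z in A, h z.1 * (starRingEnd ℂ) (h z.2) *
        (∫ ξ, k z.1 ξ * (starRingEnd ℂ) (k z.2 ξ) ∂ν) ∂(μ.prod μ) := by
  have hI := integrable_gram hk hkw hw hh
  have hIA : Integrable (fun z : Ω × (X × X) => k z.2.1 z.1 * h z.2.1 *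
      (starRingEnd ℂ) (k z.2.2 z.1 * h z.2.2)) (ν.prod ((μ.prod μ).restrict A)) := by
    refine hI.mono_measure ?_
    exact Measure.prod_mono le_rfl Measure.restrict_le_self
  have e : ∀ z : X × X, h z.1 * (starRingEnd ℂ) (h z.2) *
      (∫ ξ, k z.1 ξ * (starRingEnd ℂ) (k z.2 ξ) ∂ν) =
      ∫ ξ, k z.1 ξ * h z.1 * (starRingEnd ℂ) (k z.2 ξ * h z.2) ∂ν := by
    intro z
    rw [← integral_const_mul]
    congr 1; ext ξ; simp only [map_mul]; ring
  simp_rw [e]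
  exact ⟨hIA.integral_prod_left, hI.integral_prod_right, integral_integral_swap hIA⟩

lemma integral_mul_conj_integral (g : X → ℂ) :
    ∫ z : X × X, g z.1 * (starRingEnd ℂ) (g z.2) ∂(μ.prod μ) =
      ((‖∫ x, g x ∂μ‖ ^ 2 : ℝ) : ℂ) := by
  rw [integral_prod_mul (f := g) (g := fun x => (starRingEnd ℂ) (g x)), integral_conj,
    Complex.mul_conj, Complex.normSq_eq_norm_sq]

end Gram

section Schur
variable {X : Type*} [MeasurableSpace X] {μ : Measure X} [SFinite μ]

lemma mul_le_half_add_sq (a b : ℝ≥0∞) : a * b ≤ 2⁻¹ * (a ^ 2 + b ^ 2) := by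
  rcases eq_or_ne a ∞ with rfl | ha
  · simp [ENNReal.mul_top]
  rcases eq_or_ne b ∞ with rfl | hb
  · simp [ENNReal.mul_top]
  lift a to NNReal using ha
  lift b to NNReal using hb
  have : a * b ≤ 2⁻¹ * (a ^ 2 + b ^ 2) := by
    rw [← NNReal.coe_le_coe]
    push_cast
    nlinarith [sq_nonneg ((a : ℝ) - b)]
  have h2 : (2⁻¹ : ℝ≥0∞) = ((2⁻¹ : NNReal) : ℝ≥0∞) := by simp
  rw [h2]
  exact_mod_cast this

/-- Schur's test. -/
lemma schur_test {a : X → ℝ≥0∞} (ha : AEMeasurable a μ) {K : X → X → ℝ≥0∞}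
    (hK : Measurable (Function.uncurry K)) {M : ℝ≥0∞}
    (h1 : ∀ x, ∫⁻ y, K x y ∂μ ≤ M) (h2 : ∀ y, ∫⁻ x, K x y ∂μ ≤ M) :
    ∫⁻ x, ∫⁻ y, a x * a y * K x y ∂μ ∂μ ≤ M * ∫⁻ x, a x ^ 2 ∂μ := by
  have m1 : AEMeasurable (fun z : X × X => a z.1 ^ 2 * K z.1 z.2) (μ.prod μ) :=
    ((ha.comp_quasiMeasurePreserving Measure.quasiMeasurePreserving_fst).pow_const 2).mul
      hK.aemeasurable
  have m2 : AEMeasurable (fun z : X × X => a z.2 ^ 2 * K z.1 z.2) (μ.prod μ) :=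
    ((ha.comp_quasiMeasurePreserving Measure.quasiMeasurePreserving_snd).pow_const 2).mul
      hK.aemeasurable
  have e1 : ∫⁻ x, ∫⁻ y, a x ^ 2 * K x y ∂μ ∂μ ≤ M * ∫⁻ x, a x ^ 2 ∂μ := by
    rw [← lintegral_const_mul'' _ (ha.pow_const 2)]
    refine lintegral_mono fun x => ?_
    rw [lintegral_const_mul _ (show Measurable fun y => K x y from hK.comp measurable_prodMk_left),
      mul_comm]
    gcongr
    exact h1 x
  have e2 : ∫⁻ x, ∫⁻ y, a y ^ 2 * K x y ∂μ ∂μ ≤ M * ∫⁻ x, a x ^ 2 ∂μ := by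
    rw [lintegral_lintegral_swap m2, ← lintegral_const_mul'' _ (ha.pow_const 2)]
    refine lintegral_mono fun x => ?_
    rw [lintegral_const_mul _ (show Measurable fun y => K y x from hK.comp measurable_prodMk_right),
      mul_comm]
    gcongr
    exact h2 x
  calc ∫⁻ x, ∫⁻ y, a x * a y * K x y ∂μ ∂μ
      ≤ ∫⁻ x, ∫⁻ y, 2⁻¹ * (a x ^ 2 * K x y + a y ^ 2 * K x y) ∂μ ∂μ := by
        refine lintegral_mono fun x => lintegral_mono fun y => ?_
        rw [← add_mul, ← mul_assoc]
        refine mul_le_mul_left ?_ _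
        exact mul_le_half_add_sq _ _
    _ = ∫⁻ z, 2⁻¹ * (a z.1 ^ 2 * K z.1 z.2 + a z.2 ^ 2 * K z.1 z.2) ∂(μ.prod μ) :=
        (lintegral_prod _ ((m1.add m2).const_mul _)).symm
    _ = 2⁻¹ * (∫⁻ x, ∫⁻ y, a x ^ 2 * K x y ∂μ ∂μ + ∫⁻ x, ∫⁻ y, a y ^ 2 * K x y ∂μ ∂μ) := by
        rw [lintegral_const_mul' _ _ (by simp), lintegral_add_left' m1, lintegral_prod _ m1,
          lintegral_prod _ m2]
    _ ≤ 2⁻¹ * (M * ∫⁻ x, a x ^ 2 ∂μ + M * ∫⁻ x, a x ^ 2 ∂μ) := by gcongr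
    _ = _ := by rw [← two_mul, ← mul_assoc, ENNReal.inv_mul_cancel (by simp) (by simp), one_mul]

end Schur

lemma measurable_conj_wave (ε : ℝ) :
    Measurable fun z : Rn n × (ℝ × Rn n) => (starRingEnd ℂ) (wave ε z.2.1 z.2.2 z.1) :=
  (Complex.continuous_conj.comp ((continuous_wave ε).comp
    (by fun_prop : Continuous fun z : Rn n × (ℝ × Rn n) => (z.2, z.1)))).measurable

lemma norm_conj_wave (ε t : ℝ) (x ξ : Rn n) :
    ‖(starRingEnd ℂ) (wave ε t x ξ)‖ ≤ rexp (-(ε / 2) * ‖ξ‖ ^ 2) := by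
  rw [RCLike.norm_conj, norm_wave]

lemma integrable_exp_mul_self {ε : ℝ} (hε : 0 < ε) :
    Integrable fun ξ : Rn n => rexp (-(ε / 2) * ‖ξ‖ ^ 2) * rexp (-(ε / 2) * ‖ξ‖ ^ 2) := by
  simp_rw [exp_half_sq]
  exact integrable_wave_sq hε

lemma integral_conj_wave_mul {ε : ℝ} (hε : 0 < ε) (t t' : ℝ) (x x' : Rn n) :
    ∫ ξ, (starRingEnd ℂ) (wave ε t x ξ) * (starRingEnd ℂ) ((starRingEnd ℂ) (wave ε t' x' ξ)) =
      kern ε (t' - t) (x' - x) := by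
  rw [← integral_wave_mul_conj hε]
  congr 1; ext ξ; rw [Complex.conj_conj, mul_comm]

lemma lintegral_enorm_sq_eq {Ω : Type*} [MeasurableSpace Ω] {ν : Measure Ω} {g : Ω → ℂ}
    (hg : Integrable (fun ξ => ((‖g ξ‖ ^ 2 : ℝ) : ℂ)) ν) :
    ∫⁻ ξ, ‖g ξ‖ₑ ^ 2 ∂ν = ‖∫ ξ, ((‖g ξ‖ ^ 2 : ℝ) : ℂ) ∂ν‖ₑ := by
  have hg' : Integrable (fun ξ => ‖g ξ‖ ^ 2) ν := by
    simpa only [RCLike.re_to_complex, Complex.ofReal_re] using hg.re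
  rw [integral_complex_ofReal, ← ofReal_norm, Complex.norm_real, norm_of_nonneg (by positivity),
    ofReal_integral_eq_lintegral_ofReal hg' (ae_of_all _ fun _ => by positivity)]
  congr 1; ext ξ
  rw [ENNReal.ofReal_pow (norm_nonneg _), ofReal_norm]

lemma lintegral_slice_le {ε : ℝ} (hε : 0 < ε) (t : ℝ) {ψ : Rn n → ℂ} (hψ : Integrable ψ) :
    ∫⁻ ξ, ‖∫ x, (starRingEnd ℂ) (wave ε t x ξ) * ψ x‖ₑ ^ 2 ≤
      ENNReal.ofReal ((2 * π) ^ n) * ∫⁻ x, ‖ψ x‖ₑ ^ 2 := by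
  have hm0 : Measurable fun z : Rn n × Rn n => (starRingEnd ℂ) (wave ε t z.2 z.1) :=
    (measurable_conj_wave ε).comp (g := fun z : Rn n × (ℝ × Rn n) => _)
      (f := fun z : Rn n × Rn n => (z.1, (t, z.2))) (by fun_prop)
  obtain ⟨i1, i2, e⟩ := integral_gram (k := fun (x : Rn n) ξ => (starRingEnd ℂ) (wave ε t x ξ))
    (w := fun ξ => rexp (-(ε / 2) * ‖ξ‖ ^ 2)) (h := ψ) (μ := volume) (ν := (volume : Measure (Rn n)))
    hm0 (fun x ξ => norm_conj_wave ε t x ξ) (integrable_exp_mul_self hε) hψ univ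
  simp only [Measure.restrict_univ, integral_conj_wave_mul hε, sub_self] at i1 i2 e
  have e1 := fun ξ => integral_mul_conj_integral (μ := volume)
    (fun x : Rn n => (starRingEnd ℂ) (wave ε t x ξ) * ψ x)
  simp only [e1] at i1 e
  rw [lintegral_enorm_sq_eq i1, e]
  refine (enorm_integral_le_lintegral_enorm _).trans ?_
  have hm : Measurable (Function.uncurry fun x y : Rn n => ‖kern ε 0 (y - x)‖ₑ) := by
    unfold kern
    fun_prop
  refine le_trans (le_of_eq ?_) (schur_test (a := fun x => ‖ψ x‖ₑ) hψ.1.enorm hm ?_ ?_)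
  · rw [lintegral_prod _ i2.1.enorm]
    simp
  · intro x
    rw [lintegral_sub_right_eq_self (fun y : Rn n => ‖kern ε 0 y‖ₑ), integral_norm_kern_zero hε]
  · intro x
    rw [lintegral_sub_left_eq_self (fun y : Rn n => ‖kern ε 0 y‖ₑ), integral_norm_kern_zero hε]

/-- The set of pairs of space-time points at time distance at most `L`. -/
def nearSet (Y : Type*) (L : ℝ) : Set ((ℝ × Y) × (ℝ × Y)) := {z | |z.1.1 - z.2.1| ≤ L}

lemma measurableSet_nearSet (Y : Type*) [MeasurableSpace Y] (L : ℝ) :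
    MeasurableSet (nearSet Y L) :=
  measurableSet_le (by fun_prop) measurable_const

lemma enorm_near_le {Y : Type*} [MeasurableSpace Y] {μ : Measure Y} [SFinite μ] {L : ℝ}
    {P : ℝ × Y → ℂ} (hP : Integrable P (volume.prod μ)) :
    ‖∫ z in nearSet Y L, P z.1 * (starRingEnd ℂ) (P z.2)
        ∂((volume.prod μ).prod (volume.prod μ))‖ₑ ≤
      ENNReal.ofReal (2 * L) * ∫⁻ t, ‖∫ x, P (t, x) ∂μ‖ₑ ^ 2 := by
  set b : ℝ → ℂ := fun t => ∫ x, P (t, x) ∂μ with hb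
  have hbI : Integrable b := hP.integral_prod_left
  let χ : ℝ → ℝ → ℂ := fun t t' => if |t - t'| ≤ L then 1 else 0
  have hI : Integrable (fun z : (ℝ × Y) × (ℝ × Y) => P z.1 * (starRingEnd ℂ) (P z.2))
      ((volume.prod μ).prod (volume.prod μ)) :=
    hP.mul_prod (Complex.conjLIE.integrable_comp_iff.2 hP)
  have hχm : Measurable (fun z : ℝ × ℝ => χ z.1 z.2) :=
    Measurable.ite (measurableSet_le (by fun_prop) measurable_const) measurable_const
      measurable_const
  have hχ : ∀ t t', ‖χ t t'‖ ≤ 1 := fun t t' => by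
    simp only [χ]; split_ifs <;> simp
  have hind : ∀ z : (ℝ × Y) × (ℝ × Y), (nearSet Y L).indicator
      (fun z => P z.1 * (starRingEnd ℂ) (P z.2)) z =
      P z.1 * (χ z.1.1 z.2.1 * (starRingEnd ℂ) (P z.2)) := by
    intro z
    by_cases h : |z.1.1 - z.2.1| ≤ L
    · rw [indicator_of_mem (show z ∈ nearSet Y L from h)]; simp [χ, h]
    · rw [indicator_of_notMem (show z ∉ nearSet Y L from h)]; simp [χ, h]
  have hI' := hI.indicator (measurableSet_nearSet Y L)
  rw [← integral_indicator (measurableSet_nearSet Y L), integral_prod _ hI']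
  simp_rw [hind, integral_const_mul]
  have hc : ∀ t, ∫ z, χ t z.1 * (starRingEnd ℂ) (P z) ∂(volume.prod μ) =
      ∫ t', χ t t' * (starRingEnd ℂ) (b t') := by
    intro t
    rw [integral_prod]
    · simp_rw [integral_const_mul, integral_conj]; rfl
    · refine (Complex.conjLIE.integrable_comp_iff.2 hP).bdd_mul (c := 1) ?_
        (ae_of_all _ fun z => hχ _ _)
      exact (hχm.comp (by fun_prop : Measurable fun z : ℝ × Y => (t, z.1))).aestronglyMeasurable
  simp_rw [hc]
  have hI2 : Integrable (fun z : ℝ × Y => P z * ∫ t', χ z.1 t' * (starRingEnd ℂ) (b t'))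
      (volume.prod μ) := by
    have := hI'.integral_prod_left
    simp_rw [hind, integral_const_mul, hc] at this
    exact this
  rw [integral_prod _ hI2]
  simp_rw [integral_mul_const]
  calc _ ≤ ∫⁻ t, ‖b t‖ₑ * ∫⁻ t', ‖b t'‖ₑ * ‖χ t t'‖ₑ := by
        refine (enorm_integral_le_lintegral_enorm _).trans (lintegral_mono fun t => ?_)
        rw [enorm_mul]
        gcongr
        refine (enorm_integral_le_lintegral_enorm _).trans (lintegral_mono fun t' => ?_)
        rw [enorm_mul, RCLike.enorm_conj, mul_comm]
    _ = ∫⁻ t, ∫⁻ t', ‖b t‖ₑ * ‖b t'‖ₑ * ‖χ t t'‖ₑ := by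
        refine lintegral_congr fun t => ?_
        rw [← lintegral_const_mul' _ _ (by simp)]
        simp_rw [mul_assoc]
    _ ≤ _ := by
        have key : ∀ t, ∫⁻ t', ‖χ t t'‖ₑ ≤ ENNReal.ofReal (2 * L) := by
          intro t
          calc ∫⁻ t', ‖χ t t'‖ₑ ≤ ∫⁻ t', (Icc (t - L) (t + L)).indicator 1 t' := by
                refine lintegral_mono fun t' => ?_
                by_cases h : |t - t'| ≤ L
                · have : t' ∈ Icc (t - L) (t + L) := by
                    rw [abs_le] at h; constructor <;> linarith [h.1, h.2]
                  simp [χ, h, this]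
                · simp [χ, h]
            _ = _ := by
                rw [lintegral_indicator_one measurableSet_Icc, Real.volume_Icc]; congr 1; ring
        refine schur_test (a := fun t => ‖b t‖ₑ) (K := fun t t' => ‖χ t t'‖ₑ) hbI.1.enorm
          hχm.enorm key fun t => ?_
        refine le_trans (le_of_eq (lintegral_congr fun t' => ?_)) (key t)
        simp only [χ, abs_sub_comm t' t]

/-- The adjoint of the damped extension operator. -/
def coeffInt (ε : ℝ) (ψ : ℝ × Rn n → ℂ) (ξ : Rn n) : ℂ :=
  ∫ z : ℝ × Rn n, (starRingEnd ℂ) (wave ε z.1 z.2 ξ) * ψ z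

lemma lintegral_near_le {ε L : ℝ} (hε : 0 < ε) {ψ : ℝ × Rn n → ℂ} (hm : Measurable ψ)
    (hψ : Integrable ψ) :
    ‖∫ ξ : Rn n, ∫ z in nearSet (Rn n) L, (starRingEnd ℂ) (wave ε z.1.1 z.1.2 ξ) * ψ z.1 *
      (starRingEnd ℂ) ((starRingEnd ℂ) (wave ε z.2.1 z.2.2 ξ) * ψ z.2)‖ₑ ≤
      ENNReal.ofReal (2 * L) * (ENNReal.ofReal ((2 * π) ^ n) * ∫⁻ z, ‖ψ z‖ₑ ^ 2) := by
  have hP : ∀ ξ : Rn n,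
      Integrable (fun z : ℝ × Rn n => (starRingEnd ℂ) (wave ε z.1 z.2 ξ) * ψ z) := by
    intro ξ
    refine hψ.bdd_mul (c := rexp (-(ε / 2) * ‖ξ‖ ^ 2)) ?_
      (ae_of_all _ fun z => norm_conj_wave ε _ _ _)
    exact ((measurable_conj_wave ε).comp (g := fun z : Rn n × (ℝ × Rn n) => _)
      (f := fun z : ℝ × Rn n => (ξ, z)) (by fun_prop)).aestronglyMeasurable
  have hmeas : Measurable (fun z : Rn n × ℝ =>
      ‖∫ x, (starRingEnd ℂ) (wave ε z.2 x z.1) * ψ (z.2, x)‖ₑ ^ 2) := by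
    have h1 : Measurable (fun w : (Rn n × ℝ) × Rn n =>
        (starRingEnd ℂ) (wave ε w.1.2 w.2 w.1.1) * ψ (w.1.2, w.2)) :=
      ((measurable_conj_wave ε).comp (g := fun z : Rn n × (ℝ × Rn n) => _)
      (f := fun w : (Rn n × ℝ) × Rn n => (w.1.1, (w.1.2, w.2))) (by fun_prop)).mul
      (hm.comp (by fun_prop))
    exact (h1.stronglyMeasurable.integral_prod_right (ν := volume)).measurable.enorm.pow_const 2
  calc _ ≤ ∫⁻ ξ : Rn n, ENNReal.ofReal (2 * L) *
        ∫⁻ t, ‖∫ x, (starRingEnd ℂ) (wave ε t x ξ) * ψ (t, x)‖ₑ ^ 2 :=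
        (enorm_integral_le_lintegral_enorm _).trans (lintegral_mono fun ξ =>
          enorm_near_le (μ := volume) (hP ξ))
    _ = ENNReal.ofReal (2 * L) *
        ∫⁻ t, ∫⁻ ξ, ‖∫ x, (starRingEnd ℂ) (wave ε t x ξ) * ψ (t, x)‖ₑ ^ 2 := by
        rw [lintegral_const_mul' _ _ ofReal_ne_top, lintegral_lintegral_swap hmeas.aemeasurable]
    _ ≤ ENNReal.ofReal (2 * L) *
        ∫⁻ t, ENNReal.ofReal ((2 * π) ^ n) * ∫⁻ x, ‖ψ (t, x)‖ₑ ^ 2 := by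
        refine mul_le_mul_right (lintegral_mono_ae ?_) _
        filter_upwards [Integrable.prod_right_ae (μ := (volume : Measure ℝ)) (ν := (volume : Measure (Rn n))) hψ] with t ht
        exact lintegral_slice_le hε t ht
    _ = _ := by
        rw [lintegral_const_mul' _ _ ofReal_ne_top, Measure.volume_eq_prod,
          lintegral_prod _ (by fun_prop)]

lemma lintegral_sum_mul_conj_sq {X : Type*} [MeasurableSpace X] {μ : Measure X} [SFinite μ]
    (J : Finset ℕ) {ψ : ℕ → X → ℂ} (h2 : ∀ j ∈ J, MemLp (ψ j) 2 μ) :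
    ∫⁻ z : X × X, ‖∑ j ∈ J, ψ j z.1 * (starRingEnd ℂ) (ψ j z.2)‖ₑ ^ 2 ∂(μ.prod μ) =
      ∑ j ∈ J, ∑ k ∈ J, ‖∫ x, ψ j x * (starRingEnd ℂ) (ψ k x) ∂μ‖ₑ ^ 2 := by
  have e : ∀ z : X × X, ((‖∑ j ∈ J, ψ j z.1 * (starRingEnd ℂ) (ψ j z.2)‖ ^ 2 : ℝ) : ℂ) =
      ∑ j ∈ J, ∑ k ∈ J, (ψ j z.1 * (starRingEnd ℂ) (ψ k z.1)) *
        (starRingEnd ℂ) (ψ j z.2 * (starRingEnd ℂ) (ψ k z.2)) := by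
    intro z
    rw [← Complex.normSq_eq_norm_sq, ← Complex.mul_conj, map_sum, Finset.sum_mul_sum]
    refine Finset.sum_congr rfl fun j _ => Finset.sum_congr rfl fun k _ => ?_
    simp only [map_mul, Complex.conj_conj]; ring
  have hc : ∀ j ∈ J, ∀ k ∈ J, Integrable (fun x => ψ j x * (starRingEnd ℂ) (ψ k x)) μ :=
    fun j hj k hk => (h2 j hj).integrable_mul (q := 2) (h2 k hk).star
  have hI : ∀ j ∈ J, ∀ k ∈ J, Integrable (fun z : X × X => (ψ j z.1 * (starRingEnd ℂ) (ψ k z.1)) *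
        (starRingEnd ℂ) (ψ j z.2 * (starRingEnd ℂ) (ψ k z.2))) (μ.prod μ) := fun j hj k hk =>
    (hc j hj k hk).mul_prod (Complex.conjLIE.integrable_comp_iff.2 (hc j hj k hk))
  rw [lintegral_enorm_sq_eq]
  · simp_rw [e]
    rw [integral_finsetSum _ fun j hj => integrable_finsetSum _ fun k hk => hI j hj k hk]
    have : ∀ j ∈ J, ∫ z : X × X, ∑ k ∈ J, (ψ j z.1 * (starRingEnd ℂ) (ψ k z.1)) *
        (starRingEnd ℂ) (ψ j z.2 * (starRingEnd ℂ) (ψ k z.2)) ∂(μ.prod μ) =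
        ∑ k ∈ J, ((‖∫ x, ψ j x * (starRingEnd ℂ) (ψ k x) ∂μ‖ ^ 2 : ℝ) : ℂ) := by
      intro j hj
      rw [integral_finsetSum _ fun k hk => hI j hj k hk]
      exact Finset.sum_congr rfl fun k hk =>
        integral_mul_conj_integral (fun x => ψ j x * (starRingEnd ℂ) (ψ k x))
    rw [Finset.sum_congr rfl this]
    simp_rw [← Complex.ofReal_sum]
    rw [← ofReal_norm, Complex.norm_real, norm_of_nonneg (by positivity),
      ENNReal.ofReal_sum_of_nonneg fun j _ => by positivity]
    refine Finset.sum_congr rfl fun j _ => ?_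
    rw [ENNReal.ofReal_sum_of_nonneg fun j _ => by positivity]
    refine Finset.sum_congr rfl fun k _ => ?_
    rw [ENNReal.ofReal_pow (norm_nonneg _), ofReal_norm]
  · simp_rw [e]
    exact integrable_finsetSum _ fun j hj => integrable_finsetSum _ fun k hk => hI j hj k hk

/-- The `TT*` estimate for a finite family supported on `E`. -/
lemma sum_lintegral_coeffInt_sq_le {ε L : ℝ} (hε : 0 < ε) {E : Set (ℝ × Rn n)}
    (hE : MeasurableSet E) (J : Finset ℕ) {ψ : ℕ → ℝ × Rn n → ℂ} (hm : ∀ j ∈ J, Measurable (ψ j))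
    (h1 : ∀ j ∈ J, Integrable (ψ j)) (h2 : ∀ j ∈ J, MemLp (ψ j) 2)
    (h0 : ∀ j ∈ J, ∀ z ∉ E, ψ j z = 0) :
    ∑ j ∈ J, ∫⁻ ξ, ‖coeffInt ε (ψ j) ξ‖ₑ ^ 2 ≤
      ENNReal.ofReal (2 * L) * (ENNReal.ofReal ((2 * π) ^ n) * ∑ j ∈ J, ∫⁻ z, ‖ψ j z‖ₑ ^ 2) +
      (∫⁻ z in (E ×ˢ E) ∩ (nearSet (Rn n) L)ᶜ, ‖kern ε (z.2.1 - z.1.1) (z.2.2 - z.1.2)‖ₑ ^ 2)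
          ^ (1 / 2 : ℝ) *
        (∑ j ∈ J, ∑ k ∈ J, ‖∫ z, ψ j z * (starRingEnd ℂ) (ψ k z)‖ₑ ^ 2) ^ (1 / 2 : ℝ) := by
  set K : (ℝ × Rn n) × (ℝ × Rn n) → ℂ := fun z => kern ε (z.2.1 - z.1.1) (z.2.2 - z.1.2) with hK
  have hKm : Measurable K := by unfold K kern; fun_prop
  set N := nearSet (Rn n) L
  have hN : MeasurableSet N := measurableSet_nearSet _ _
  have gram := fun j (hj : j ∈ J) A => integral_gram
    (k := fun (z : ℝ × Rn n) ξ => (starRingEnd ℂ) (wave ε z.1 z.2 ξ))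
    (w := fun ξ => rexp (-(ε / 2) * ‖ξ‖ ^ 2)) (h := ψ j) (μ := volume) (ν := (volume : Measure (Rn n)))
    (measurable_conj_wave ε) (fun z ξ => norm_conj_wave ε _ _ ξ) (integrable_exp_mul_self hε)
    (h1 j hj) A
  simp only [integral_conj_wave_mul hε] at gram
  have main : ∀ j ∈ J, ∫⁻ ξ, ‖coeffInt ε (ψ j) ξ‖ₑ ^ 2 =
      ‖∫ ξ, ((‖coeffInt ε (ψ j) ξ‖ ^ 2 : ℝ) : ℂ)‖ₑ ∧ ∫ ξ, ((‖coeffInt ε (ψ j) ξ‖ ^ 2 : ℝ) : ℂ) =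
      ∫ z, ψ j z.1 * (starRingEnd ℂ) (ψ j z.2) * K z ∂(volume.prod volume) := by
    intro j hj
    obtain ⟨i1, i2, e⟩ := gram j hj univ
    have e1 := fun ξ => integral_mul_conj_integral (μ := volume)
      (fun z : ℝ × Rn n => (starRingEnd ℂ) (wave ε z.1 z.2 ξ) * ψ j z)
    simp only [Measure.restrict_univ, e1] at i1 e
    exact ⟨lintegral_enorm_sq_eq i1, e⟩
  have step : ∑ j ∈ J, ∫⁻ ξ, ‖coeffInt ε (ψ j) ξ‖ₑ ^ 2 =
      ‖∑ j ∈ J, ∫ ξ, ((‖coeffInt ε (ψ j) ξ‖ ^ 2 : ℝ) : ℂ)‖ₑ := by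
    rw [Finset.sum_congr rfl fun j hj => (main j hj).1]
    simp_rw [integral_complex_ofReal, ← Complex.ofReal_sum, ← ofReal_norm, Complex.norm_real]
    have hp : ∀ j, 0 ≤ ∫ ξ, ‖coeffInt ε (ψ j) ξ‖ ^ 2 := fun j => integral_nonneg fun _ => by positivity
    rw [norm_of_nonneg (Finset.sum_nonneg fun j _ => hp j),
      ENNReal.ofReal_sum_of_nonneg fun j _ => hp j]
    exact Finset.sum_congr rfl fun j _ => by rw [norm_of_nonneg (hp j)]
  have hI : ∀ j ∈ J, Integrable (fun z => ψ j z.1 * (starRingEnd ℂ) (ψ j z.2) * K z)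
      (volume.prod volume) := fun j hj => (gram j hj univ).2.1
  rw [step, Finset.sum_congr rfl fun j hj => (main j hj).2.trans
    (integral_add_compl hN (hI j hj)).symm, Finset.sum_add_distrib]
  refine (enorm_add_le _ _).trans (add_le_add ?_ ?_)
  · refine (enorm_sum_le _ _).trans ?_
    rw [Finset.mul_sum, Finset.mul_sum]
    refine Finset.sum_le_sum fun j hj => ?_
    rw [← (gram j hj N).2.2]
    exact lintegral_near_le hε (hm j hj) (h1 j hj)
  · rw [← integral_finsetSum _ fun j hj => (hI j hj).integrableOn]
    set G : (ℝ × Rn n) × (ℝ × Rn n) → ℂ := fun z => ∑ j ∈ J, ψ j z.1 * (starRingEnd ℂ) (ψ j z.2)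
      with hG
    have hGm : Measurable G := by
      refine Finset.measurable_fun_sum _ fun j hj => ?_
      exact ((hm j hj).comp measurable_fst).mul
        (Complex.continuous_conj.measurable.comp ((hm j hj).comp measurable_snd))
    have hG0 : ∀ z ∉ E ×ˢ E, G z = 0 := by
      intro z hz
      refine Finset.sum_eq_zero fun j hj => ?_
      rw [mem_prod, not_and_or] at hz
      rcases hz with h | h <;> simp [h0 j hj _ h]
    calc _ ≤ ∫⁻ z in Nᶜ, ‖G z‖ₑ * ‖K z‖ₑ ∂(volume.prod volume) := by
          refine (enorm_integral_le_lintegral_enorm _).trans (lintegral_mono fun z => ?_)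
          rw [← Finset.sum_mul, enorm_mul]
      _ = ∫⁻ z, ‖G z‖ₑ * (((E ×ˢ E) ∩ Nᶜ).indicator (fun z => ‖K z‖ₑ) z) ∂(volume.prod volume) := by
          rw [← lintegral_indicator hN.compl]
          refine lintegral_congr fun z => ?_
          by_cases hz : z ∈ E ×ˢ E
          · by_cases hz' : z ∈ Nᶜ
            · rw [indicator_of_mem hz',
                indicator_of_mem (show z ∈ (E ×ˢ E) ∩ Nᶜ from ⟨hz, hz'⟩)]
            · rw [indicator_of_notMem hz',
                indicator_of_notMem (show z ∉ (E ×ˢ E) ∩ Nᶜ from fun h => hz' h.2), mul_zero]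
          · rw [hG0 z hz, enorm_zero, zero_mul]
            by_cases hz' : z ∈ Nᶜ
            · rw [indicator_of_mem hz', hG0 z hz, enorm_zero, zero_mul]
            · rw [indicator_of_notMem hz']
      _ ≤ (∫⁻ z, ‖G z‖ₑ ^ (2 : ℝ) ∂(volume.prod volume)) ^ (1 / 2 : ℝ) *
          (∫⁻ z, (((E ×ˢ E) ∩ Nᶜ).indicator (fun z => ‖K z‖ₑ) z) ^ (2 : ℝ) ∂(volume.prod volume))
            ^ (1 / 2 : ℝ) :=
          ENNReal.lintegral_mul_le_Lp_mul_Lq _ Real.HolderConjugate.two_two hGm.enorm.aemeasurable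
            (hKm.enorm.indicator ((hE.prod hE).inter hN.compl)).aemeasurable
      _ = _ := by
          rw [mul_comm]
          simp_rw [ENNReal.rpow_two]
          rw [lintegral_sum_mul_conj_sq J h2, ← lintegral_indicator ((hE.prod hE).inter hN.compl)]
          congr 2
          refine lintegral_congr fun z => ?_
          by_cases hz : z ∈ (E ×ˢ E) ∩ Nᶜ
          · rw [indicator_of_mem hz, indicator_of_mem hz]
          · rw [indicator_of_notMem hz, indicator_of_notMem hz]; simp

lemma enorm_integral_mul_conj_sq_le {X : Type*} [MeasurableSpace X] {μ : Measure X} {f g : X → ℂ}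
    (hf : AEStronglyMeasurable f μ) (hg : AEStronglyMeasurable g μ) :
    ‖∫ x, f x * (starRingEnd ℂ) (g x) ∂μ‖ₑ ≤
      (∫⁻ x, ‖f x‖ₑ ^ 2 ∂μ) ^ (1 / 2 : ℝ) * (∫⁻ x, ‖g x‖ₑ ^ 2 ∂μ) ^ (1 / 2 : ℝ) := by
  refine (enorm_integral_le_lintegral_enorm _).trans ?_
  have := ENNReal.lintegral_mul_le_Lp_mul_Lq μ Real.HolderConjugate.two_two hf.enorm hg.enorm
  simp only [ENNReal.rpow_two, Pi.mul_apply] at this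
  simpa only [enorm_mul, RCLike.enorm_conj] using this

/-- The adjoint relation between a kernel operator and its adjoint. -/
lemma integral_adjoint {X : Type*} [MeasurableSpace X] {μ : Measure X} [SFinite μ]
    {k : X → Rn n → ℂ} {w : Rn n → ℝ} (hk : Measurable fun z : X × Rn n => k z.1 z.2)
    (hkw : ∀ x ξ, ‖k x ξ‖ ≤ w ξ) (hw : MemLp w 2) {h : Rn n → ℂ} (hh : MemLp h 2)
    {ψ : X → ℂ} (hψ : Integrable ψ μ) :
    ∫ x, (∫ ξ, k x ξ * h ξ) * (starRingEnd ℂ) (ψ x) ∂μ =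
      ∫ ξ, h ξ * (starRingEnd ℂ) (∫ x, (starRingEnd ℂ) (k x ξ) * ψ x ∂μ) := by
  have hI : Integrable (Function.uncurry fun x ξ => k x ξ * h ξ * (starRingEnd ℂ) (ψ x))
      (μ.prod volume) := by
    refine (hψ.norm.mul_prod (hw.integrable_mul (q := 2) hh.norm)).mono' ?_
      (ae_of_all _ fun z => ?_)
    · exact (hk.aestronglyMeasurable.mul
        (hh.1.comp_quasiMeasurePreserving Measure.quasiMeasurePreserving_snd)).mul
        (Complex.continuous_conj.comp_aestronglyMeasurable
        (hψ.1.comp_quasiMeasurePreserving Measure.quasiMeasurePreserving_fst))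
    · simp only [Function.uncurry, norm_mul, RCLike.norm_conj, Pi.mul_apply]
      rw [mul_comm]
      gcongr
      exact hkw _ _
  simp_rw [← integral_mul_const]
  rw [integral_integral_swap hI]
  congr 1; ext ξ
  rw [← integral_conj, ← integral_const_mul]
  congr 1; ext x
  simp only [map_mul, Complex.conj_conj]; ring

/-- The damped extension operator. -/
def extOp (ε : ℝ) (h : Rn n → ℂ) (z : ℝ × Rn n) : ℂ := ∫ ξ, wave ε z.1 z.2 ξ * h ξ

lemma measurable_extOp (ε : ℝ) {h : Rn n → ℂ} (hh : Measurable h) : Measurable (extOp ε h) := by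
  have h1 : Measurable (fun w : (ℝ × Rn n) × Rn n => wave ε w.1.1 w.1.2 w.2 * h w.2) :=
    (continuous_wave ε).measurable.mul (hh.comp measurable_snd)
  exact (h1.stronglyMeasurable.integral_prod_right (ν := volume)).measurable

lemma norm_extOp_le (ε : ℝ) (h : Rn n → ℂ) :
    ∃ C : ℝ, ∀ z, ‖extOp ε h z‖ ≤ C := by
  refine ⟨∫ ξ, rexp (-(ε / 2) * ‖ξ‖ ^ 2) * ‖h ξ‖, fun z => ?_⟩
  refine (norm_integral_le_integral_norm _).trans (le_of_eq ?_)
  simp_rw [norm_mul, norm_wave]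

/-- A finite family in `L²` satisfying Bessel's inequality. -/
structure BesselFam (J : Finset ℕ) (h : ℕ → Rn n → ℂ) : Prop where
  meas : ∀ j ∈ J, Measurable (h j)
  memLp : ∀ j ∈ J, MemLp (h j) 2
  bessel : ∀ φ : Rn n → ℂ, MemLp φ 2 →
    ∑ j ∈ J, ‖∫ ξ, h j ξ * (starRingEnd ℂ) (φ ξ)‖ₑ ^ 2 ≤ ∫⁻ ξ, ‖φ ξ‖ₑ ^ 2

lemma BesselFam.sum_extOp_sq_le {J : Finset ℕ} {h : ℕ → Rn n → ℂ} (H : BesselFam J h) {ε : ℝ}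
    (hε : 0 < ε) (z : ℝ × Rn n) :
    ∑ j ∈ J, ‖extOp ε (h j) z‖ₑ ^ 2 ≤ ENNReal.ofReal ((π / ε) ^ ((n : ℝ) / 2)) := by
  have e : ∫⁻ ξ : Rn n, ‖(starRingEnd ℂ) (wave ε z.1 z.2 ξ)‖ₑ ^ 2 =
      ENNReal.ofReal ((π / ε) ^ ((n : ℝ) / 2)) := by
    have eg : ∫ v : Rn n, rexp (-ε * ‖v‖ ^ 2) = (π / ε) ^ ((n : ℝ) / 2) := by
      rw [GaussianFourier.integral_rexp_neg_mul_sq_norm hε, finrank_euclideanSpace_fin]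
    rw [← eg, ofReal_integral_eq_lintegral_ofReal (integrable_wave_sq hε)
        (ae_of_all _ fun _ => (exp_pos _).le)]
    congr 1; ext ξ
    rw [RCLike.enorm_conj, ← ofReal_norm, norm_wave, ← ENNReal.ofReal_pow (exp_pos _).le, sq,
      exp_half_sq]
  rw [← e]
  refine le_trans (le_of_eq ?_) (H.bessel _ (memLp_wave hε z.1 z.2).star)
  refine Finset.sum_congr rfl fun j _ => ?_
  simp only [extOp, Complex.conj_conj]
  simp_rw [mul_comm]

lemma le_of_le_mul_sqrt {S A : ℝ≥0∞} (hS : S ≠ ∞)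
    (h : S ≤ A ^ (1 / 2 : ℝ) * S ^ (1 / 2 : ℝ)) : S ≤ A := by
  rcases eq_or_ne S 0 with rfl | h0
  · simp
  have h1 : S ^ (1 / 2 : ℝ) ≠ 0 := by simp [h0, hS]
  have h2 : S ^ (1 / 2 : ℝ) ≠ ∞ := by simp [h0, hS]
  have h3 : S ^ (1 / 2 : ℝ) * S ^ (1 / 2 : ℝ) = S := by
    rw [← ENNReal.rpow_add _ _ h0 hS]; norm_num
  have h4 : S ^ (1 / 2 : ℝ) ≤ A ^ (1 / 2 : ℝ) := by
    rw [← ENNReal.mul_le_mul_iff_left h1 h2, h3]; exact h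
  exact (ENNReal.rpow_le_rpow_iff (by norm_num)).1 h4

lemma lintegral_mul_self_conj {X : Type*} [MeasurableSpace X] {μ : Measure X} {g : X → ℂ}
    (hg : MemLp g 2 μ) : ∫⁻ x, ‖g x‖ₑ ^ 2 ∂μ = ‖∫ x, g x * (starRingEnd ℂ) (g x) ∂μ‖ₑ := by
  have e : ∀ x, g x * (starRingEnd ℂ) (g x) = ((‖g x‖ ^ 2 : ℝ) : ℂ) := fun x => by
    rw [Complex.mul_conj, Complex.normSq_eq_norm_sq]
  simp_rw [e]
  refine lintegral_enorm_sq_eq ?_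
  simp_rw [← e]
  exact hg.integrable_mul (q := 2) hg.star

lemma memLp_indicator_of_bdd {X : Type*} [MeasurableSpace X] {μ : Measure X} {g : X → ℂ}
    (hg : Measurable g) {C : ℝ} (hC : ∀ x, ‖g x‖ ≤ C) {E : Set X} (hE : MeasurableSet E)
    (hμ : μ E ≠ ∞) (p : ℝ≥0∞) : MemLp (E.indicator g) p μ := by
  rw [memLp_indicator_iff_restrict hE]
  have : IsFiniteMeasure (μ.restrict E) := ⟨by simpa using hμ.lt_top⟩
  exact MemLp.of_bound hg.aestronglyMeasurable C (ae_of_all _ hC)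

lemma integral_indicator_conj_indicator {X : Type*} [MeasurableSpace X] {μ : Measure X} (E : Set X)
    (f g : X → ℂ) : ∫ x, E.indicator f x * (starRingEnd ℂ) (E.indicator g x) ∂μ =
      ∫ x, f x * (starRingEnd ℂ) (E.indicator g x) ∂μ := by
  congr 1; ext x
  by_cases h : x ∈ E <;> simp [h]

/-- Fixed-time `L²` bound. -/
lemma lintegral_extOp_slice_le {ε : ℝ} (hε : 0 < ε) {h : Rn n → ℂ} (hm : Measurable h)
    (hh : MemLp h 2) (t : ℝ) :
    ∫⁻ x, ‖extOp ε h (t, x)‖ₑ ^ 2 ≤ ENNReal.ofReal ((2 * π) ^ n) * ∫⁻ ξ, ‖h ξ‖ₑ ^ 2 := by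
  obtain ⟨C, hC⟩ := norm_extOp_le ε h
  have hum : Measurable fun x => extOp ε h (t, x) := (measurable_extOp ε hm).comp measurable_prodMk_left
  have key : ∀ R : ℕ, ∫⁻ x in Metric.ball (0 : Rn n) R, ‖extOp ε h (t, x)‖ₑ ^ 2 ≤
      ENNReal.ofReal ((2 * π) ^ n) * ∫⁻ ξ, ‖h ξ‖ₑ ^ 2 := by
    intro R
    set B := Metric.ball (0 : Rn n) R
    have hB : MeasurableSet B := measurableSet_ball
    have hBf : volume B ≠ ∞ := measure_ball_lt_top.ne
    set ψ := B.indicator fun x => extOp ε h (t, x) with hψ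
    have p1 : Integrable ψ := memLp_one_iff_integrable.1
      (memLp_indicator_of_bdd hum (fun x => hC _) hB hBf 1)
    have p2 : MemLp ψ 2 := memLp_indicator_of_bdd hum (fun x => hC _) hB hBf 2
    have e0 : ∫⁻ x in B, ‖extOp ε h (t, x)‖ₑ ^ 2 = ∫⁻ x, ‖ψ x‖ₑ ^ 2 := by
      rw [← lintegral_indicator hB]
      refine lintegral_congr fun x => ?_
      by_cases hx : x ∈ B <;> simp [hψ, hx]
    have hfin : ∫⁻ x, ‖ψ x‖ₑ ^ 2 ≠ ∞ := by
      have := (memLp_two_iff_integrable_sq_norm p2.1).1 p2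
      have h2 := this.2
      simpa [HasFiniteIntegral, enorm_pow] using h2.ne
    rw [e0]
    refine le_of_le_mul_sqrt hfin ?_
    have hkm : Measurable fun z : Rn n × Rn n => wave ε t z.1 z.2 :=
      (continuous_wave ε).measurable.comp (g := fun z : (ℝ × Rn n) × Rn n => _)
        (f := fun z : Rn n × Rn n => ((t, z.1), z.2)) (by fun_prop)
    have ham : Measurable fun ξ => ∫ x, (starRingEnd ℂ) (wave ε t x ξ) * ψ x := by
      have h1 : Measurable (fun w : Rn n × Rn n => (starRingEnd ℂ) (wave ε t w.2 w.1) * ψ w.2) :=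
        (Complex.continuous_conj.measurable.comp (hkm.comp measurable_swap)).mul
          ((hum.indicator hB).comp measurable_snd)
      exact (h1.stronglyMeasurable.integral_prod_right (ν := volume)).measurable
    calc ∫⁻ x, ‖ψ x‖ₑ ^ 2 = ‖∫ x, ψ x * (starRingEnd ℂ) (ψ x)‖ₑ := lintegral_mul_self_conj p2
      _ = ‖∫ ξ, h ξ * (starRingEnd ℂ) (∫ x, (starRingEnd ℂ) (wave ε t x ξ) * ψ x)‖ₑ := by
        rw [hψ, integral_indicator_conj_indicator, ← hψ]
        rw [← integral_adjoint hkm (fun x ξ => (norm_wave ε t x ξ).le) (memLp_exp hε) hh p1]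
        rfl
      _ ≤ (∫⁻ ξ, ‖h ξ‖ₑ ^ 2) ^ (1 / 2 : ℝ) *
          (ENNReal.ofReal ((2 * π) ^ n) * ∫⁻ x, ‖ψ x‖ₑ ^ 2) ^ (1 / 2 : ℝ) := by
        refine (enorm_integral_mul_conj_sq_le hh.1 ham.aestronglyMeasurable).trans ?_
        gcongr
        exact lintegral_slice_le hε t p1
      _ = _ := by
        rw [ENNReal.mul_rpow_of_nonneg _ _ (by norm_num), ENNReal.mul_rpow_of_nonneg _ _ (by norm_num)]
        ring
  have hU : ⋃ R : ℕ, Metric.ball (0 : Rn n) R = univ := by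
    ext x
    obtain ⟨R, hR⟩ := exists_nat_gt ‖x‖
    simp only [mem_iUnion, mem_univ, iff_true]
    exact ⟨R, by simpa using hR⟩
  rw [← setLIntegral_univ, ← hU, setLIntegral_iUnion_of_directed]
  · exact iSup_le key
  · exact Monotone.directed_le fun a b hab => Metric.ball_subset_ball (by exact_mod_cast hab)

lemma BesselFam.sum_setLIntegral_le_time {J : Finset ℕ} {h : ℕ → Rn n → ℂ} (H : BesselFam J h)
    {ε : ℝ} (hε : 0 < ε) {E : Set (ℝ × Rn n)} {F : Set ℝ}
    (hEF : E ⊆ F ×ˢ univ) :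
    ∑ j ∈ J, ∫⁻ z in E, ‖extOp ε (h j) z‖ₑ ^ 2 ≤
      ENNReal.ofReal ((2 * π) ^ n) * (volume F * ∑ j ∈ J, ∫⁻ ξ, ‖h j ξ‖ₑ ^ 2) := by
  rw [Finset.mul_sum, Finset.mul_sum]
  refine Finset.sum_le_sum fun j hj => ?_
  calc ∫⁻ z in E, ‖extOp ε (h j) z‖ₑ ^ 2 ≤ ∫⁻ z in F ×ˢ univ, ‖extOp ε (h j) z‖ₑ ^ 2 :=
        lintegral_mono_set hEF
    _ = ∫⁻ t in F, ∫⁻ x, ‖extOp ε (h j) (t, x)‖ₑ ^ 2 := by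
        rw [Measure.volume_eq_prod, ← Measure.prod_restrict, Measure.restrict_univ,
          lintegral_prod _ ((measurable_extOp ε (H.meas j hj)).enorm.pow_const 2).aemeasurable]
    _ ≤ ∫⁻ t in F, ENNReal.ofReal ((2 * π) ^ n) * ∫⁻ ξ, ‖h j ξ‖ₑ ^ 2 :=
        lintegral_mono fun t => lintegral_extOp_slice_le hε (H.meas j hj) (H.memLp j hj) t
    _ = _ := by rw [lintegral_const, Measure.restrict_apply_univ]; ring

lemma lintegral_far_le (hn : 2 ≤ n) {L : ℝ} (hL : 0 < L) :
    ∫⁻ τ : ℝ, {τ : ℝ | L < |τ|}.indicator (fun τ => ENNReal.ofReal ((π / |τ|) ^ n)) τ ≤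
      ENNReal.ofReal (2 * π ^ n * L ^ (1 - (n : ℝ))) := by
  have hn' : (2 : ℝ) ≤ n := by exact_mod_cast hn
  have hset : {τ : ℝ | L < |τ|} = Iio (-L) ∪ Ioi L := by
    ext τ; simp only [Set.mem_ofPred_eq, lt_abs, mem_union, mem_Iio, mem_Ioi]
    constructor <;> rintro (h | h)
    · exact Or.inr h
    · left; linarith
    · right; linarith
    · exact Or.inl h
  have hms : MeasurableSet {τ : ℝ | L < |τ|} := measurableSet_lt measurable_const (by fun_prop)
  have h1 : ∫⁻ τ in Ioi L, ENNReal.ofReal ((π / |τ|) ^ n) ≤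
      ENNReal.ofReal (π ^ n * L ^ (1 - (n : ℝ))) := by
    have hi := integrableOn_Ioi_rpow_of_lt (a := -(n : ℝ)) (by linarith) hL
    have e : ∫⁻ τ in Ioi L, ENNReal.ofReal ((π / |τ|) ^ n) =
        ∫⁻ τ in Ioi L, ENNReal.ofReal (π ^ n * τ ^ (-(n : ℝ))) := by
      refine setLIntegral_congr_fun measurableSet_Ioi fun τ hτ => ?_
      have hτ0 : 0 < τ := hL.trans hτ
      rw [abs_of_pos hτ0, div_pow, Real.rpow_neg hτ0.le, Real.rpow_natCast, div_eq_mul_inv]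
    rw [e, ← ofReal_integral_eq_lintegral_ofReal (hi.const_mul _)]
    · rw [integral_const_mul, integral_Ioi_rpow_of_lt (by linarith) hL]
      refine ENNReal.ofReal_le_ofReal (mul_le_mul_of_nonneg_left ?_ (by positivity))
      rw [show -L ^ (-(n : ℝ) + 1) / (-(n : ℝ) + 1) = L ^ (1 - (n : ℝ)) / (n - 1) by
        rw [show -(n : ℝ) + 1 = 1 - n by ring, ← neg_div_neg_eq]; congr 1 <;> ring]
      exact div_le_self (by positivity) (by linarith)
    · refine (ae_restrict_iff' measurableSet_Ioi).2 (ae_of_all _ fun τ hτ => ?_)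
      have hτ0 : 0 < τ := hL.trans hτ
      exact mul_nonneg (by positivity) (Real.rpow_nonneg hτ0.le _)
  have h2 : ∫⁻ τ in Iio (-L), ENNReal.ofReal ((π / |τ|) ^ n) =
      ∫⁻ τ in Ioi L, ENNReal.ofReal ((π / |τ|) ^ n) := by
    rw [← lintegral_indicator measurableSet_Iio, ← lintegral_indicator measurableSet_Ioi,
      ← lintegral_neg_eq_self]
    refine lintegral_congr fun τ => ?_
    by_cases h : L < τ
    · rw [indicator_of_mem (by simpa using h), indicator_of_mem (by simpa using h), abs_neg]
    · rw [indicator_of_notMem (by simpa using h), indicator_of_notMem (by simpa using h)]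
  rw [lintegral_indicator hms, hset]
  refine (lintegral_union_le _ _ _).trans ?_
  rw [h2, ← two_mul]
  calc _ ≤ 2 * ENNReal.ofReal (π ^ n * L ^ (1 - (n : ℝ))) := by gcongr
    _ = _ := by
      rw [mul_assoc, ENNReal.ofReal_mul (by norm_num : (0:ℝ) ≤ 2), ENNReal.ofReal_ofNat]

lemma lintegral_kern_far_le (hn : 2 ≤ n) {ε L : ℝ} (hε : 0 < ε) (hL : 0 < L)
    {E : Set (ℝ × Rn n)} (hE : MeasurableSet E) {m : ℝ≥0∞} (hm : ∀ t, volume (Prod.mk t ⁻¹' E) ≤ m) :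
    ∫⁻ z in (E ×ˢ E) ∩ (nearSet (Rn n) L)ᶜ, ‖kern ε (z.2.1 - z.1.1) (z.2.2 - z.1.2)‖ₑ ^ 2 ≤
      ENNReal.ofReal (2 * π ^ n * L ^ (1 - (n : ℝ))) * (m * volume E) := by
  have hN : MeasurableSet (nearSet (Rn n) L)ᶜ := (measurableSet_nearSet _ _).compl
  set g : ℝ → ℝ≥0∞ := {τ : ℝ | L < |τ|}.indicator (fun τ => ENNReal.ofReal ((π / |τ|) ^ n)) with hg
  have hgm : Measurable g :=
    Measurable.indicator (by fun_prop) (measurableSet_lt measurable_const (by fun_prop))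
  have hpt : ∀ z : (ℝ × Rn n) × (ℝ × Rn n), ((E ×ˢ E) ∩ (nearSet (Rn n) L)ᶜ).indicator
      (fun z => ‖kern ε (z.2.1 - z.1.1) (z.2.2 - z.1.2)‖ₑ ^ 2) z ≤
      E.indicator 1 z.1 * (g (z.2.1 - z.1.1) * E.indicator 1 z.2) := by
    intro z
    by_cases hz : z ∈ (E ×ˢ E) ∩ (nearSet (Rn n) L)ᶜ
    · have hL' : L < |z.2.1 - z.1.1| := by
        have := hz.2
        simp only [nearSet, mem_compl_iff, Set.mem_ofPred_eq, not_le] at this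
        rwa [abs_sub_comm]
      have hL2 : z.2.1 - z.1.1 ∈ {τ : ℝ | L < |τ|} := hL'
      rw [indicator_of_mem hz, indicator_of_mem hz.1.1, indicator_of_mem hz.1.2, hg,
        indicator_of_mem hL2]
      simp only [Pi.one_apply, one_mul, mul_one]
      have h0 : z.2.1 - z.1.1 ≠ 0 := fun h => by rw [h] at hL'; simp at hL'; linarith
      rw [← ofReal_norm, ← ENNReal.ofReal_pow (norm_nonneg _)]
      refine ENNReal.ofReal_le_ofReal ?_
      calc _ ≤ ((π / |z.2.1 - z.1.1|) ^ ((n : ℝ) / 2)) ^ 2 := by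
            gcongr; exact norm_kern_le hε h0 _
        _ = _ := by
            rw [← Real.rpow_natCast, ← Real.rpow_mul (by positivity), ← Real.rpow_natCast]
            congr 1; push_cast; ring
    · rw [indicator_of_notMem hz]; exact zero_le
  have hm1 : Measurable fun z : (ℝ × Rn n) × (ℝ × Rn n) =>
      E.indicator (1 : ℝ × Rn n → ℝ≥0∞) z.1 * (g (z.2.1 - z.1.1) * E.indicator 1 z.2) := by
    have := (measurable_one (α := ℝ≥0∞) (β := ℝ × Rn n)).indicator hE
    fun_prop
  have hm2 : ∀ z : ℝ × Rn n, Measurable fun z' : ℝ × Rn n =>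
      g (z'.1 - z.1) * E.indicator (1 : ℝ × Rn n → ℝ≥0∞) z' := fun z =>
    (hgm.comp (measurable_fst.sub_const _)).mul (measurable_one.indicator hE)
  rw [← lintegral_indicator ((hE.prod hE).inter hN)]
  calc _ ≤ ∫⁻ z : (ℝ × Rn n) × (ℝ × Rn n),
        E.indicator 1 z.1 * (g (z.2.1 - z.1.1) * E.indicator 1 z.2) := lintegral_mono hpt
    _ = ∫⁻ z : ℝ × Rn n, E.indicator 1 z * ∫⁻ z' : ℝ × Rn n, g (z'.1 - z.1) * E.indicator 1 z' := by
        rw [Measure.volume_eq_prod, lintegral_prod _ hm1.aemeasurable]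
        refine lintegral_congr fun z => ?_
        exact lintegral_const_mul (μ := (volume : Measure ℝ).prod (volume : Measure (Rn n)))
          (E.indicator 1 z) (hm2 z)
    _ ≤ ∫⁻ z : ℝ × Rn n, E.indicator 1 z *
          (ENNReal.ofReal (2 * π ^ n * L ^ (1 - (n : ℝ))) * m) := by
        refine lintegral_mono fun z => mul_le_mul_right ?_ _
        rw [Measure.volume_eq_prod, lintegral_prod _ (hm2 z).aemeasurable]
        calc _ ≤ ∫⁻ t, g (t - z.1) * m := by
              refine lintegral_mono fun t => ?_
              simp only
              have h3 : Measurable fun y : Rn n => E.indicator (1 : ℝ × Rn n → ℝ≥0∞) (t, y) :=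
                (measurable_one.indicator hE).comp measurable_prodMk_left
              rw [lintegral_const_mul _ h3]
              refine mul_le_mul_right (le_trans (le_of_eq ?_) (hm t)) _
              rw [← lintegral_indicator_one (measurable_prodMk_left hE)]
              rfl
          _ = (∫⁻ t, g t) * m := by
              have h3 : Measurable fun t => g (t - z.1) := hgm.comp (measurable_id.sub_const _)
              rw [lintegral_mul_const _ h3,
                lintegral_sub_right_eq_self (fun t => g t)]
          _ ≤ _ := by gcongr; exact lintegral_far_le hn hL
    _ = _ := by
        rw [lintegral_mul_const _ (measurable_one.indicator hE), lintegral_indicator_one hE]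
        ring

lemma measurable_coeffInt (ε : ℝ) {ψ : ℝ × Rn n → ℂ} (hψ : Measurable ψ) :
    Measurable (coeffInt ε ψ) := by
  have h1 : Measurable fun z : Rn n × (ℝ × Rn n) =>
      (starRingEnd ℂ) (wave ε z.2.1 z.2.2 z.1) * ψ z.2 := by
    have h : Measurable fun z : Rn n × (ℝ × Rn n) => wave ε z.2.1 z.2.2 z.1 :=
      ((continuous_wave ε).comp (continuous_snd.prodMk continuous_fst)).measurable
    exact (Complex.continuous_conj.measurable.comp h).mul (hψ.comp measurable_snd)
  exact (h1.stronglyMeasurable.integral_prod_right (ν := (volume : Measure (ℝ × Rn n)))).measurable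

lemma memLp_coeffInt {ε : ℝ} (hε : 0 < ε) {ψ : ℝ × Rn n → ℂ} (hψ : Measurable ψ) :
    MemLp (coeffInt ε ψ) 2 := by
  refine ((memLp_exp (n := n) hε).const_mul (∫ z, ‖ψ z‖)).mono
    (measurable_coeffInt ε hψ).aestronglyMeasurable (ae_of_all _ fun ξ => ?_)
  calc ‖coeffInt ε ψ ξ‖ ≤ ∫ z : ℝ × Rn n, ‖(starRingEnd ℂ) (wave ε z.1 z.2 ξ) * ψ z‖ :=
        norm_integral_le_integral_norm _
    _ = ∫ z : ℝ × Rn n, rexp (-(ε / 2) * ‖ξ‖ ^ 2) * ‖ψ z‖ := by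
        simp only [norm_mul, RCLike.norm_conj, norm_wave]
    _ = rexp (-(ε / 2) * ‖ξ‖ ^ 2) * ∫ z, ‖ψ z‖ := integral_const_mul _ _
    _ ≤ _ := by rw [mul_comm]; exact Real.le_norm_self _

lemma integral_extOp_mul_conj {ε : ℝ} (hε : 0 < ε) {h : Rn n → ℂ} (hh : MemLp h 2)
    {ψ : ℝ × Rn n → ℂ} (hψ : Integrable ψ) :
    ∫ z, extOp ε h z * (starRingEnd ℂ) (ψ z) = ∫ ξ, h ξ * (starRingEnd ℂ) (coeffInt ε ψ ξ) :=
  integral_adjoint (X := ℝ × Rn n) (k := fun z ξ => wave ε z.1 z.2 ξ)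
    (continuous_wave ε).measurable (fun z ξ => (norm_wave ε z.1 z.2 ξ).le) (memLp_exp hε) hh hψ

/-- If `R ≤ X + √(B R)` then `R ≤ 2 X + B`. -/
lemma le_of_le_add_mul_sqrt {R X B : ℝ≥0∞} (hR : R ≠ ∞)
    (h : R ≤ X + B ^ (1 / 2 : ℝ) * R ^ (1 / 2 : ℝ)) : R ≤ 2 * X + B := by
  by_cases hX : X = ∞
  · simp [hX]
  by_cases hB : B = ∞
  · simp [hB]
  lift R to NNReal using hR
  lift X to NNReal using hX
  lift B to NNReal using hB
  rw [← ENNReal.coe_rpow_of_nonneg _ (by norm_num), ← ENNReal.coe_rpow_of_nonneg _ (by norm_num)] at h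
  norm_cast at h ⊢
  rw [← NNReal.coe_le_coe] at h ⊢
  push_cast at h ⊢
  have hs := Real.sqrt_nonneg (B : ℝ)
  have hr := Real.sqrt_nonneg (R : ℝ)
  rw [← Real.sqrt_eq_rpow, ← Real.sqrt_eq_rpow] at h
  nlinarith [Real.sq_sqrt B.coe_nonneg, Real.sq_sqrt R.coe_nonneg,
    sq_nonneg (√(B : ℝ) - √(R : ℝ))]

lemma BesselFam.sum_setLIntegral_sq_le {J : Finset ℕ} {h : ℕ → Rn n → ℂ} (H : BesselFam J h)
    (hn : 2 ≤ n) {ε : ℝ} (hε : 0 < ε) {E : Set (ℝ × Rn n)} (hE : MeasurableSet E)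
    (hEf : volume E ≠ ∞) {m : ℝ≥0∞} (hm : ∀ t, volume (Prod.mk t ⁻¹' E) ≤ m) {L : ℝ} (hL : 0 < L) :
    (∑ j ∈ J, ∫⁻ z in E, ‖extOp ε (h j) z‖ₑ ^ 2) ^ 2 ≤
      (∑ j ∈ J, ∫⁻ ξ, ‖h j ξ‖ₑ ^ 2) *
      (ENNReal.ofReal (4 * (2 * π) ^ n * L) * (∑ j ∈ J, ∫⁻ z in E, ‖extOp ε (h j) z‖ₑ ^ 2) +
        ENNReal.ofReal (2 * π ^ n * L ^ (1 - (n : ℝ))) * (m * volume E)) := by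
  set ψ : ℕ → ℝ × Rn n → ℂ := fun j => E.indicator (extOp ε (h j)) with hψ
  have hmem : ∀ j ∈ J, ∀ p, MemLp (ψ j) p := fun j hj p => by
    obtain ⟨C, hC⟩ := norm_extOp_le ε (h j)
    exact memLp_indicator_of_bdd (measurable_extOp ε (H.meas j hj)) hC hE hEf p
  have hme : ∀ j ∈ J, Measurable (ψ j) := fun j hj => (measurable_extOp ε (H.meas j hj)).indicator hE
  have hint : ∀ j ∈ J, Integrable (ψ j) := fun j hj => memLp_one_iff_integrable.1 (hmem j hj 1)
  have hS : ∀ j, ∫⁻ z in E, ‖extOp ε (h j) z‖ₑ ^ 2 = ∫⁻ z, ‖ψ j z‖ₑ ^ 2 := fun j => by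
    rw [← lintegral_indicator hE]
    refine lintegral_congr fun z => ?_
    by_cases hz : z ∈ E <;> simp [hψ, hz]
  simp only [hS]
  set a : ℕ → Rn n → ℂ := fun j => coeffInt ε (ψ j) with ha
  have hamem : ∀ j ∈ J, MemLp (a j) 2 := fun j hj => memLp_coeffInt hε (hme j hj)
  set ν := ∑ j ∈ J, ∫⁻ ξ, ‖h j ξ‖ₑ ^ 2
  set S := ∑ j ∈ J, ∫⁻ z, ‖ψ j z‖ₑ ^ 2 with hSdef
  set R := ∑ j ∈ J, ∫⁻ ξ, ‖a j ξ‖ₑ ^ 2 with hR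
  have hRf : R ≠ ∞ := by
    refine ENNReal.sum_ne_top.2 fun j hj => ?_
    have := (hamem j hj).eLpNorm_lt_top
    rw [eLpNorm_lt_top_iff_lintegral_rpow_enorm_lt_top (by norm_num) (by norm_num)] at this
    simpa using this.ne
  have hSR : S ≤ ν ^ (1 / 2 : ℝ) * R ^ (1 / 2 : ℝ) := by
    calc S ≤ ∑ j ∈ J, (∫⁻ ξ, ‖h j ξ‖ₑ ^ 2) ^ (1 / 2 : ℝ) * (∫⁻ ξ, ‖a j ξ‖ₑ ^ 2) ^ (1 / 2 : ℝ) := by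
          refine Finset.sum_le_sum fun j hj => ?_
          rw [lintegral_mul_self_conj (hmem j hj 2)]
          simp only [hψ]
          rw [integral_indicator_conj_indicator]
          rw [integral_extOp_mul_conj hε (H.memLp j hj) (hint j hj)]
          exact enorm_integral_mul_conj_sq_le (H.memLp j hj).1 (hamem j hj).1
      _ ≤ (∑ j ∈ J, ((∫⁻ ξ, ‖h j ξ‖ₑ ^ 2) ^ (1 / 2 : ℝ)) ^ (2 : ℝ)) ^ (1 / 2 : ℝ) *
          (∑ j ∈ J, ((∫⁻ ξ, ‖a j ξ‖ₑ ^ 2) ^ (1 / 2 : ℝ)) ^ (2 : ℝ)) ^ (1 / 2 : ℝ) :=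
          ENNReal.inner_le_Lp_mul_Lq J _ _ Real.HolderConjugate.two_two
      _ = _ := by
          simp only [← ENNReal.rpow_mul]
          norm_num
          rfl
  have hgram : ∑ j ∈ J, ∑ k ∈ J, ‖∫ z, ψ j z * (starRingEnd ℂ) (ψ k z)‖ₑ ^ 2 ≤ R := by
    rw [Finset.sum_comm, hR]
    refine Finset.sum_le_sum fun k hk => ?_
    refine le_trans (le_of_eq (Finset.sum_congr rfl fun j hj => ?_)) (H.bessel (a k) (hamem k hk))
    rw [← integral_extOp_mul_conj hε (H.memLp j hj) (hint k hk)]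
    simp only [hψ]
    rw [integral_indicator_conj_indicator]
  have hRle := sum_lintegral_coeffInt_sq_le (L := L) hε hE J hme hint
    (fun j hj => hmem j hj 2) (fun j _ z hz => indicator_of_notMem hz _)
  have hR2 : R ≤ 2 * (ENNReal.ofReal (2 * L) * (ENNReal.ofReal ((2 * π) ^ n) * S)) +
      ENNReal.ofReal (2 * π ^ n * L ^ (1 - (n : ℝ))) * (m * volume E) := by
    refine le_of_le_add_mul_sqrt hRf (hRle.trans ?_)
    gcongr
    exact lintegral_kern_far_le hn hε hL hE hm
  calc S ^ 2 ≤ (ν ^ (1 / 2 : ℝ) * R ^ (1 / 2 : ℝ)) ^ 2 := by gcongr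
    _ = ν * R := by
        rw [mul_pow, ← ENNReal.rpow_natCast, ← ENNReal.rpow_natCast, ← ENNReal.rpow_mul,
          ← ENNReal.rpow_mul]
        norm_num
    _ ≤ _ := by
        refine mul_le_mul_right (hR2.trans (le_of_eq ?_)) _
        congr 1
        have hL2 : 0 ≤ 2 * L := by positivity
        rw [show 4 * (2 * π) ^ n * L = 2 * ((2 * L) * (2 * π) ^ n) by ring,
          ENNReal.ofReal_mul (q := 2 * L * (2 * π) ^ n) (by norm_num : (0:ℝ) ≤ 2),
          ENNReal.ofReal_mul hL2,
          ENNReal.ofReal_ofNat]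
        ring

/-- The constant in the space-time local estimate. -/
def cA (n : ℕ) : ℝ := 4 * (2 * π) ^ n + 2 * π ^ n + 1

lemma cA_pos (n : ℕ) : 0 < cA n := by unfold cA; positivity

lemma le_of_forall_sq_le (hn : 2 ≤ n) {S ν M : ℝ} (hS : 0 ≤ S) (hν : 0 ≤ ν) (hM : 0 ≤ M)
    (h : ∀ L : ℝ, 0 < L →
      S ^ 2 ≤ ν * (4 * (2 * π) ^ n * L * S + 2 * π ^ n * L ^ (1 - (n : ℝ)) * M)) :
    S ≤ cA n * ν ^ ((n : ℝ) / (n + 1)) * M ^ (1 / ((n : ℝ) + 1)) := by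
  have hn' : (0 : ℝ) < n + 1 := by positivity
  have hn0 : (n : ℝ) ≠ 0 := by positivity
  rcases hν.eq_or_lt with rfl | hν
  · have := h 1 one_pos
    rw [Real.zero_rpow (by positivity)]
    nlinarith
  rcases hM.eq_or_lt with rfl | hM
  · rw [Real.zero_rpow (by positivity), mul_zero]
    by_contra! hS0
    have hc : 0 < ν * (4 * (2 * π) ^ n) := by positivity
    have := h (S / (2 * (ν * (4 * (2 * π) ^ n)))) (by positivity)
    have e : ν * (4 * (2 * π) ^ n * (S / (2 * (ν * (4 * (2 * π) ^ n)))) * S) = S ^ 2 / 2 := by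
      field_simp
    rw [mul_zero, add_zero, e] at this
    nlinarith
  set L := (M / ν) ^ (1 / ((n : ℝ) + 1)) with hL
  have hLpos : 0 < L := by positivity
  have hLn : L ^ ((n : ℝ) + 1) = M / ν := by
    rw [hL, ← Real.rpow_mul (by positivity), one_div_mul_cancel hn'.ne', Real.rpow_one]
  have hT : ν * L = ν ^ ((n : ℝ) / (n + 1)) * M ^ (1 / ((n : ℝ) + 1)) := by
    rw [hL, Real.div_rpow hM.le hν.le]
    rw [show (n : ℝ) / (n + 1) = 1 - 1 / (n + 1) by field_simp; ring, Real.rpow_sub hν, Real.rpow_one]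
    ring
  have hM2 : L ^ (1 - (n : ℝ)) * M = ν * L ^ 2 := by
    have : M = ν * L ^ ((n : ℝ) + 1) := by rw [hLn]; field_simp
    rw [this, mul_left_comm, ← Real.rpow_add hLpos, ← Real.rpow_natCast]
    congr 2; push_cast; ring
  rw [mul_assoc, ← hT]
  have hTpos : 0 < ν * L := by positivity
  have hh := h L hLpos
  have e : ν * (4 * (2 * π) ^ n * L * S + 2 * π ^ n * L ^ (1 - (n : ℝ)) * M) =
      4 * (2 * π) ^ n * (ν * L) * S + 2 * π ^ n * (ν * L) ^ 2 := by
    rw [mul_assoc (2 * π ^ n), hM2]; ring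
  rw [e] at hh
  generalize ν * L = T at *
  have c1 : 0 < 4 * (2 * π) ^ n := by positivity
  have c2 : 0 < 2 * π ^ n := by positivity
  unfold cA
  generalize 4 * (2 * π) ^ n = c at *
  generalize 2 * π ^ n = d at *
  by_contra! hlt
  have hTS : T ≤ S := by nlinarith [mul_pos c1 hTpos, mul_pos c2 hTpos]
  nlinarith [mul_nonneg c2.le (mul_nonneg hTpos.le (sub_nonneg.2 hTS))]

lemma BesselFam.sum_setLIntegral_le {J : Finset ℕ} {h : ℕ → Rn n → ℂ} (H : BesselFam J h)
    (hn : 2 ≤ n) {ε : ℝ} (hε : 0 < ε) {E : Set (ℝ × Rn n)} (hE : MeasurableSet E)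
    (hEf : volume E ≠ ∞) {m : ℝ≥0∞} (hmf : m ≠ ∞) (hm : ∀ t, volume (Prod.mk t ⁻¹' E) ≤ m) :
    ∑ j ∈ J, ∫⁻ z in E, ‖extOp ε (h j) z‖ₑ ^ 2 ≤
      ENNReal.ofReal (cA n) * (∑ j ∈ J, ∫⁻ ξ, ‖h j ξ‖ₑ ^ 2) ^ ((n : ℝ) / (n + 1)) *
        (m * volume E) ^ (1 / ((n : ℝ) + 1)) := by
  have hS : ∑ j ∈ J, ∫⁻ z in E, ‖extOp ε (h j) z‖ₑ ^ 2 ≠ ∞ := by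
    refine ENNReal.sum_ne_top.2 fun j _ => ?_
    obtain ⟨C, hC⟩ := norm_extOp_le ε (h j)
    refine ((setLIntegral_mono measurable_const fun z _ =>
      pow_le_pow_left' (enorm_le_coe (r := C.toNNReal) |>.2 ?_) 2).trans_lt ?_).ne
    · rw [← NNReal.coe_le_coe, coe_nnnorm]; exact (hC z).trans (Real.le_coe_toNNReal C)
    · rw [setLIntegral_const]
      exact ENNReal.mul_lt_top (by simp) hEf.lt_top
  have hν : ∑ j ∈ J, ∫⁻ ξ, ‖h j ξ‖ₑ ^ 2 ≠ ∞ := by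
    refine ENNReal.sum_ne_top.2 fun j hj => ?_
    have := (H.memLp j hj).eLpNorm_lt_top
    rw [eLpNorm_lt_top_iff_lintegral_rpow_enorm_lt_top (by norm_num) (by norm_num)] at this
    simpa using this.ne
  have key := fun L hL => H.sum_setLIntegral_sq_le hn hε hE hEf hm (L := L) hL
  generalize ∑ j ∈ J, ∫⁻ z in E, ‖extOp ε (h j) z‖ₑ ^ 2 = S at *
  generalize ∑ j ∈ J, ∫⁻ ξ, ‖h j ξ‖ₑ ^ 2 = ν at *
  have hMf : m * volume E ≠ ∞ := ENNReal.mul_ne_top hmf hEf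
  generalize m * volume E = M at *
  lift S to NNReal using hS
  lift ν to NNReal using hν
  lift M to NNReal using hMf
  have hn' : (0 : ℝ) < n + 1 := by positivity
  have := le_of_forall_sq_le hn S.coe_nonneg ν.coe_nonneg M.coe_nonneg (fun L hL => by
    have k := key L hL
    have p1 : 0 ≤ 4 * (2 * π) ^ n * L := by positivity
    have p2 : 0 ≤ 2 * π ^ n * L ^ (1 - (n : ℝ)) := by positivity
    have k2 := ENNReal.toReal_mono (by
      simp [ENNReal.mul_ne_top]) k
    rw [ENNReal.toReal_mul, ENNReal.toReal_add (by simp [ENNReal.mul_ne_top])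
      (by simp [ENNReal.mul_ne_top]), ENNReal.toReal_mul, ENNReal.toReal_mul,
      ENNReal.toReal_ofReal p1, ENNReal.toReal_ofReal p2] at k2
    simpa using k2)
  rw [← ENNReal.coe_rpow_of_nonneg _ (by positivity), ← ENNReal.coe_rpow_of_nonneg _ (by positivity),
    ENNReal.ofReal, ← ENNReal.coe_mul, ← ENNReal.coe_mul, ENNReal.coe_le_coe, ← NNReal.coe_le_coe]
  push_cast
  rwa [Real.coe_toNNReal _ (cA_pos n).le]

lemma norm_exp_I_mul_ofReal' (r : ℝ) {z : ℂ} (h : z = Complex.I * r) : ‖Complex.exp z‖ = 1 := by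
  rw [h, mul_comm]; exact Complex.norm_exp_ofReal_mul_I r

lemma continuous_dotC : Continuous fun z : Rn n × Rn n => dotC z.1 z.2 := by
  unfold dotC
  fun_prop

lemma measurable_FT (f : Rn n → ℂ) : Measurable (FT f) := by
  by_cases hf : Integrable f
  · refine Continuous.measurable ?_
    refine continuous_of_dominated (bound := fun x => ‖f x‖) (fun ξ => ?_) (fun ξ => ?_) hf.norm ?_
    · refine Continuous.aestronglyMeasurable ?_ |>.mul hf.1
      have := (continuous_dotC (n := n)).comp (continuous_id.prodMk (continuous_const (y := ξ)))
      simp only [Function.comp_def] at this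
      exact Complex.continuous_exp.comp (continuous_const.mul this).neg
    · refine ae_of_all _ fun x => ?_
      rw [norm_mul, norm_exp_I_mul_ofReal' (-(∑ i, x i * ξ i)) (by simp [dotC]), one_mul]
    · refine ae_of_all _ fun x => ?_
      have := (continuous_dotC (n := n)).comp ((continuous_const (y := x)).prodMk continuous_id)
      simp only [Function.comp_def] at this
      exact (Complex.continuous_exp.comp (continuous_const.mul this).neg).mul continuous_const
  · have : FT f = 0 := by
      funext ξ
      refine integral_undef fun h => hf ?_
      have h2 : Continuous fun x : Rn n => Complex.exp (Complex.I * dotC x ξ) := by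
        have := (continuous_dotC (n := n)).comp (continuous_id.prodMk (continuous_const (y := ξ)))
        simp only [Function.comp_def] at this
        exact Complex.continuous_exp.comp (continuous_const.mul this)
      refine (h.bdd_mul (c := 1) h2.aestronglyMeasurable (ae_of_all _ fun x => ?_)).congr
        (ae_of_all _ fun x => ?_)
      · exact (norm_exp_I_mul_ofReal' (∑ i, x i * ξ i) (by simp [dotC])).le
      · simp only
        rw [← mul_assoc, ← Complex.exp_add, add_neg_cancel, Complex.exp_zero, one_mul]
    rw [this]; exact measurable_zero

/-- The normalized profile `(2π)^{-n/2} |ξ|^s f̂(ξ)`. -/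
def profile (s : ℝ) (f : Rn n → ℂ) (ξ : Rn n) : ℂ :=
  (((2 * π) ^ (-(n : ℝ) / 2) * ‖ξ‖ ^ s : ℝ) : ℂ) * FT f ξ

lemma measurable_profile (s : ℝ) (f : Rn n → ℂ) : Measurable (profile s f) :=
  (Complex.measurable_ofReal.comp (by fun_prop)).mul (measurable_FT f)

lemma OrthonormalHs.integral_profile {s : ℝ} {f : ℕ → Rn n → ℂ} (hf : OrthonormalHs s f) (j k : ℕ) :
    ∫ ξ, profile s (f j) ξ * (starRingEnd ℂ) (profile s (f k) ξ) = if j = k then 1 else 0 := by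
  rw [← hf j k, ← integral_smul]
  refine integral_congr_ae (ae_of_all _ fun ξ => ?_)
  simp only [profile, map_mul, Complex.conj_ofReal, Complex.real_smul]
  have h1 : ((2 * π) ^ (-(n : ℝ) / 2) * ‖ξ‖ ^ s) * ((2 * π) ^ (-(n : ℝ) / 2) * ‖ξ‖ ^ s) =
      (2 * π) ^ (-(n : ℝ)) * ‖ξ‖ ^ (2 * s) := by
    rw [mul_mul_mul_comm, ← Real.rpow_add (by positivity), mul_comm 2 s, Real.rpow_mul (norm_nonneg _),
      Real.rpow_two, sq]
    congr 2; ring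
  have h2 := congrArg (fun r : ℝ => (r : ℂ)) h1
  push_cast at h2 ⊢
  linear_combination FT (f j) ξ * (starRingEnd ℂ) (FT (f k) ξ) * h2

lemma memLp_two_of_integral_mul_conj_ne_zero {X : Type*} [MeasurableSpace X] {μ : Measure X}
    {g : X → ℂ} (hg : Measurable g) (h : ∫ x, g x * (starRingEnd ℂ) (g x) ∂μ ≠ 0) : MemLp g 2 μ := by
  have h1 := not_imp_comm.1 integral_undef h
  refine (memLp_two_iff_integrable_sq_norm hg.aestronglyMeasurable).2 (h1.norm.congr ?_)
  refine ae_of_all _ fun x => ?_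
  simp only [norm_mul, RCLike.norm_conj, sq]

lemma sum_enorm_integral_sq_le_of_orthonormal {X : Type*} [MeasurableSpace X] {μ : Measure X}
    {g : ℕ → X → ℂ} (hm : ∀ j, MemLp (g j) 2 μ)
    (ho : ∀ j k, ∫ x, g j x * (starRingEnd ℂ) (g k x) ∂μ = if j = k then 1 else 0)
    (J : Finset ℕ) {φ : X → ℂ} (hφ : MemLp φ 2 μ) :
    ∑ j ∈ J, ‖∫ x, g j x * (starRingEnd ℂ) (φ x) ∂μ‖ₑ ^ 2 ≤ ∫⁻ x, ‖φ x‖ₑ ^ 2 ∂μ := by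
  have hin : ∀ {u v : X → ℂ} (hu : MemLp u 2 μ) (hv : MemLp v 2 μ),
      inner ℂ (hv.toLp v) (hu.toLp u) = ∫ x, u x * (starRingEnd ℂ) (v x) ∂μ := by
    intro u v hu hv
    rw [L2.inner_def]
    refine integral_congr_ae ?_
    filter_upwards [hu.coeFn_toLp, hv.coeFn_toLp] with x h1 h2
    rw [h1, h2, RCLike.inner_apply]
  have hG : Orthonormal ℂ fun j => (hm j).toLp (g j) := by
    rw [orthonormal_iff_ite]
    intro i j
    rw [hin, ho]
    simp only [eq_comm]
  have hb := hG.sum_inner_products_le ((hφ).toLp φ) (s := J)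
  have e : ENNReal.ofReal (‖hφ.toLp φ‖ ^ 2) = ∫⁻ x, ‖φ x‖ₑ ^ 2 ∂μ := by
    rw [Lp.norm_toLp, ENNReal.ofReal_pow ENNReal.toReal_nonneg, ENNReal.ofReal_toReal hφ.2.ne,
      eLpNorm_eq_lintegral_rpow_enorm_toReal (by norm_num) (by norm_num), ← ENNReal.rpow_natCast,
      ← ENNReal.rpow_mul]
    norm_num
  rw [← e]
  refine le_trans (le_of_eq ?_) (ENNReal.ofReal_le_ofReal hb)
  rw [ENNReal.ofReal_sum_of_nonneg (fun _ _ => by positivity)]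
  refine Finset.sum_congr rfl fun j _ => ?_
  rw [← hin (hm j) hφ, ENNReal.ofReal_pow (norm_nonneg _), ofReal_norm, ← inner_conj_symm,
    RCLike.enorm_conj]

/-- The dyadic annulus `2^k ≤ |ξ| < 2^(k+1)`. -/
def annulus (n : ℕ) (k : ℤ) : Set (Rn n) := {ξ | ‖ξ‖ ∈ Ico ((2 : ℝ) ^ k) (2 ^ (k + 1))}

lemma measurableSet_annulus (k : ℤ) : MeasurableSet (annulus n k) :=
  measurableSet_Ico.preimage measurable_norm

lemma iUnion_annulus : ⋃ k, annulus n k = {0}ᶜ := by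
  ext ξ
  simp only [annulus, mem_iUnion, mem_compl_iff, mem_singleton_iff, Set.mem_ofPred_eq]
  constructor
  · rintro ⟨k, hk⟩ rfl
    have : (0 : ℝ) < 2 ^ k := by positivity
    rw [norm_zero] at hk
    exact absurd hk.1 (not_le.2 this)
  · intro h
    exact exists_mem_Ico_zpow (norm_pos_iff.2 h) one_lt_two

lemma pairwise_disjoint_annulus : Pairwise (Function.onFun Disjoint (annulus n)) := by
  intro i j hij
  refine Set.disjoint_left.2 fun ξ hi hj => hij ?_
  simp only [annulus, Set.mem_ofPred_eq, mem_Ico] at hi hj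
  have h1 := (zpow_lt_zpow_iff_right₀ (one_lt_two (α := ℝ))).1 (hi.1.trans_lt hj.2)
  have h2 := (zpow_lt_zpow_iff_right₀ (one_lt_two (α := ℝ))).1 (hj.1.trans_lt hi.2)
  omega

lemma tsum_setLIntegral_annulus_le (F : Rn n → ℝ≥0∞) :
    ∑' k, ∫⁻ ξ in annulus n k, F ξ ≤ ∫⁻ ξ, F ξ := by
  rw [← lintegral_iUnion measurableSet_annulus pairwise_disjoint_annulus]
  exact setLIntegral_le_lintegral _ _

/-- The regularization parameter of the annulus `k`. -/
def epsAt (k : ℤ) : ℝ := (2 : ℝ) ^ (-2 * k)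

lemma epsAt_pos (k : ℤ) : 0 < epsAt k := by unfold epsAt; positivity

/-- The weight turning the profile into a regularized frequency-localized profile. -/
def annWeight (s : ℝ) (k : ℤ) (ξ : Rn n) : ℝ :=
  (annulus n k).indicator
    (fun ξ => ‖ξ‖ ^ (-s) * ((2 : ℝ) ^ k) ^ s * rexp (epsAt k / 2 * ‖ξ‖ ^ 2 - 2)) ξ

lemma measurable_annWeight (s : ℝ) (k : ℤ) : Measurable (annWeight (n := n) s k) :=
  Measurable.indicator (by fun_prop) (measurableSet_annulus k)

lemma annWeight_nonneg (s : ℝ) (k : ℤ) (ξ : Rn n) : 0 ≤ annWeight s k ξ :=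
  indicator_nonneg (fun _ _ => by positivity) _

lemma annWeight_le (s : ℝ) (hs : 0 ≤ s) (k : ℤ) (ξ : Rn n) : annWeight s k ξ ≤ 1 := by
  refine indicator_le' (g := 1) (fun ξ hξ => ?_) (fun _ _ => zero_le_one) ξ
  obtain ⟨h1, h2⟩ := hξ
  have hk : (0 : ℝ) < 2 ^ k := by positivity
  have h0 : 0 < ‖ξ‖ := hk.trans_le h1
  have e1 : ‖ξ‖ ^ (-s) * ((2 : ℝ) ^ k) ^ s ≤ 1 := by
    rw [Real.rpow_neg h0.le, inv_mul_le_one₀ (by positivity)]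
    exact Real.rpow_le_rpow hk.le h1 hs
  have e2 : rexp (epsAt k / 2 * ‖ξ‖ ^ 2 - 2) ≤ 1 := by
    rw [Real.exp_le_one_iff]
    have : epsAt k * ‖ξ‖ ^ 2 ≤ epsAt k * ((2 : ℝ) ^ (k + 1)) ^ 2 := by
      have := (epsAt_pos k).le
      gcongr
    have e : epsAt k * ((2 : ℝ) ^ (k + 1)) ^ 2 = 4 := by
      rw [epsAt, ← zpow_natCast, ← zpow_mul, ← zpow_add₀ two_ne_zero]
      rw [show -2 * k + (k + 1) * ((2 : ℕ) : ℤ) = 2 by push_cast; ring]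
      norm_num
    linarith
  exact mul_le_one₀ e1 (by positivity) e2

/-- The regularized profile localized in the annulus `k`. -/
def annProfile (s : ℝ) (f : Rn n → ℂ) (k : ℤ) (ξ : Rn n) : ℂ :=
  (annWeight s k ξ : ℂ) * profile s f ξ

lemma measurable_annProfile (s : ℝ) (f : Rn n → ℂ) (k : ℤ) : Measurable (annProfile s f k) :=
  (Complex.measurable_ofReal.comp (measurable_annWeight s k)).mul (measurable_profile s f)

lemma OrthonormalHs.memLp_profile {s : ℝ} {f : ℕ → Rn n → ℂ} (hf : OrthonormalHs s f) (j : ℕ) :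
    MemLp (profile s (f j)) 2 :=
  memLp_two_of_integral_mul_conj_ne_zero (measurable_profile s _) (by simp [hf.integral_profile])

lemma OrthonormalHs.lintegral_profile {s : ℝ} {f : ℕ → Rn n → ℂ} (hf : OrthonormalHs s f) (j : ℕ) :
    ∫⁻ ξ, ‖profile s (f j) ξ‖ₑ ^ 2 = 1 := by
  rw [lintegral_mul_self_conj (hf.memLp_profile j), hf.integral_profile]; simp

lemma enorm_annProfile_le {s : ℝ} (hs : 0 ≤ s) (f : Rn n → ℂ) (k : ℤ) (ξ : Rn n) :
    ‖annProfile s f k ξ‖ₑ ≤ (annulus n k).indicator (fun ξ => ‖profile s f ξ‖ₑ) ξ := by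
  by_cases hξ : ξ ∈ annulus n k
  · rw [indicator_of_mem hξ, annProfile, ← ofReal_norm, ← ofReal_norm]
    refine ENNReal.ofReal_le_ofReal ?_
    rw [norm_mul, Complex.norm_real, Real.norm_of_nonneg (annWeight_nonneg s k ξ)]
    exact mul_le_of_le_one_left (norm_nonneg _) (annWeight_le s hs k ξ)
  · simp [annProfile, annWeight, hξ]

lemma OrthonormalHs.besselFam {s : ℝ} (hs : 0 ≤ s) {f : ℕ → Rn n → ℂ} (hf : OrthonormalHs s f)
    (k : ℤ) (J : Finset ℕ) : BesselFam J fun j => annProfile s (f j) k where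
  meas j _ := measurable_annProfile s _ k
  memLp j _ := by
    refine (hf.memLp_profile j).mono (measurable_annProfile s _ k).aestronglyMeasurable
      (ae_of_all _ fun ξ => ?_)
    rw [annProfile, norm_mul, Complex.norm_real, Real.norm_of_nonneg (annWeight_nonneg s k ξ)]
    exact mul_le_of_le_one_left (norm_nonneg _) (annWeight_le s hs k ξ)
  bessel φ hφ := by
    have hb : ∀ ξ, ‖(annWeight s k ξ : ℂ) * φ ξ‖ ≤ ‖φ ξ‖ := fun ξ => by
      rw [norm_mul, Complex.norm_real, Real.norm_of_nonneg (annWeight_nonneg s k ξ)]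
      exact mul_le_of_le_one_left (norm_nonneg _) (annWeight_le s hs k ξ)
    have hφ' : MemLp (fun ξ => (annWeight s k ξ : ℂ) * φ ξ) 2 :=
      hφ.mono ((Complex.measurable_ofReal.comp
        (measurable_annWeight s k)).aestronglyMeasurable.mul hφ.1) (ae_of_all _ hb)
    refine le_trans (le_of_eq ?_) ((sum_enorm_integral_sq_le_of_orthonormal hf.memLp_profile
      hf.integral_profile J hφ').trans (lintegral_mono fun ξ => ?_))
    · refine Finset.sum_congr rfl fun j _ => ?_
      congr 3
      funext ξ
      rw [annProfile, map_mul, Complex.conj_ofReal]; ring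
    · rw [← ofReal_norm, ← ofReal_norm]
      exact pow_le_pow_left' (ENNReal.ofReal_le_ofReal (hb ξ)) 2

lemma lintegral_annProfile_le {s : ℝ} (hs : 0 ≤ s) (f : Rn n → ℂ) (k : ℤ) :
    ∫⁻ ξ, ‖annProfile s f k ξ‖ₑ ^ 2 ≤ ∫⁻ ξ in annulus n k, ‖profile s f ξ‖ₑ ^ 2 := by
  rw [← lintegral_indicator (measurableSet_annulus k)]
  refine lintegral_mono fun ξ => ?_
  refine (pow_le_pow_left' (enorm_annProfile_le hs f k ξ) 2).trans (le_of_eq ?_)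
  by_cases hξ : ξ ∈ annulus n k <;> simp [hξ]

/-- Powers of two in `ℝ≥0∞`. -/
def p2 (x : ℝ) : ℝ≥0∞ := (2 : ℝ≥0∞) ^ x

lemma p2_add (x y : ℝ) : p2 (x + y) = p2 x * p2 y :=
  ENNReal.rpow_add _ _ two_ne_zero ofNat_ne_top

lemma p2_rpow (x y : ℝ) : p2 x ^ y = p2 (x * y) := (ENNReal.rpow_mul _ _ _).symm

lemma p2_ne_zero (x : ℝ) : p2 x ≠ 0 := by simp [p2]

lemma p2_ne_top (x : ℝ) : p2 x ≠ ∞ := by simp [p2, ENNReal.rpow_eq_top_iff]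

lemma p2_zero : p2 0 = 1 := ENNReal.rpow_zero

lemma p2_mono {x y : ℝ} (h : x ≤ y) : p2 x ≤ p2 y :=
  ENNReal.rpow_le_rpow_of_exponent_le one_le_two h

lemma p2_eq_ofReal (x : ℝ) : p2 x = ENNReal.ofReal ((2 : ℝ) ^ x) := by
  rw [p2, ← ENNReal.ofReal_rpow_of_pos two_pos, ENNReal.ofReal_ofNat]

/-- The constant in the frequency decomposition. -/
def cS (n : ℕ) : ℝ := (2 * π) ^ (-(n : ℝ)) * (rexp 2 * (2 * π) ^ ((n : ℝ) / 2))

lemma cS_pos (n : ℕ) : 0 < cS n := by unfold cS; positivity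

lemma setIntegral_annulus_eq {s : ℝ} (f : Rn n → ℂ) (k : ℤ) (t : ℝ) (x : Rn n) :
    ∫ ξ in annulus n k, Complex.exp (Complex.I * (dotC x ξ - (t : ℂ) * ((‖ξ‖ : ℝ) : ℂ) ^ 2)) *
      (1 * FT f ξ) =
    (((2 : ℝ) ^ (-(k * s) : ℝ) * (rexp 2 * (2 * π) ^ ((n : ℝ) / 2)) : ℝ) : ℂ) *
      extOp (epsAt k) (annProfile s f k) (t, x) := by
  rw [extOp, ← integral_const_mul, ← integral_indicator (measurableSet_annulus k)]
  refine integral_congr_ae (ae_of_all _ fun ξ => ?_)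
  by_cases hξ : ξ ∈ annulus n k
  · rw [indicator_of_mem hξ]
    simp only [annProfile, annWeight, profile, wave, indicator_of_mem hξ]
    have h0 : 0 < ‖ξ‖ := (show (0 : ℝ) < 2 ^ k by positivity).trans_le hξ.1
    have h1 : (2 : ℝ) ^ (-(k * s) : ℝ) * (rexp 2 * (2 * π) ^ ((n : ℝ) / 2)) *
        (rexp (-(epsAt k / 2) * ‖ξ‖ ^ 2) * (‖ξ‖ ^ (-s) * ((2 : ℝ) ^ k) ^ s *
        rexp (epsAt k / 2 * ‖ξ‖ ^ 2 - 2)) * ((2 * π) ^ (-(n : ℝ) / 2) * ‖ξ‖ ^ s)) = 1 := by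
      have a1 : (2 : ℝ) ^ (-(k * s) : ℝ) * ((2 : ℝ) ^ k) ^ s = 1 := by
        rw [← Real.rpow_intCast, ← Real.rpow_mul two_pos.le, ← Real.rpow_add two_pos]
        simp
      have a2 : ‖ξ‖ ^ (-s) * ‖ξ‖ ^ s = 1 := by rw [← Real.rpow_add h0]; simp
      have a3 : ((2 * π) ^ ((n : ℝ) / 2)) * (2 * π) ^ (-(n : ℝ) / 2) = 1 := by
        rw [← Real.rpow_add (by positivity), neg_div, add_neg_cancel, Real.rpow_zero]
      have a4 : rexp 2 * rexp (-(epsAt k / 2) * ‖ξ‖ ^ 2) * rexp (epsAt k / 2 * ‖ξ‖ ^ 2 - 2) = 1 := by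
        rw [← Real.exp_add, ← Real.exp_add, ← Real.exp_zero]; congr 1; ring
      calc _ = ((2 : ℝ) ^ (-(k * s) : ℝ) * ((2 : ℝ) ^ k) ^ s) * (‖ξ‖ ^ (-s) * ‖ξ‖ ^ s) *
          (((2 * π) ^ ((n : ℝ) / 2)) * (2 * π) ^ (-(n : ℝ) / 2)) *
          (rexp 2 * rexp (-(epsAt k / 2) * ‖ξ‖ ^ 2) * rexp (epsAt k / 2 * ‖ξ‖ ^ 2 - 2)) := by ring
        _ = 1 := by rw [a1, a2, a3, a4]; norm_num
    have h2 := congrArg (fun r : ℝ => (r : ℂ)) h1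
    simp only [Complex.ofReal_mul, Complex.ofReal_one] at h2 ⊢
    linear_combination -(Complex.exp (Complex.I * (dotC x ξ - (t : ℂ) * ((‖ξ‖ : ℝ) : ℂ) ^ 2)) *
      FT f ξ) * h2
  · rw [indicator_of_notMem hξ]
    simp [annProfile, annWeight, hξ]

lemma enorm_schrodinger_le (hn : 1 ≤ n) (s : ℝ) (f : Rn n → ℂ) (t : ℝ) (x : Rn n) :
    ‖schrodinger f t x‖ₑ ≤ ENNReal.ofReal (cS n) *
      ∑' k : ℤ, p2 (-(k * s)) * ‖extOp (epsAt k) (annProfile s f k) (t, x)‖ₑ := by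
  by_cases hi : Integrable fun ξ : Rn n =>
      Complex.exp (Complex.I * (dotC x ξ - (t : ℂ) * ((‖ξ‖ : ℝ) : ℂ) ^ 2)) * (1 * FT f ξ)
  swap
  · rw [schrodinger, prop, integral_undef hi, smul_zero, enorm_zero]; exact zero_le
  have : Nonempty (Fin n) := ⟨⟨0, hn⟩⟩
  have h0 : ∫ ξ : Rn n,
      Complex.exp (Complex.I * (dotC x ξ - (t : ℂ) * ((‖ξ‖ : ℝ) : ℂ) ^ 2)) * (1 * FT f ξ) =
      ∑' k : ℤ, ∫ ξ in annulus n k,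
      Complex.exp (Complex.I * (dotC x ξ - (t : ℂ) * ((‖ξ‖ : ℝ) : ℂ) ^ 2)) * (1 * FT f ξ) := by
    rw [← integral_iUnion measurableSet_annulus pairwise_disjoint_annulus hi.integrableOn,
      iUnion_annulus, restrict_compl_singleton]
  rw [schrodinger, prop, h0, Complex.real_smul, enorm_mul]
  simp only [setIntegral_annulus_eq (s := s)]
  have hc : ‖(((2 * π) ^ (-(n : ℝ)) : ℝ) : ℂ)‖ₑ = ENNReal.ofReal ((2 * π) ^ (-(n : ℝ))) := by
    rw [← ofReal_norm, Complex.norm_real, Real.norm_of_nonneg (by positivity)]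
  rw [hc, cS, ENNReal.ofReal_mul (by positivity), mul_assoc, ← ENNReal.tsum_mul_left (a := ENNReal.ofReal (rexp 2 * _))]
  refine mul_le_mul_right ((enorm_tsum_le_tsum_enorm).trans (le_of_eq ?_)) _
  refine tsum_congr fun k => ?_
  rw [enorm_mul, ← ofReal_norm, Complex.norm_real, Real.norm_of_nonneg (by positivity),
    ENNReal.ofReal_mul (by positivity), p2_eq_ofReal]
  ring

/-- A decomposition of the solutions `e^{itΔ} f_j` into dyadic frequency pieces `U k j` with masses
`N k j`, together with the three basic estimates for each frequency. -/
structure Pieces (n : ℕ) (s : ℝ) (f : ℕ → Rn n → ℂ) (c : ℝ≥0∞) (U : ℤ → ℕ → ℝ × Rn n → ℂ)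
    (N : ℤ → ℕ → ℝ≥0∞) : Prop where
  meas : ∀ k j, Measurable (U k j)
  mass : ∀ j, ∑' k, N k j ≤ 1
  enorm_le : ∀ j t x, ‖schrodinger (f j) t x‖ₑ ≤ c * ∑' k : ℤ, p2 (-(k * s)) * ‖U k j (t, x)‖ₑ
  sum_le : ∀ k (J : Finset ℕ) z, ∑ j ∈ J, ‖U k j z‖ₑ ^ 2 ≤ c * p2 (k * n)
  time_le : ∀ k (J : Finset ℕ) (E : Set (ℝ × Rn n)) (F : Set ℝ), E ⊆ F ×ˢ univ →
    ∑ j ∈ J, ∫⁻ z in E, ‖U k j z‖ₑ ^ 2 ≤ c * (volume F * ∑ j ∈ J, N k j)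
  local_le : ∀ k (J : Finset ℕ) (E : Set (ℝ × Rn n)), MeasurableSet E → volume E ≠ ∞ →
    ∀ m : ℝ≥0∞, m ≠ ∞ → (∀ t, volume (Prod.mk t ⁻¹' E) ≤ m) →
    ∑ j ∈ J, ∫⁻ z in E, ‖U k j z‖ₑ ^ 2 ≤
      c * ((∑ j ∈ J, N k j) ^ ((n : ℝ) / (n + 1)) * (m * volume E) ^ (1 / ((n : ℝ) + 1)))

/-- The constant in the three basic estimates. -/
def cP (n : ℕ) : ℝ := cS n + π ^ ((n : ℝ) / 2) + (2 * π) ^ n + cA n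

lemma OrthonormalHs.pieces (hn : 2 ≤ n) {s : ℝ} (hs : 0 ≤ s) {f : ℕ → Rn n → ℂ}
    (hf : OrthonormalHs s f) :
    Pieces n s f (ENNReal.ofReal (cP n)) (fun k j => extOp (epsAt k) (annProfile s (f j) k))
      (fun k j => ∫⁻ ξ in annulus n k, ‖profile s (f j) ξ‖ₑ ^ 2) := by
  have h1 := (cS_pos n).le
  have h2 := (cA_pos n).le
  have h3 : 0 ≤ π ^ ((n : ℝ) / 2) := by positivity
  have h4 : 0 ≤ (2 * π) ^ n := by positivity
  have h5 : ∀ (k : ℤ) (J : Finset ℕ), ∑ j ∈ J, ∫⁻ ξ, ‖annProfile s (f j) k ξ‖ₑ ^ 2 ≤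
      ∑ j ∈ J, ∫⁻ ξ in annulus n k, ‖profile s (f j) ξ‖ₑ ^ 2 := fun k J =>
    Finset.sum_le_sum fun j _ => lintegral_annProfile_le hs _ _
  refine ⟨fun k j => measurable_extOp _ (measurable_annProfile s _ k), fun j => ?_, fun j t x => ?_,
    fun k J z => ?_, fun k J E F hEF => ?_, fun k J E hE hEf m hmf hm => ?_⟩
  · exact (tsum_setLIntegral_annulus_le _).trans (hf.lintegral_profile j).le
  · refine (enorm_schrodinger_le (by omega) s (f j) t x).trans (mul_le_mul_left ?_ _)
    exact ENNReal.ofReal_le_ofReal (by unfold cP; linarith)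
  · refine ((hf.besselFam hs k J).sum_extOp_sq_le (epsAt_pos k) z).trans ?_
    have e : (π / epsAt k) ^ ((n : ℝ) / 2) = π ^ ((n : ℝ) / 2) * (2 : ℝ) ^ (k * n : ℝ) := by
      rw [epsAt, Real.div_rpow pi_pos.le (by positivity), div_eq_mul_inv, ← Real.rpow_intCast,
        ← Real.rpow_mul two_pos.le, ← Real.rpow_neg two_pos.le]
      congr 2; push_cast; ring
    rw [e, ENNReal.ofReal_mul h3, ← p2_eq_ofReal]
    exact mul_le_mul_left (ENNReal.ofReal_le_ofReal (by unfold cP; linarith)) _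
  · refine ((hf.besselFam hs k J).sum_setLIntegral_le_time (epsAt_pos k) hEF).trans ?_
    have h6 : (2 * π) ^ n ≤ cP n := by unfold cP; linarith
    exact mul_le_mul' (ENNReal.ofReal_le_ofReal h6) (mul_le_mul_right (h5 k J) _)
  · refine ((hf.besselFam hs k J).sum_setLIntegral_le hn (epsAt_pos k) hE hEf hmf hm).trans ?_
    rw [mul_assoc]
    have h6 : cA n ≤ cP n := by unfold cP; linarith
    refine mul_le_mul' (ENNReal.ofReal_le_ofReal h6) (mul_le_mul_left ?_ _)
    exact ENNReal.rpow_le_rpow (h5 k J) (by positivity)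

open Filter

lemma exists_p2_le_lt {a : ℝ≥0∞} (h0 : a ≠ 0) (h1 : a ≠ ∞) :
    ∃ k : ℤ, p2 k ≤ a ∧ a < p2 (k + 1) := by
  obtain ⟨k, hk1, hk2⟩ := ENNReal.exists_mem_Ico_zpow h0 h1 (y := 2) (by norm_num) (by norm_num)
  refine ⟨k, ?_, ?_⟩
  · rwa [p2, ENNReal.rpow_intCast]
  · have : ((k : ℝ) + 1) = ((k + 1 : ℤ) : ℝ) := by push_cast; rfl
    rwa [p2, this, ENNReal.rpow_intCast]

lemma int_eq_of_p2_le_lt {a : ℝ≥0∞} {k l : ℤ} (hk : p2 k ≤ a) (hk' : a < p2 (k + 1))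
    (hl : p2 l ≤ a) (hl' : a < p2 (l + 1)) : k = l := by
  have h1 : ((k : ℝ)) < l + 1 := by
    by_contra! h; exact absurd (hk.trans_lt hl') (not_lt.2 (p2_mono h))
  have h2 : ((l : ℝ)) < k + 1 := by
    by_contra! h; exact absurd (hl.trans_lt hk') (not_lt.2 (p2_mono h))
  have h1' : k < l + 1 := by exact_mod_cast h1
  have h2' : l < k + 1 := by exact_mod_cast h2
  omega

/-- A family of space-time sets adapted to the dyadic level sets of a function normalized in the
dual mixed norm. -/
structure BlockFam (n : ℕ) (p q : ℝ) (E : ℤ → ℤ → Set (ℝ × Rn n)) (F : ℤ → Set ℝ) : Prop where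
  meas : ∀ i m, MeasurableSet (E i m)
  sub : ∀ i m, E i m ⊆ F i ×ˢ univ
  time : ∀ i, volume (F i) ≤ p2 (-(i * q))
  slice : ∀ i m t, volume (Prod.mk t ⁻¹' E i m) ≤ p2 (-(m * p))
  total : ∑' i : ℤ, ∑' m : ℤ, p2 (i * q + m * p) * volume (E i m) ≤ 1

/-- The mixed norm of a nonnegative function. -/
def mixedL (p q : ℝ) (ρ : ℝ × Rn n → ℝ≥0∞) : ℝ≥0∞ :=
  (∫⁻ t, (∫⁻ x, ρ (t, x) ^ p) ^ (q / p)) ^ (1 / q)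

/-- The dual pairing of `ρ` with a block family. -/
def blockSum (p q : ℝ) (ρ : ℝ × Rn n → ℝ≥0∞) (E : ℤ → ℤ → Set (ℝ × Rn n)) : ℝ≥0∞ :=
  ∑' i : ℤ, ∑' m : ℤ, p2 (i * (q - 1) + m * (p - 1)) * ∫⁻ z in E i m, ρ z

/-- The dyadic level sets of a pair of functions. -/
def levelSet (A : ℝ × Rn n → ℝ≥0∞) (B : ℝ → ℝ≥0∞) (i m : ℤ) : Set (ℝ × Rn n) :=
  {z | (p2 i ≤ B z.1 ∧ B z.1 < p2 (i + 1)) ∧ p2 m ≤ A z ∧ A z < p2 (m + 1)}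

lemma measurableSet_levelSet {A : ℝ × Rn n → ℝ≥0∞} {B : ℝ → ℝ≥0∞} (hA : Measurable A)
    (hB : Measurable B) (i m : ℤ) : MeasurableSet (levelSet A B i m) := by
  have hB' : Measurable fun z : ℝ × Rn n => B z.1 := hB.comp measurable_fst
  exact ((measurableSet_le measurable_const hB').inter (measurableSet_lt hB' measurable_const)).inter
    ((measurableSet_le measurable_const hA).inter (measurableSet_lt hA measurable_const))

lemma tsum_indicator_levelSet {A : ℝ × Rn n → ℝ≥0∞} {B : ℝ → ℝ≥0∞} (g : ℤ → ℤ → ℝ≥0∞) {i m : ℤ}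
    {z : ℝ × Rn n} (hz : z ∈ levelSet A B i m) :
    ∑' i : ℤ, ∑' m : ℤ, (levelSet A B i m).indicator (fun _ => g i m) z = g i m := by
  have key : ∀ i' m', z ∈ levelSet A B i' m' → i' = i ∧ m' = m := fun i' m' h =>
    ⟨int_eq_of_p2_le_lt h.1.1 h.1.2 hz.1.1 hz.1.2, int_eq_of_p2_le_lt h.2.1 h.2.2 hz.2.1 hz.2.2⟩
  rw [tsum_eq_single i, tsum_eq_single m, indicator_of_mem hz]
  · intro m' hm'
    exact indicator_of_notMem (fun h => hm' (key _ _ h).2) _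
  · intro i' hi'
    refine ENNReal.tsum_eq_zero.2 fun m' => indicator_of_notMem (fun h => hi' (key _ _ h).1) _

lemma tsum_levelSet_le {A : ℝ × Rn n → ℝ≥0∞} {B : ℝ → ℝ≥0∞} {p q : ℝ} (hp : 0 < p) (hq : 0 < q)
    (z : ℝ × Rn n) :
    ∑' i : ℤ, ∑' m : ℤ, (levelSet A B i m).indicator (fun _ => p2 (i * q + m * p)) z ≤
      B z.1 ^ q * A z ^ p := by
  by_cases h : ∃ i m, z ∈ levelSet A B i m
  · obtain ⟨i, m, hz⟩ := h
    rw [tsum_indicator_levelSet (fun i m => p2 (i * q + m * p)) hz, p2_add, ← p2_rpow, ← p2_rpow]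
    exact mul_le_mul' (ENNReal.rpow_le_rpow hz.1.1 hq.le) (ENNReal.rpow_le_rpow hz.2.1 hp.le)
  · push Not at h
    refine le_trans (le_of_eq ?_) zero_le
    exact ENNReal.tsum_eq_zero.2 fun i => ENNReal.tsum_eq_zero.2 fun m =>
      indicator_of_notMem (h i m) _

lemma le_tsum_levelSet {A : ℝ × Rn n → ℝ≥0∞} {B : ℝ → ℝ≥0∞} {p q : ℝ} (hp : 1 < p) (hq : 1 < q)
    {z : ℝ × Rn n} (hA : A z ≠ ∞) (hB : B z.1 ≠ ∞) :
    B z.1 ^ (q - 1) * A z ^ (p - 1) ≤ p2 (p + q) *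
      ∑' i : ℤ, ∑' m : ℤ, (levelSet A B i m).indicator
        (fun _ => p2 (i * (q - 1) + m * (p - 1))) z := by
  by_cases hA0 : A z = 0
  · rw [hA0, ENNReal.zero_rpow_of_pos (by linarith), mul_zero]; exact zero_le
  by_cases hB0 : B z.1 = 0
  · rw [hB0, ENNReal.zero_rpow_of_pos (by linarith), zero_mul]; exact zero_le
  obtain ⟨i, hi⟩ := exists_p2_le_lt hB0 hB
  obtain ⟨m, hm⟩ := exists_p2_le_lt hA0 hA
  rw [tsum_indicator_levelSet (fun i m => p2 (i * (q - 1) + m * (p - 1))) (⟨hi, hm⟩ :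
    z ∈ levelSet A B i m)]
  calc _ ≤ p2 (i + 1) ^ (q - 1) * p2 (m + 1) ^ (p - 1) :=
        mul_le_mul' (ENNReal.rpow_le_rpow hi.2.le (by linarith))
          (ENNReal.rpow_le_rpow hm.2.le (by linarith))
    _ ≤ _ := by
        rw [p2_rpow, p2_rpow, ← p2_add, ← p2_add]
        exact p2_mono (by linarith)

lemma mixedL_le_of_blockSum_le_of_finite {p q : ℝ} (hp : 1 < p) (hq : 1 < q)
    {ρ : ℝ × Rn n → ℝ≥0∞} (hρ : Measurable ρ) (hρf : ∀ z, ρ z ≠ ∞)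
    (hr : ∀ t, ∫⁻ x, ρ (t, x) ^ p ≠ ∞) (hX : mixedL p q ρ ≠ ∞) {K : ℝ≥0∞}
    (hK : ∀ E F, BlockFam n p q E F → blockSum p q ρ E ≤ K) : mixedL p q ρ ≤ p2 (p + q) * K := by
  by_cases hX0 : mixedL p q ρ = 0
  · rw [hX0]; exact zero_le
  have hp0 : 0 < p := by linarith
  have hq0 : 0 < q := by linarith
  set I : ℝ → ℝ≥0∞ := fun t => ∫⁻ x, ρ (t, x) ^ p with hI
  set r : ℝ → ℝ≥0∞ := fun t => I t ^ (1 / p) with hrdef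
  set X := mixedL p q ρ with hXdef
  have hIm : Measurable I := (hρ.pow_const p).lintegral_prod_right'
  have hrm : Measurable r := hIm.pow_const _
  have hrf : ∀ t, r t ≠ ∞ := fun t => ENNReal.rpow_ne_top_of_nonneg (by positivity) (hr t)
  have hrp : ∀ t, r t ^ p = I t := fun t => by
    rw [hrdef]; simp only; rw [← ENNReal.rpow_mul, one_div_mul_cancel hp0.ne', ENNReal.rpow_one]
  have hXq : ∫⁻ t, r t ^ q = X ^ q := by
    rw [hXdef, mixedL, ← ENNReal.rpow_mul, one_div_mul_cancel hq0.ne', ENNReal.rpow_one]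
    refine lintegral_congr fun t => ?_
    rw [hrdef]; simp only; rw [← ENNReal.rpow_mul]; congr 1; ring
  set A : ℝ × Rn n → ℝ≥0∞ := fun z => ρ z / r z.1 with hA
  set B : ℝ → ℝ≥0∞ := fun t => r t / X with hB
  have hAm : Measurable A := hρ.div (hrm.comp measurable_fst)
  have hBm : Measurable B := hrm.div_const _
  have hBf : ∀ t, B t ≠ ∞ := fun t => ENNReal.div_ne_top (hrf t) hX0
  have hXq0 : X ^ q ≠ 0 := by simp [hX0, hX, ENNReal.rpow_eq_zero_iff]
  have hXqf : X ^ q ≠ ∞ := ENNReal.rpow_ne_top_of_nonneg hq0.le hX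
  have hBq : ∫⁻ t, B t ^ q = 1 := by
    have h : ∀ t, B t ^ q = r t ^ q * (X ^ q)⁻¹ := fun t => by
      simp only [hB]; rw [ENNReal.div_rpow_of_nonneg _ _ hq0.le, div_eq_mul_inv]
    simp only [h]
    rw [lintegral_mul_const _ (hrm.pow_const q), hXq, ENNReal.mul_inv_cancel hXq0 hXqf]
  have hAp : ∀ t, r t ≠ 0 → ∫⁻ x, A (t, x) ^ p = 1 := fun t ht => by
    have h : ∀ x, A (t, x) ^ p = ρ (t, x) ^ p * (r t ^ p)⁻¹ := fun x => by
      simp only [hA]; rw [ENNReal.div_rpow_of_nonneg _ _ hp0.le, div_eq_mul_inv]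
    have hm : Measurable fun x => ρ (t, x) ^ p := (hρ.comp measurable_prodMk_left).pow_const p
    simp only [h]
    rw [lintegral_mul_const _ hm, hrp]
    refine ENNReal.mul_inv_cancel ?_ (hr t)
    change I t ≠ 0
    rw [← hrp]; simp [ht, hrf t, ENNReal.rpow_eq_zero_iff]
  have hB0 : ∀ t, B t ≠ 0 → r t ≠ 0 := fun t h h0 => h (by simp [hB, h0])
  have hfam : BlockFam n p q (levelSet A B) (fun i => {t | p2 i ≤ B t}) := by
    refine ⟨measurableSet_levelSet hAm hBm, fun i m z hz => ⟨hz.1.1, mem_univ _⟩, fun i => ?_,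
      fun i m t => ?_, ?_⟩
    · have h := mul_meas_ge_le_lintegral (μ := volume) (hBm.pow_const q) (p2 i ^ q)
      rw [hBq, p2_rpow] at h
      have hsub : {t | p2 i ≤ B t} ⊆ {t | p2 (i * q) ≤ B t ^ q} := fun t ht => by
        have := ENNReal.rpow_le_rpow ht hq0.le
        rwa [p2_rpow] at this
      calc volume {t | p2 i ≤ B t} ≤ volume {t | p2 (i * q) ≤ B t ^ q} := measure_mono hsub
        _ = p2 (-(i * q)) * (p2 (i * q) * volume {t | p2 (i * q) ≤ B t ^ q}) := by
            rw [← mul_assoc, ← p2_add, neg_add_cancel, p2_zero, one_mul]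
        _ ≤ p2 (-(i * q)) * 1 := by gcongr
        _ = _ := mul_one _
    · by_cases ht : p2 i ≤ B t
      swap
      · have : Prod.mk t ⁻¹' levelSet A B i m = ∅ := by
          ext x
          simp only [mem_preimage, mem_empty_iff_false, iff_false]
          exact fun hx => ht hx.1.1
        rw [this]; simp
      have ht0 : r t ≠ 0 := hB0 t fun h => p2_ne_zero i (le_antisymm (h ▸ ht) zero_le)
      have h := mul_meas_ge_le_lintegral (μ := volume)
        ((hAm.comp (measurable_prodMk_left (x := t))).pow_const p) (p2 m ^ p)
      simp only [Function.comp_def] at h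
      rw [hAp t ht0, p2_rpow] at h
      have hsub : Prod.mk t ⁻¹' levelSet A B i m ⊆ {x | p2 (m * p) ≤ A (t, x) ^ p} := fun x hx => by
        have := ENNReal.rpow_le_rpow hx.2.1 hp0.le
        rwa [p2_rpow] at this
      calc _ ≤ volume {x | p2 (m * p) ≤ A (t, x) ^ p} := measure_mono hsub
        _ = p2 (-(m * p)) * (p2 (m * p) * volume {x | p2 (m * p) ≤ A (t, x) ^ p}) := by
            rw [← mul_assoc, ← p2_add, neg_add_cancel, p2_zero, one_mul]
        _ ≤ p2 (-(m * p)) * 1 := by gcongr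
        _ = _ := mul_one _
    · calc ∑' i : ℤ, ∑' m : ℤ, p2 (i * q + m * p) * volume (levelSet A B i m)
          = ∑' i : ℤ, ∑' m : ℤ,
            ∫⁻ z, (levelSet A B i m).indicator (fun _ => p2 (i * q + m * p)) z := by
            refine tsum_congr fun i => tsum_congr fun m => ?_
            rw [lintegral_indicator_const (measurableSet_levelSet hAm hBm i m)]
        _ = ∫⁻ z, ∑' i : ℤ, ∑' m : ℤ,
            (levelSet A B i m).indicator (fun _ => p2 (i * q + m * p)) z := by
            have hm : ∀ i m : ℤ, Measurable fun z =>
                (levelSet A B i m).indicator (fun _ => p2 (i * q + m * p)) z := fun i m =>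
              measurable_const.indicator (measurableSet_levelSet hAm hBm i m)
            rw [lintegral_tsum fun i => (Measurable.tsum fun m => hm i m).aemeasurable]
            exact tsum_congr fun i => (lintegral_tsum fun m => (hm i m).aemeasurable).symm
        _ ≤ ∫⁻ z : ℝ × Rn n, B z.1 ^ q * A z ^ p :=
            lintegral_mono fun z => tsum_levelSet_le hp0 hq0 z
        _ = ∫⁻ t, B t ^ q * ∫⁻ x, A (t, x) ^ p := by
            have hm : Measurable fun z : ℝ × Rn n => B z.1 ^ q * A z ^ p :=
              ((hBm.comp measurable_fst).pow_const q).mul (hAm.pow_const p)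
            rw [Measure.volume_eq_prod, lintegral_prod _ hm.aemeasurable]
            refine lintegral_congr fun t => ?_
            have hm3 : Measurable fun x => A (t, x) ^ p :=
              (hAm.comp measurable_prodMk_left).pow_const p
            exact lintegral_const_mul (B t ^ q) hm3
        _ ≤ ∫⁻ t, B t ^ q := by
            refine lintegral_mono fun t => ?_
            by_cases ht : B t = 0
            · simp [ht, ENNReal.zero_rpow_of_pos hq0]
            · simp [hAp t (hB0 t ht)]
        _ = 1 := hBq
  refine le_trans ?_ (mul_le_mul_right (hK _ _ hfam) _)
  have hlow : X = ∫⁻ z : ℝ × Rn n, ρ z * (B z.1 ^ (q - 1) * A z ^ (p - 1)) := by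
    have hm : Measurable fun z : ℝ × Rn n => ρ z * (B z.1 ^ (q - 1) * A z ^ (p - 1)) :=
      hρ.mul (((hBm.comp measurable_fst).pow_const (q - 1)).mul (hAm.pow_const (p - 1)))
    rw [Measure.volume_eq_prod, lintegral_prod _ hm.aemeasurable]
    calc X = X * ∫⁻ t, B t ^ q := by rw [hBq, mul_one]
      _ = ∫⁻ t, X * B t ^ q := (lintegral_const_mul _ (hBm.pow_const q)).symm
      _ = _ := by
        refine lintegral_congr fun t => ?_
        by_cases ht : r t = 0
        · have : B t = 0 := by simp [hB, ht]
          simp [this, ENNReal.zero_rpow_of_pos hq0, ENNReal.zero_rpow_of_pos (sub_pos.2 hq)]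
        have e : ∀ x, ρ (t, x) * (B t ^ (q - 1) * A (t, x) ^ (p - 1)) =
            (B t ^ (q - 1) * r t) * A (t, x) ^ p := fun x => by
          have : ρ (t, x) = r t * A (t, x) := by
            simp only [hA]; rw [ENNReal.mul_div_cancel ht (hrf t)]
          have hAf : A (t, x) ≠ ∞ := ENNReal.div_ne_top (hρf _) ht
          have h2 : A (t, x) ^ p = A (t, x) * A (t, x) ^ (p - 1) := by
            conv_lhs => rw [show p = 1 + (p - 1) by ring]
            rw [ENNReal.rpow_add_of_nonneg _ _ zero_le_one (by linarith), ENNReal.rpow_one]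
          rw [this, h2]; ring
        simp only [e]
        have hm3 : Measurable fun x => A (t, x) ^ p :=
          (hAm.comp measurable_prodMk_left).pow_const p
        rw [lintegral_const_mul _ hm3, hAp t ht, mul_one]
        have h3 : r t = X * B t := by simp only [hB]; rw [ENNReal.mul_div_cancel hX0 hX]
        conv_rhs => rw [h3]
        have h2 : B t ^ q = B t * B t ^ (q - 1) := by
          conv_lhs => rw [show q = 1 + (q - 1) by ring]
          rw [ENNReal.rpow_add_of_nonneg _ _ zero_le_one (by linarith), ENNReal.rpow_one]
        rw [h2]; ring
  rw [hlow, blockSum]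
  have hm : ∀ i m : ℤ, Measurable fun z =>
      (levelSet A B i m).indicator (fun _ => p2 (i * (q - 1) + m * (p - 1))) z := fun i m =>
    measurable_const.indicator (measurableSet_levelSet hAm hBm i m)
  have hm' : ∀ i m : ℤ, Measurable fun z =>
      (levelSet A B i m).indicator (fun _ => p2 (i * (q - 1) + m * (p - 1))) z * ρ z :=
    fun i m => (hm i m).mul hρ
  calc _ ≤ ∫⁻ z, p2 (p + q) * ∑' i : ℤ, ∑' m : ℤ, (levelSet A B i m).indicator
        (fun _ => p2 (i * (q - 1) + m * (p - 1))) z * ρ z := by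
        refine lintegral_mono fun z => ?_
        by_cases ht : r z.1 = 0
        · have : B z.1 = 0 := by simp [hB, ht]
          simp [this, ENNReal.zero_rpow_of_pos (sub_pos.2 hq)]
        have := le_tsum_levelSet (A := A) (B := B) hp hq (z := z)
          (ENNReal.div_ne_top (hρf z) ht) (hBf z.1)
        simp only [ENNReal.tsum_mul_right]
        rw [← mul_assoc (p2 _), mul_comm (ρ z)]
        exact mul_le_mul_left this _
    _ = p2 (p + q) * ∑' i : ℤ, ∑' m : ℤ, ∫⁻ z, (levelSet A B i m).indicator
        (fun _ => p2 (i * (q - 1) + m * (p - 1))) z * ρ z := by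
        rw [lintegral_const_mul' _ _ (p2_ne_top _),
          lintegral_tsum fun i => (Measurable.tsum fun m => hm' i m).aemeasurable]
        congr 1
        exact tsum_congr fun i => lintegral_tsum fun m => (hm' i m).aemeasurable
    _ = _ := by
        congr 1
        refine tsum_congr fun i => tsum_congr fun m => ?_
        rw [← lintegral_const_mul _ hρ, ← lintegral_indicator (measurableSet_levelSet hAm hBm i m)]
        refine lintegral_congr fun z => ?_
        by_cases hz : z ∈ levelSet A B i m <;> simp [hz]

/-- Truncation of a function to a bounded function with bounded support. -/
def truncAt (M : ℕ) (ρ : ℝ × Rn n → ℝ≥0∞) : ℝ × Rn n → ℝ≥0∞ :=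
  (Metric.closedBall 0 (M : ℝ)).indicator fun z => min (ρ z) M

lemma measurable_truncAt (M : ℕ) {ρ : ℝ × Rn n → ℝ≥0∞} (hρ : Measurable ρ) :
    Measurable (truncAt M ρ) :=
  (hρ.min measurable_const).indicator measurableSet_closedBall

lemma truncAt_le (M : ℕ) (ρ : ℝ × Rn n → ℝ≥0∞) (z : ℝ × Rn n) : truncAt M ρ z ≤ ρ z :=
  (indicator_le_self _ _ _).trans (min_le_left _ _)

lemma truncAt_le_indicator (M : ℕ) (ρ : ℝ × Rn n → ℝ≥0∞) (t : ℝ) (x : Rn n) :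
    truncAt M ρ (t, x) ≤ (Metric.closedBall (0 : ℝ) M).indicator
      (fun _ => (Metric.closedBall (0 : Rn n) M).indicator (fun _ => (M : ℝ≥0∞)) x) t := by
  rw [truncAt]
  by_cases h : (t, x) ∈ Metric.closedBall (0 : ℝ × Rn n) (M : ℝ)
  · rw [indicator_of_mem h]
    have h' := h
    rw [mem_closedBall_zero_iff, Prod.norm_def, max_le_iff] at h'
    rw [indicator_of_mem (mem_closedBall_zero_iff.2 h'.1),
      indicator_of_mem (mem_closedBall_zero_iff.2 h'.2)]
    exact min_le_right _ _
  · rw [indicator_of_notMem h]; exact zero_le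

lemma monotone_truncAt (ρ : ℝ × Rn n → ℝ≥0∞) (z : ℝ × Rn n) :
    Monotone fun M => truncAt M ρ z := by
  intro M N h
  have h' : (M : ℝ) ≤ N := by exact_mod_cast h
  simp only [truncAt]
  by_cases hz : z ∈ Metric.closedBall (0 : ℝ × Rn n) (M : ℝ)
  · rw [indicator_of_mem hz, indicator_of_mem (Metric.closedBall_subset_closedBall h' hz)]
    exact min_le_min le_rfl (by exact_mod_cast h)
  · rw [indicator_of_notMem hz]; exact zero_le

lemma tendsto_truncAt (ρ : ℝ × Rn n → ℝ≥0∞) (z : ℝ × Rn n) :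
    Tendsto (fun M => truncAt M ρ z) atTop (nhds (ρ z)) := by
  have h : Tendsto (fun M : ℕ => min (ρ z) (M : ℝ≥0∞)) atTop (nhds (min (ρ z) ∞)) :=
    tendsto_const_nhds.min ENNReal.tendsto_nat_nhds_top
  rw [min_eq_left le_top] at h
  refine h.congr' ?_
  filter_upwards [eventually_ge_atTop ⌈‖z‖⌉₊] with M hM
  rw [truncAt, indicator_of_mem]
  rw [mem_closedBall_zero_iff]
  exact (Nat.le_ceil _).trans (by exact_mod_cast hM)

lemma tendsto_mixedL_truncAt {p q : ℝ} (hp : 0 < p) (hq : 0 < q) {ρ : ℝ × Rn n → ℝ≥0∞}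
    (hρ : Measurable ρ) :
    Tendsto (fun M => mixedL p q (truncAt M ρ)) atTop (nhds (mixedL p q ρ)) := by
  have hm : ∀ M, Measurable fun t => ∫⁻ x, truncAt M ρ (t, x) ^ p := fun M =>
    ((measurable_truncAt M hρ).pow_const p).lintegral_prod_right'
  have h1 : ∀ t, Tendsto (fun M => ∫⁻ x, truncAt M ρ (t, x) ^ p) atTop
      (nhds (∫⁻ x, ρ (t, x) ^ p)) := fun t => by
    refine lintegral_tendsto_of_tendsto_of_monotone (fun M => ?_) ?_ ?_
    · exact (((measurable_truncAt M hρ).comp measurable_prodMk_left).pow_const p).aemeasurable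
    · exact ae_of_all _ fun x M N h => ENNReal.rpow_le_rpow (monotone_truncAt ρ (t, x) h) hp.le
    · exact ae_of_all _ fun x =>
        (ENNReal.continuous_rpow_const.tendsto _).comp (tendsto_truncAt ρ (t, x))
  refine (ENNReal.continuous_rpow_const.tendsto _).comp ?_
  refine lintegral_tendsto_of_tendsto_of_monotone (fun M => ?_) ?_ ?_
  · exact ((hm M).pow_const _).aemeasurable
  · exact ae_of_all _ fun t M N h => ENNReal.rpow_le_rpow (lintegral_mono fun x =>
      ENNReal.rpow_le_rpow (monotone_truncAt ρ (t, x) h) hp.le) (by positivity)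
  · exact ae_of_all _ fun t => (ENNReal.continuous_rpow_const.tendsto _).comp (h1 t)

lemma lintegral_truncAt_le {p : ℝ} (hp : 0 < p) (M : ℕ) (ρ : ℝ × Rn n → ℝ≥0∞) (t : ℝ) :
    ∫⁻ x, truncAt M ρ (t, x) ^ p ≤ (Metric.closedBall (0 : ℝ) M).indicator
      (fun _ => (M : ℝ≥0∞) ^ p * volume (Metric.closedBall (0 : Rn n) M)) t := by
  rw [← lintegral_indicator_const measurableSet_closedBall]
  by_cases ht : t ∈ Metric.closedBall (0 : ℝ) M
  · rw [indicator_of_mem ht]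
    refine lintegral_mono fun x => ?_
    have h := truncAt_le_indicator M ρ t x
    rw [indicator_of_mem ht] at h
    by_cases hx : x ∈ Metric.closedBall (0 : Rn n) M
    · rw [indicator_of_mem hx] at h ⊢
      exact ENNReal.rpow_le_rpow h hp.le
    · rw [indicator_of_notMem hx] at h ⊢
      rw [le_antisymm h zero_le, ENNReal.zero_rpow_of_pos hp]
  · rw [indicator_of_notMem ht]
    refine le_of_eq ?_
    have : ∀ x, truncAt M ρ (t, x) ^ p = 0 := fun x => by
      have h := truncAt_le_indicator M ρ t x
      rw [indicator_of_notMem ht] at h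
      rw [le_antisymm h zero_le, ENNReal.zero_rpow_of_pos hp]
    simp [this]

lemma mixedL_le_of_blockSum_le {p q : ℝ} (hp : 1 < p) (hq : 1 < q)
    {ρ : ℝ × Rn n → ℝ≥0∞} (hρ : Measurable ρ) {K : ℝ≥0∞}
    (hK : ∀ E F, BlockFam n p q E F → blockSum p q ρ E ≤ K) : mixedL p q ρ ≤ p2 (p + q) * K := by
  have hp0 : 0 < p := by linarith
  have hq0 : 0 < q := by linarith
  refine le_of_tendsto' (tendsto_mixedL_truncAt hp0 hq0 hρ) fun M => ?_
  have hfin : (M : ℝ≥0∞) ^ p * volume (Metric.closedBall (0 : Rn n) M) ≠ ∞ :=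
    ENNReal.mul_ne_top (ENNReal.rpow_ne_top_of_nonneg hp0.le (ENNReal.natCast_ne_top M))
      measure_closedBall_lt_top.ne
  refine mixedL_le_of_blockSum_le_of_finite hp hq (measurable_truncAt M hρ) (fun z => ?_)
    (fun t => ?_) ?_ fun E F h => le_trans ?_ (hK E F h)
  · obtain ⟨t, x⟩ := z
    refine ne_top_of_le_ne_top ?_ (truncAt_le_indicator M ρ t x)
    refine ne_top_of_le_ne_top (ENNReal.natCast_ne_top M) ?_
    exact (indicator_le_self _ _ _).trans (indicator_le_self _ _ _)
  · exact ne_top_of_le_ne_top hfin ((lintegral_truncAt_le hp0 M ρ t).trans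
      (indicator_le_self _ _ _))
  · refine ENNReal.rpow_ne_top_of_nonneg (by positivity) ?_
    have : ∀ t, (∫⁻ x, truncAt M ρ (t, x) ^ p) ^ (q / p) ≤ (Metric.closedBall (0 : ℝ) M).indicator
        (fun _ => ((M : ℝ≥0∞) ^ p * volume (Metric.closedBall (0 : Rn n) M)) ^ (q / p)) t :=
      fun t => by
        refine (ENNReal.rpow_le_rpow (lintegral_truncAt_le hp0 M ρ t) (by positivity)).trans ?_
        by_cases ht : t ∈ Metric.closedBall (0 : ℝ) M
        · rw [indicator_of_mem ht, indicator_of_mem ht]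
        · rw [indicator_of_notMem ht, indicator_of_notMem ht,
            ENNReal.zero_rpow_of_pos (by positivity)]
    refine ne_top_of_le_ne_top ?_ (lintegral_mono this)
    rw [lintegral_indicator_const measurableSet_closedBall]
    exact ENNReal.mul_ne_top (ENNReal.rpow_ne_top_of_nonneg (by positivity) hfin)
      measure_closedBall_lt_top.ne
  · exact ENNReal.tsum_le_tsum fun i => ENNReal.tsum_le_tsum fun m =>
      mul_le_mul_right (lintegral_mono fun z => truncAt_le M ρ z) _

lemma tsum_sq_le_weighted (w : ℤ → ℝ) (a : ℤ → ℝ≥0∞) :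
    (∑' k, a k) ^ 2 ≤ (∑' k, p2 (-w k)) * ∑' k, p2 (w k) * a k ^ 2 := by
  have h := ENNReal.lintegral_mul_le_Lp_mul_Lq (Measure.count : Measure ℤ)
    Real.HolderConjugate.two_two (f := fun k => p2 (-(w k / 2))) (g := fun k => p2 (w k / 2) * a k)
    (measurable_of_countable _).aemeasurable (measurable_of_countable _).aemeasurable
  rw [lintegral_count, lintegral_count, lintegral_count] at h
  have e1 : ∀ k, ((fun k => p2 (-(w k / 2))) * fun k => p2 (w k / 2) * a k) k = a k := fun k => by
    simp only [Pi.mul_apply]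
    rw [← mul_assoc, ← p2_add, neg_add_cancel, p2_zero, one_mul]
  have e2 : ∀ k, p2 (-(w k / 2)) ^ (2 : ℝ) = p2 (-w k) := fun k => by
    rw [p2_rpow]; congr 1; ring
  have e3 : ∀ k, (p2 (w k / 2) * a k) ^ (2 : ℝ) = p2 (w k) * a k ^ 2 := fun k => by
    rw [ENNReal.mul_rpow_of_nonneg _ _ zero_le_two, p2_rpow, div_mul_cancel₀ _ two_ne_zero]
    norm_num
  simp only [e1, e2, e3] at h
  have h2 := pow_le_pow_left₀ zero_le h 2
  refine h2.trans (le_of_eq ?_)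
  rw [mul_pow, ← ENNReal.rpow_natCast, ← ENNReal.rpow_natCast, ← ENNReal.rpow_mul,
    ← ENNReal.rpow_mul]
  norm_num

lemma tsum_p2_abs_ne_top {c : ℝ} (hc : 0 < c) : ∑' k : ℤ, p2 (-(c * |(k : ℝ)|)) ≠ ∞ := by
  have hlt : p2 (-c) < 1 := by
    rw [p2]; exact ENNReal.rpow_lt_one_of_one_lt_of_neg (by norm_num) (by linarith)
  have hg : ∑' m : ℕ, p2 (-c) ^ m ≠ ∞ := by
    rw [ENNReal.tsum_geometric]
    exact ENNReal.inv_ne_top.2 (tsub_pos_of_lt hlt).ne'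
  have e : ∀ m : ℕ, p2 (-(c * (m : ℝ))) = p2 (-c) ^ m := fun m => by
    rw [← ENNReal.rpow_natCast, p2_rpow]; congr 1; ring
  rw [tsum_of_nat_of_neg_add_one ENNReal.summable ENNReal.summable]
  refine ENNReal.add_ne_top.2 ⟨?_, ?_⟩
  · refine ne_top_of_le_ne_top hg (ENNReal.tsum_le_tsum fun m => ?_)
    rw [← e]; simp
  · refine ne_top_of_le_ne_top hg (ENNReal.tsum_le_tsum fun m => ?_)
    rw [← e]
    refine p2_mono ?_
    have : |((-((m : ℤ) + 1) : ℤ) : ℝ)| = (m : ℝ) + 1 := by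
      push_cast; rw [abs_neg, abs_of_nonneg (by positivity)]
    rw [this]; nlinarith

lemma exists_tsum_p2_shift_le {c : ℝ} (hc : 0 < c) :
    ∃ K : ℝ≥0∞, K ≠ ∞ ∧ ∀ σ : ℝ, ∑' k : ℤ, p2 (-(c * |(k : ℝ) + σ|)) ≤ K := by
  refine ⟨p2 c * ∑' k : ℤ, p2 (-(c * |(k : ℝ)|)),
    ENNReal.mul_ne_top (p2_ne_top _) (tsum_p2_abs_ne_top hc), fun σ => ?_⟩
  rw [← (Equiv.addRight ⌊σ⌋).tsum_eq (fun k : ℤ => p2 (-(c * |(k : ℝ)|))), ← ENNReal.tsum_mul_left]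
  refine ENNReal.tsum_le_tsum fun k => ?_
  rw [← p2_add]
  refine p2_mono ?_
  have h1 : |((k + ⌊σ⌋ : ℤ) : ℝ)| ≤ |(k : ℝ) + σ| + 1 := by
    have h2 : |(⌊σ⌋ : ℝ) - σ| ≤ 1 := by
      rw [abs_le]; constructor <;> linarith [Int.floor_le σ, Int.lt_floor_add_one σ]
    calc |((k + ⌊σ⌋ : ℤ) : ℝ)| = |((k : ℝ) + σ) + ((⌊σ⌋ : ℝ) - σ)| := by push_cast; congr 1; ring
      _ ≤ _ := (abs_add_le _ _).trans (by linarith)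
  simp only [Equiv.coe_addRight]
  nlinarith

lemma exists_tsum_p2_affine_le {c a : ℝ} (hc : 0 < c) (ha : a ≠ 0) :
    ∃ K : ℝ≥0∞, K ≠ ∞ ∧ ∀ σ : ℝ, ∑' k : ℤ, p2 (-(c * |k * a + σ|)) ≤ K := by
  obtain ⟨K, hK, h⟩ := exists_tsum_p2_shift_le (mul_pos hc (abs_pos.2 ha))
  refine ⟨K, hK, fun σ => le_of_eq_of_le (tsum_congr fun k => ?_) (h (σ / a))⟩
  rw [mul_assoc, ← abs_mul, mul_add, mul_div_cancel₀ _ ha, mul_comm a]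

lemma exists_tsum_tsum_p2_le {c a₁ b₁ a₂ b₂ : ℝ} (hc : 0 < c) (hdet : a₁ * b₂ - a₂ * b₁ ≠ 0) :
    ∃ K : ℝ≥0∞, K ≠ ∞ ∧ ∀ σ τ : ℝ, ∑' x : ℤ, ∑' y : ℤ,
      p2 (-(c * (|x * a₁ + y * b₁ + σ| + |x * a₂ + y * b₂ + τ|))) ≤ K := by
  set D := a₁ * b₂ - a₂ * b₁ with hD
  set M := |a₁| + |b₁| + |a₂| + |b₂| with hM
  have hM0 : 0 < M := by
    rw [hM]
    by_contra! h
    have h1 : |a₁| = 0 := by linarith [abs_nonneg a₁, abs_nonneg b₁, abs_nonneg a₂, abs_nonneg b₂]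
    have h2 : |a₂| = 0 := by linarith [abs_nonneg a₁, abs_nonneg b₁, abs_nonneg a₂, abs_nonneg b₂]
    rw [abs_eq_zero] at h1 h2
    exact hdet (by rw [hD, h1, h2]; ring)
  have hD0 : 0 < |D| := abs_pos.2 hdet
  set c' := c * |D| / M with hc'
  have hc'0 : 0 < c' := by positivity
  obtain ⟨K, hK, h⟩ := exists_tsum_p2_shift_le hc'0
  refine ⟨K * K, ENNReal.mul_ne_top hK hK, fun σ τ => ?_⟩
  set u := (b₂ * σ - b₁ * τ) / D
  set v := (a₁ * τ - a₂ * σ) / D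
  calc _ ≤ ∑' x : ℤ, ∑' y : ℤ, p2 (-(c' * |(x : ℝ) + u|)) * p2 (-(c' * |(y : ℝ) + v|)) := by
        refine ENNReal.tsum_le_tsum fun x => ENNReal.tsum_le_tsum fun y => ?_
        rw [← p2_add]
        refine p2_mono ?_
        set L₁ := x * a₁ + y * b₁ + σ
        set L₂ := x * a₂ + y * b₂ + τ
        have e1 : |D| * |(x : ℝ) + u| = |b₂ * L₁ - b₁ * L₂| := by
          rw [← abs_mul]; congr 1
          rw [mul_add, mul_div_cancel₀ _ hdet]; ring
        have e2 : |D| * |(y : ℝ) + v| = |a₁ * L₂ - a₂ * L₁| := by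
          rw [← abs_mul]; congr 1
          rw [mul_add, mul_div_cancel₀ _ hdet]; ring
        have i1 : |b₂ * L₁ - b₁ * L₂| ≤ |b₂| * |L₁| + |b₁| * |L₂| := by
          rw [← abs_mul, ← abs_mul]; exact abs_sub _ _
        have i2 : |a₁ * L₂ - a₂ * L₁| ≤ |a₁| * |L₂| + |a₂| * |L₁| := by
          rw [← abs_mul, ← abs_mul]; exact abs_sub _ _
        have i3 : |D| * |(x : ℝ) + u| + |D| * |(y : ℝ) + v| ≤ M * (|L₁| + |L₂|) := by
          rw [e1, e2, hM]
          nlinarith [abs_nonneg a₁, abs_nonneg b₁, abs_nonneg a₂, abs_nonneg b₂, abs_nonneg L₁,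
            abs_nonneg L₂, mul_nonneg (abs_nonneg a₁) (abs_nonneg L₁),
            mul_nonneg (abs_nonneg b₁) (abs_nonneg L₁), mul_nonneg (abs_nonneg a₂) (abs_nonneg L₂),
            mul_nonneg (abs_nonneg b₂) (abs_nonneg L₂)]
        have i4 : c' * |(x : ℝ) + u| + c' * |(y : ℝ) + v| ≤ c * (|L₁| + |L₂|) := by
          calc _ = c / M * (|D| * |(x : ℝ) + u| + |D| * |(y : ℝ) + v|) := by rw [hc']; ring
            _ ≤ c / M * (M * (|L₁| + |L₂|)) := by gcongr
            _ = _ := by field_simp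
        linarith
    _ = (∑' x : ℤ, p2 (-(c' * |(x : ℝ) + u|))) * ∑' y : ℤ, p2 (-(c' * |(y : ℝ) + v|)) := by
        simp only [ENNReal.tsum_mul_left, ENNReal.tsum_mul_right]
    _ ≤ K * K := mul_le_mul' (h u) (h v)

/-- If a convex combination of three numbers vanishes, their minimum is quantitatively negative. -/
lemma exists_le_of_convex_comb_eq_zero {x y z θ₁ θ₂ θ₃ : ℝ} (h₁ : 0 < θ₁) (h₂ : 0 < θ₂)
    (h₃ : 0 < θ₃) (hsum : θ₁ + θ₂ + θ₃ = 1) (h : θ₁ * x + θ₂ * y + θ₃ * z = 0) :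
    x ≤ -((1 / θ₁ + 1 / θ₂)⁻¹ * (|x| + |y|)) ∨ y ≤ -((1 / θ₁ + 1 / θ₂)⁻¹ * (|x| + |y|)) ∨
      z ≤ -((1 / θ₁ + 1 / θ₂)⁻¹ * (|x| + |y|)) := by
  set μ := min x (min y z) with hμ
  have hx : μ ≤ x := min_le_left _ _
  have hy : μ ≤ y := (min_le_right _ _).trans (min_le_left _ _)
  have hz : μ ≤ z := (min_le_right _ _).trans (min_le_right _ _)
  have hμ0 : μ ≤ 0 := by nlinarith
  have bound : ∀ {w θ : ℝ}, 0 < θ → θ ≤ 1 → μ ≤ w → θ * (w - μ) ≤ -μ → |w| ≤ -μ / θ := by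
    intro w θ h0 h1 hw h
    rw [le_div_iff₀ h0]
    rcases abs_cases w with ⟨e, _⟩ | ⟨e, _⟩ <;> rw [e] <;> nlinarith
  have bx := bound h₁ (by linarith) hx (by nlinarith)
  have bY := bound h₂ (by linarith) hy (by nlinarith)
  have hpos : 0 < 1 / θ₁ + 1 / θ₂ := by positivity
  have key : (1 / θ₁ + 1 / θ₂)⁻¹ * (|x| + |y|) ≤ -μ := by
    rw [inv_mul_le_iff₀ hpos]
    calc _ ≤ -μ / θ₁ + -μ / θ₂ := add_le_add bx bY
      _ = _ := by ring
  rcases min_choice x (min y z) with h | h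
  · left; linarith
  rcases min_choice y z with h' | h'
  · right; left; rw [h, h'] at hμ; linarith
  · right; right; rw [h, h'] at hμ; linarith

section
variable {s : ℝ} {f : ℕ → Rn n → ℂ} {c : ℝ≥0∞} {U : ℤ → ℕ → ℝ × Rn n → ℂ} {N : ℤ → ℕ → ℝ≥0∞}

lemma sum_indicator_mul (S : Set ℕ) (J : Finset ℕ) (g : ℕ → ℝ≥0∞) :
    ∃ J' : Finset ℕ, (∀ j ∈ J', j ∈ S) ∧
      (∑ j ∈ J, S.indicator (fun _ => 1) j * g j = ∑ j ∈ J', g j) := by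
  classical
  refine ⟨J.filter (· ∈ S), fun j hj => (Finset.mem_filter.1 hj).2, ?_⟩
  rw [Finset.sum_filter]
  refine Finset.sum_congr rfl fun j _ => ?_
  by_cases h : j ∈ S <;> simp [h]

lemma tsum_indicator_mul_le (S : Set ℕ) (g : ℕ → ℝ≥0∞) {b : ℝ≥0∞}
    (h : ∀ J : Finset ℕ, (∀ j ∈ J, j ∈ S) → ∑ j ∈ J, g j ≤ b) :
    ∑' j, S.indicator (fun _ => 1) j * g j ≤ b := by
  rw [ENNReal.tsum_eq_iSup_sum]
  refine iSup_le fun J => ?_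
  obtain ⟨J', h1, h2⟩ := sum_indicator_mul S J g
  rw [h2]; exact h J' h1

lemma sum_le_tsum_indicator_mul {S : Set ℕ} {J : Finset ℕ} (hJ : ∀ j ∈ J, j ∈ S) (g : ℕ → ℝ≥0∞) :
    ∑ j ∈ J, g j ≤ ∑' j, S.indicator (fun _ => 1) j * g j := by
  refine le_trans (le_of_eq (Finset.sum_congr rfl fun j hj => ?_)) (ENNReal.sum_le_tsum J)
  simp [hJ j hj]

lemma Pieces.tsum_le_volume (P : Pieces n s f c U N) (S : Set ℕ) (k : ℤ) (E : Set (ℝ × Rn n)) :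
    ∑' j, S.indicator (fun _ => 1) j * ∫⁻ z in E, ‖U k j z‖ₑ ^ 2 ≤
      c * p2 (k * n) * volume E := by
  refine tsum_indicator_mul_le S _ fun J _ => ?_
  rw [← lintegral_finsetSum' _ fun j _ => ((P.meas k j).enorm.pow_const 2).aemeasurable,
    ← setLIntegral_const]
  exact lintegral_mono fun z => P.sum_le k J z

lemma Pieces.tsum_le_time (P : Pieces n s f c U N) (S : Set ℕ) (k : ℤ) {E : Set (ℝ × Rn n)}
    {F : Set ℝ} (h : E ⊆ F ×ˢ univ) :
    ∑' j, S.indicator (fun _ => 1) j * ∫⁻ z in E, ‖U k j z‖ₑ ^ 2 ≤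
      c * (volume F * ∑' j, S.indicator (fun _ => 1) j * N k j) := by
  refine tsum_indicator_mul_le S _ fun J hJ => (P.time_le k J E F h).trans ?_
  gcongr
  exact sum_le_tsum_indicator_mul hJ _

lemma Pieces.tsum_le_local (P : Pieces n s f c U N) (S : Set ℕ) (k : ℤ) {E : Set (ℝ × Rn n)}
    (hE : MeasurableSet E) (hEf : volume E ≠ ∞) {m : ℝ≥0∞} (hm : m ≠ ∞)
    (h : ∀ t, volume (Prod.mk t ⁻¹' E) ≤ m) :
    ∑' j, S.indicator (fun _ => 1) j * ∫⁻ z in E, ‖U k j z‖ₑ ^ 2 ≤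
      c * ((∑' j, S.indicator (fun _ => 1) j * N k j) ^ ((n : ℝ) / (n + 1)) *
        (m * volume E) ^ (1 / ((n : ℝ) + 1))) := by
  refine tsum_indicator_mul_le S _ fun J hJ => (P.local_le k J E hE hEf m hm h).trans ?_
  gcongr
  exact sum_le_tsum_indicator_mul hJ _

end

/-- Exponent coming from the pointwise bound. -/
def expO (d s i m k l : ℝ) : ℝ := k * (d - 2 * s) + l * 1 + (-i - m)

/-- Exponent coming from the bound in terms of the time support. -/
def expB (p s α i m k l : ℝ) : ℝ := k * (-(2 * s)) + l * (1 - α) + (-i + m * (p - 1))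

/-- Exponent coming from the localized bound. -/
def expA (d p q s α i m k l : ℝ) : ℝ :=
  i * (q - 1) + m * (p - 1) + l - 2 * s * k - l * α * d / (d + 1) - (i * q + 2 * m * p) / (d + 1)

lemma rpow_mul_rpow_le_add {a b : ℝ≥0∞} {θ : ℝ} (h0 : 0 ≤ θ) (h1 : θ ≤ 1) :
    a ^ θ * b ^ (1 - θ) ≤ a + b := by
  rcases le_total a b with h | h
  · calc _ ≤ b ^ θ * b ^ (1 - θ) := by gcongr
      _ = b := by
        rw [← ENNReal.rpow_add_of_nonneg _ _ h0 (by linarith), add_sub_cancel, ENNReal.rpow_one]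
      _ ≤ _ := le_add_self
  · calc _ ≤ a ^ θ * a ^ (1 - θ) := by gcongr
      _ = a := by
        rw [← ENNReal.rpow_add_of_nonneg _ _ h0 (by linarith), add_sub_cancel, ENNReal.rpow_one]
      _ ≤ _ := le_self_add

section
variable {s : ℝ} {f : ℕ → Rn n → ℂ} {c : ℝ≥0∞} {U : ℤ → ℕ → ℝ × Rn n → ℂ} {N : ℤ → ℕ → ℝ≥0∞}
  {p q α : ℝ} {E : ℤ → ℤ → Set (ℝ × Rn n)} {F : ℤ → Set ℝ}

lemma BlockFam.volume_ne_top (B : BlockFam n p q E F) (i m : ℤ) : volume (E i m) ≠ ∞ := by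
  have h : p2 (i * q + m * p) * volume (E i m) ≤ 1 :=
    ((ENNReal.le_tsum m).trans (ENNReal.le_tsum (f := fun i : ℤ => ∑' m : ℤ,
      p2 (i * q + m * p) * volume (E i m)) i)).trans B.total
  intro h'
  rw [h', ENNReal.mul_top (p2_ne_zero _)] at h
  exact absurd h (by simp)

lemma le_p2_mul_of_p2_mul_eq {x : ℝ} {a b : ℝ≥0∞} (h : p2 x * a = b) : a = p2 (-x) * b := by
  rw [← h, ← mul_assoc, ← p2_add, neg_add_cancel, p2_zero, one_mul]

lemma Pieces.block_le (P : Pieces n s f c U N) (B : BlockFam n p q E F) (S : Set ℕ)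
    (i m k l : ℤ) {x : ℝ}
    (hx : expO n s i m k l ≤ x ∨ expB p s α i m k l ≤ x ∨ expA n p q s α i m k l ≤ x) :
    p2 (i * (q - 1) + m * (p - 1) + l - 2 * s * k) *
        ∑' j, S.indicator (fun _ => 1) j * ∫⁻ z in E i m, ‖U k j z‖ₑ ^ 2 ≤
      c * p2 x * (p2 (l * α) * (∑' j, S.indicator (fun _ => 1) j * N k j) +
        p2 (i * q + m * p) * volume (E i m)) := by
  set ν := ∑' j, S.indicator (fun _ => 1) j * N k j with hν
  set β := p2 (l * α) * ν with hβ
  set ω := p2 (i * q + m * p) * volume (E i m) with hω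
  have eν : ν = p2 (-(l * α)) * β := le_p2_mul_of_p2_mul_eq rfl
  have eω : volume (E i m) = p2 (-(i * q + m * p)) * ω := le_p2_mul_of_p2_mul_eq rfl
  rcases hx with hx | hx | hx
  · calc _ ≤ p2 (i * (q - 1) + m * (p - 1) + l - 2 * s * k) *
          (c * p2 (k * n) * (p2 (-(i * q + m * p)) * ω)) := by
          rw [← eω]; gcongr; exact P.tsum_le_volume S k _
      _ = c * p2 (expO n s i m k l) * ω := by
          have : expO n s i m k l = (i * (q - 1) + m * (p - 1) + l - 2 * s * k) + k * n +
            -(i * q + m * p) := by unfold expO; ring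
          rw [this, p2_add, p2_add]; ring
      _ ≤ _ := mul_le_mul' (mul_le_mul' le_rfl (p2_mono hx)) le_add_self
  · calc _ ≤ p2 (i * (q - 1) + m * (p - 1) + l - 2 * s * k) *
          (c * (p2 (-(i * q)) * (p2 (-(l * α)) * β))) := by
          rw [← eν]; gcongr
          refine (P.tsum_le_time S k (B.sub i m)).trans ?_
          gcongr; exact B.time i
      _ = c * p2 (expB p s α i m k l) * β := by
          have : expB p s α i m k l = (i * (q - 1) + m * (p - 1) + l - 2 * s * k) + -(i * q) +
            -(l * α) := by unfold expB; ring
          rw [this, p2_add, p2_add]; ring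
      _ ≤ _ := mul_le_mul' (mul_le_mul' le_rfl (p2_mono hx)) le_self_add
  · have hn0 : (0 : ℝ) < (n : ℝ) + 1 := by positivity
    have hθ : 1 / ((n : ℝ) + 1) = 1 - (n : ℝ) / (n + 1) := by field_simp; ring
    calc _ ≤ p2 (i * (q - 1) + m * (p - 1) + l - 2 * s * k) *
          (c * ((p2 (-(l * α)) * β) ^ ((n : ℝ) / (n + 1)) *
            (p2 (-(m * p)) * (p2 (-(i * q + m * p)) * ω)) ^ (1 / ((n : ℝ) + 1)))) := by
          rw [← eν, ← eω]; gcongr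
          exact P.tsum_le_local S k (B.meas i m) (B.volume_ne_top i m) (p2_ne_top _) (B.slice i m)
      _ = c * p2 (expA n p q s α i m k l) *
            (β ^ ((n : ℝ) / (n + 1)) * ω ^ (1 - (n : ℝ) / (n + 1))) := by
          have : expA n p q s α i m k l = (i * (q - 1) + m * (p - 1) + l - 2 * s * k) +
            -(l * α) * ((n : ℝ) / (n + 1)) + -(m * p) * (1 / ((n : ℝ) + 1)) +
            -(i * q + m * p) * (1 / ((n : ℝ) + 1)) := by unfold expA; ring
          rw [this, p2_add, p2_add, p2_add, ← hθ,
            ENNReal.mul_rpow_of_nonneg _ β (by positivity),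
            ENNReal.mul_rpow_of_nonneg _ (_ * ω) (by positivity),
            ENNReal.mul_rpow_of_nonneg _ ω (by positivity), p2_rpow, p2_rpow, p2_rpow]
          ring
      _ ≤ _ := mul_le_mul' (mul_le_mul' le_rfl (p2_mono hx)) (rpow_mul_rpow_le_add (by positivity)
          (by rw [div_le_one hn0]; linarith))

end

/-- The indices at which a sequence has size about `2^l`. -/
def levelIdx (μ : ℕ → ℝ≥0∞) (l : ℤ) : Set ℕ := {j | p2 l ≤ μ j ∧ μ j < p2 (l + 1)}

lemma le_tsum_levelIdx {μ : ℕ → ℝ≥0∞} {j : ℕ} (h : μ j ≠ ∞) :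
    μ j ≤ ∑' l : ℤ, p2 (l + 1) * (levelIdx μ l).indicator (fun _ => 1) j := by
  by_cases h0 : μ j = 0
  · rw [h0]; exact zero_le
  obtain ⟨l, hl⟩ := exists_p2_le_lt h0 h
  refine le_trans ?_ (ENNReal.le_tsum l)
  rw [indicator_of_mem (show j ∈ levelIdx μ l from hl), mul_one]
  exact hl.2.le

lemma tsum_levelIdx_le {μ : ℕ → ℝ≥0∞} {α : ℝ} (hα : 0 ≤ α) (j : ℕ) :
    ∑' l : ℤ, p2 (l * α) * (levelIdx μ l).indicator (fun _ => 1) j ≤ μ j ^ α := by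
  by_cases h : ∃ l, j ∈ levelIdx μ l
  · obtain ⟨l, hl⟩ := h
    rw [tsum_eq_single l fun l' hl' => ?_, indicator_of_mem hl, mul_one, ← p2_rpow]
    · exact ENNReal.rpow_le_rpow hl.1 hα
    · rw [indicator_of_notMem, mul_zero]
      exact fun h' => hl' (int_eq_of_p2_le_lt h'.1 h'.2 hl.1 hl.2)
  · push Not at h
    simp [h]

lemma exists_exp_le {p q s α : ℝ} (hn : 2 ≤ n) (hp : 0 < p) (hq : 0 < q)
    (hab : 1 / q < (n : ℝ) / (n - 1) * (1 / p)) (hs0 : 0 < s)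
    (hs : 2 * s = n - (2 / q + n / p)) (hα : α = n / (1 / q + n / p)) :
    ∃ c : ℝ, 0 < c ∧ ∀ i m k l : ℝ,
      expO n s i m k l ≤ -(c * (|expO n s i m k l| + |expB p s α i m k l|)) ∨
      expB p s α i m k l ≤ -(c * (|expO n s i m k l| + |expB p s α i m k l|)) ∨
      expA n p q s α i m k l ≤ -(c * (|expO n s i m k l| + |expB p s α i m k l|)) := by
  have hd : (2 : ℝ) ≤ n := by exact_mod_cast hn
  set d : ℝ := (n : ℝ)
  have hd0 : 0 < d := by linarith
  set a := 1 / p with ha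
  set b := 1 / q with hb
  have ha0 : 0 < a := by positivity
  have hb0 : 0 < b := by positivity
  have hpa : p * a = 1 := by rw [ha]; field_simp
  have hqb : q * b = 1 := by rw [hb]; field_simp
  have hs' : 2 * s = d - (2 * b + d * a) := by rw [hs, ha, hb]; ring
  have hα' : α * (b + d * a) = d := by
    rw [hα, show d / p = d * a by rw [ha]; ring]; field_simp
  set θA := (d + 1) / d * b with hθA
  set θB := a - (d - 1) / d * b with hθB
  set θO := 2 * s / d with hθO
  have hA0 : 0 < θA := by positivity
  have hO0 : 0 < θO := by positivity
  have hB0 : 0 < θB := by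
    have h1 : 0 < (d - 1) / d := div_pos (by linarith) hd0
    have h2 := mul_lt_mul_of_pos_left hab h1
    have h3 : (d - 1) / d * (d / (d - 1) * a) = a := by
      have : d - 1 ≠ 0 := by linarith
      field_simp
    rw [hθB]; linarith
  have hsum : θO + θB + θA = 1 := by
    rw [hθA, hθB, hθO, hs']; field_simp; ring
  refine ⟨(1 / θO + 1 / θB)⁻¹, by positivity, fun i m k l => ?_⟩
  refine exists_le_of_convex_comb_eq_zero hO0 hB0 hA0 hsum ?_
  have cA : θA * d / (d + 1) = b := by rw [hθA]; field_simp
  have cA' : θA / (d + 1) = b / d := by rw [hθA]; field_simp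
  have cO : θO * d = 2 * s := by rw [hθO]; field_simp
  have cB : θB = a - b + b / d := by rw [hθB]; field_simp; ring
  have key : θO * expO d s i m k l + θB * expB p s α i m k l + θA * expA d p q s α i m k l =
      i * (-(θO + θB + θA) + θA * q - (θA / (d + 1)) * q) +
      m * (-(θO + θB + θA) + θB * p + θA * p - 2 * (θA / (d + 1)) * p) +
      l * ((θO + θB + θA) - θB * α - α * (θA * d / (d + 1))) +
      k * (θO * d - 2 * s * (θO + θB + θA)) := by
    unfold expO expB expA; ring
  rw [key, hsum, cA, cA', cO, cB]
  have hA1 : θA = b + b / d := by rw [hθA]; field_simp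
  rw [hA1]
  have e1 : α * (a + b / d) = 1 := by
    have : α * (a + b / d) = α * (b + d * a) / d := by field_simp; ring
    rw [this, hα']; field_simp
  linear_combination i * hqb + m * hpa - l * e1

section
variable {s : ℝ} {f : ℕ → Rn n → ℂ} {c : ℝ≥0∞} {U : ℤ → ℕ → ℝ × Rn n → ℂ} {N : ℤ → ℕ → ℝ≥0∞}
  {p q α : ℝ} {E : ℤ → ℤ → Set (ℝ × Rn n)} {F : ℤ → Set ℝ}

/-- The majorant of the density provided by the frequency decomposition. -/
def majorant (s : ℝ) (c : ℝ≥0∞) (U : ℤ → ℕ → ℝ × Rn n → ℂ) (μ : ℕ → ℝ≥0∞) (z : ℝ × Rn n) : ℝ≥0∞ :=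
  ∑' j, μ j * (c * ∑' k : ℤ, p2 (-(k * s)) * ‖U k j z‖ₑ) ^ 2

lemma Pieces.measurable_majorant (P : Pieces n s f c U N) (μ : ℕ → ℝ≥0∞) :
    Measurable (majorant s c U μ) :=
  Measurable.tsum fun j => (((Measurable.tsum fun k =>
    (P.meas k j).enorm.const_mul _).const_mul _).pow_const 2).const_mul _

lemma majorant_le {μ : ℕ → ℝ≥0∞} (hμ : ∀ j, μ j ≠ ∞) (w : ℤ → ℤ → ℝ) {K : ℝ≥0∞}
    (hw : ∀ l, ∑' k, p2 (-w l k) ≤ K) (z : ℝ × Rn n) :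
    majorant s c U μ z ≤ ∑' l : ℤ, ∑' k : ℤ, 2 * c ^ 2 * K * p2 (w l k + l - 2 * s * k) *
      ∑' j, (levelIdx μ l).indicator (fun _ => 1) j * ‖U k j z‖ₑ ^ 2 := by
  have h1 : ∀ l j, (c * ∑' k : ℤ, p2 (-(k * s)) * ‖U k j z‖ₑ) ^ 2 ≤
      ∑' k : ℤ, c ^ 2 * K * p2 (w l k - 2 * s * k) * ‖U k j z‖ₑ ^ 2 := fun l j => by
    rw [mul_pow]
    calc _ ≤ c ^ 2 * ((∑' k, p2 (-w l k)) *
          ∑' k : ℤ, p2 (w l k) * (p2 (-(k * s)) * ‖U k j z‖ₑ) ^ 2) := by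
          gcongr; exact tsum_sq_le_weighted _ _
      _ ≤ c ^ 2 * (K * ∑' k : ℤ, p2 (w l k) * (p2 (-(k * s)) * ‖U k j z‖ₑ) ^ 2) := by
          gcongr; exact hw l
      _ = _ := by
          rw [← mul_assoc, ← ENNReal.tsum_mul_left]
          refine tsum_congr fun k => ?_
          rw [show w l k - 2 * s * k = w l k + -(k * s) + -(k * s) by ring, p2_add, p2_add]
          ring
  calc majorant s c U μ z ≤ ∑' j, (∑' l : ℤ, p2 (l + 1) *
        (levelIdx μ l).indicator (fun _ => 1) j) *
          (c * ∑' k : ℤ, p2 (-(k * s)) * ‖U k j z‖ₑ) ^ 2 :=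
        ENNReal.tsum_le_tsum fun j => mul_le_mul' (le_tsum_levelIdx (hμ j)) le_rfl
    _ ≤ ∑' j, ∑' l : ℤ, ∑' k : ℤ, 2 * c ^ 2 * K * p2 (w l k + l - 2 * s * k) *
          ((levelIdx μ l).indicator (fun _ => 1) j * ‖U k j z‖ₑ ^ 2) := by
        refine ENNReal.tsum_le_tsum fun j => ?_
        rw [← ENNReal.tsum_mul_right]
        refine ENNReal.tsum_le_tsum fun l => ?_
        refine (mul_le_mul' le_rfl (h1 l j)).trans (le_of_eq ?_)
        rw [← ENNReal.tsum_mul_left]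
        refine tsum_congr fun k => ?_
        rw [show w l k + l - 2 * s * k = w l k - 2 * s * k + l by ring, p2_add _ (l : ℝ),
          p2_add (l : ℝ) 1, show p2 1 = 2 from ENNReal.rpow_one _]
        ring
    _ = _ := by
        rw [ENNReal.tsum_comm]
        refine tsum_congr fun l => ?_
        rw [ENNReal.tsum_comm]
        refine tsum_congr fun k => ?_
        rw [ENNReal.tsum_mul_left]

lemma Pieces.setLIntegral_majorant_le (P : Pieces n s f c U N) {μ : ℕ → ℝ≥0∞} (hμ : ∀ j, μ j ≠ ∞)
    (w : ℤ → ℤ → ℝ) {K : ℝ≥0∞} (hw : ∀ l, ∑' k, p2 (-w l k) ≤ K) (G : Set (ℝ × Rn n)) :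
    ∫⁻ z in G, majorant s c U μ z ≤ ∑' l : ℤ, ∑' k : ℤ,
      2 * c ^ 2 * K * p2 (w l k + l - 2 * s * k) *
      ∑' j, (levelIdx μ l).indicator (fun _ => 1) j * ∫⁻ z in G, ‖U k j z‖ₑ ^ 2 := by
  refine (lintegral_mono fun z => majorant_le hμ w hw z).trans (le_of_eq ?_)
  have m1 : ∀ (l k : ℤ) j, Measurable fun z =>
      (levelIdx μ l).indicator (fun _ => (1 : ℝ≥0∞)) j * ‖U k j z‖ₑ ^ 2 := fun l k j =>
    ((P.meas k j).enorm.pow_const 2).const_mul _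
  have m2 : ∀ l k : ℤ, Measurable fun z =>
      ∑' j, (levelIdx μ l).indicator (fun _ => (1 : ℝ≥0∞)) j * ‖U k j z‖ₑ ^ 2 := fun l k =>
    Measurable.tsum (m1 l k)
  have m3 : ∀ l k : ℤ, Measurable fun z => 2 * c ^ 2 * K * p2 (w l k + l - 2 * s * k) *
      ∑' j, (levelIdx μ l).indicator (fun _ => (1 : ℝ≥0∞)) j * ‖U k j z‖ₑ ^ 2 := fun l k =>
    (m2 l k).const_mul _
  rw [lintegral_tsum fun l => (Measurable.tsum (m3 l)).aemeasurable]
  refine tsum_congr fun l => ?_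
  rw [lintegral_tsum fun k => (m3 l k).aemeasurable]
  refine tsum_congr fun k => ?_
  rw [lintegral_const_mul _ (m2 l k), lintegral_tsum fun j => (m1 l k j).aemeasurable]
  congr 1
  refine tsum_congr fun j => ?_
  exact lintegral_const_mul _ ((P.meas k j).enorm.pow_const 2)

end

lemma exists_blockSum_majorant_le {p q s α : ℝ} (hn : 2 ≤ n) (hp : 0 < p) (hq : 0 < q)
    (hab : 1 / q < (n : ℝ) / (n - 1) * (1 / p)) (hs0 : 0 < s)
    (hs : 2 * s = n - (2 / q + n / p)) (hα : α = n / (1 / q + n / p)) {c : ℝ≥0∞} (hc : c ≠ ∞) :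
    ∃ C : ℝ≥0∞, C ≠ ∞ ∧ ∀ (f : ℕ → Rn n → ℂ) (U : ℤ → ℕ → ℝ × Rn n → ℂ) (N : ℤ → ℕ → ℝ≥0∞),
      Pieces n s f c U N → ∀ μ : ℕ → ℝ≥0∞, (∀ j, μ j ≠ ∞) → ∑' j, μ j ^ α ≤ 1 →
      ∀ E F, BlockFam n p q E F → blockSum p q (majorant s c U μ) E ≤ C := by
  obtain ⟨c₀, hc₀, hmin⟩ := exists_exp_le hn hp hq hab hs0 hs hα
  have hn0 : (0 : ℝ) < n := by positivity
  have hα0 : 0 < α := by rw [hα]; positivity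
  have hds : 0 < (n : ℝ) - 2 * s := by rw [hs]; ring_nf; positivity
  have hdet1 : ((n : ℝ) - 2 * s) * (1 - α) - (-(2 * s)) * 1 ≠ 0 := by
    have h1 : α * (1 / q + n / p) = n := by rw [hα]; field_simp
    have h2 : (n : ℝ) - 2 * s = 1 / q + (1 / q + n / p) := by rw [hs]; ring
    have h3 : (n : ℝ) - α * (n - 2 * s) = -(α * (1 / q)) := by rw [h2, mul_add, h1]; ring
    have h4 : 0 < α * (1 / q) := by positivity
    have : ((n : ℝ) - 2 * s) * (1 - α) - (-(2 * s)) * 1 = n - α * (n - 2 * s) := by ring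
    rw [this, h3]; linarith
  have hdet2 : (-1 : ℝ) * (p - 1) - (-1) * (-1) ≠ 0 := by
    have : (-1 : ℝ) * (p - 1) - (-1) * (-1) = -p := by ring
    rw [this]; linarith
  have hc2 : 0 < c₀ / 2 := by positivity
  obtain ⟨K, hK, hKs⟩ := exists_tsum_p2_affine_le hc2 hds.ne'
  obtain ⟨K₁, hK₁, hKs₁⟩ := exists_tsum_tsum_p2_le hc2 hdet1
  obtain ⟨K₂, hK₂, hKs₂⟩ := exists_tsum_tsum_p2_le hc2 hdet2
  refine ⟨2 * c ^ 3 * K * (K₁ + K₂), by finiteness, ?_⟩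
  intro f U N P μ hμ hμ1 E F B
  set ω : ℤ → ℤ → ℝ≥0∞ := fun i m => p2 (i * q + m * p) * volume (E i m) with hω
  set β : ℤ → ℤ → ℝ≥0∞ := fun l k =>
    p2 (l * α) * ∑' j, (levelIdx μ l).indicator (fun _ => 1) j * N k j with hβ
  set W : ℤ → ℤ → ℤ → ℤ → ℝ≥0∞ := fun i m l k =>
    p2 (-(c₀ / 2 * (|expO n s i m k l| + |expB p s α i m k l|))) with hW
  have hβ1 : ∑' l, ∑' k, β l k ≤ 1 := by
    calc ∑' l, ∑' k, β l k = ∑' l : ℤ, ∑' j, p2 (l * α) *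
          (levelIdx μ l).indicator (fun _ => 1) j * ∑' k, N k j := by
          refine tsum_congr fun l => ?_
          simp only [hβ]
          rw [ENNReal.tsum_mul_left, ENNReal.tsum_comm, ← ENNReal.tsum_mul_left]
          refine tsum_congr fun j => ?_
          rw [ENNReal.tsum_mul_left, mul_assoc]
      _ ≤ ∑' l : ℤ, ∑' j, p2 (l * α) * (levelIdx μ l).indicator (fun _ => 1) j :=
          ENNReal.tsum_le_tsum fun l => ENNReal.tsum_le_tsum fun j =>
            mul_le_of_le_one_right' (P.mass j)
      _ ≤ ∑' j, μ j ^ α := by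
          rw [ENNReal.tsum_comm]
          exact ENNReal.tsum_le_tsum fun j => tsum_levelIdx_le hα0.le j
      _ ≤ 1 := hμ1
  have hterm : ∀ i m : ℤ, p2 (i * (q - 1) + m * (p - 1)) * ∫⁻ z in E i m, majorant s c U μ z ≤
      2 * c ^ 3 * K * ∑' l, ∑' k, W i m l k * (β l k + ω i m) := fun i m => by
    have h := P.setLIntegral_majorant_le hμ (fun l k => c₀ / 2 * |expO n s i m k l|) (K := K)
      (fun l => by
        refine le_of_eq_of_le (tsum_congr fun k => ?_) (hKs (l * 1 + (-i - m)))
        rw [expO, add_assoc]) (E i m)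
    refine (mul_le_mul' le_rfl h).trans ?_
    rw [← ENNReal.tsum_mul_left, ← ENNReal.tsum_mul_left]
    refine ENNReal.tsum_le_tsum fun l => ?_
    rw [← ENNReal.tsum_mul_left, ← ENNReal.tsum_mul_left]
    refine ENNReal.tsum_le_tsum fun k => ?_
    have hb := P.block_le (α := α) B (levelIdx μ l) i m k l (hmin i m k l)
    calc _ = 2 * c ^ 2 * K * p2 (c₀ / 2 * |expO n s i m k l|) *
          (p2 (i * (q - 1) + m * (p - 1) + l - 2 * s * k) *
          ∑' j, (levelIdx μ l).indicator (fun _ => 1) j * ∫⁻ z in E i m, ‖U k j z‖ₑ ^ 2) := by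
          have e1 : p2 (c₀ / 2 * |expO n s i m k l| + l - 2 * s * k) =
              p2 (c₀ / 2 * |expO n s i m k l|) * p2 (l - 2 * s * k) := by
            rw [← p2_add, add_sub_assoc]
          have e2 : p2 (i * (q - 1) + m * (p - 1) + l - 2 * s * k) =
              p2 (i * (q - 1) + m * (p - 1)) * p2 (l - 2 * s * k) := by
            rw [← p2_add, add_sub_assoc]
          rw [e1, e2]
          ring
      _ ≤ 2 * c ^ 2 * K * p2 (c₀ / 2 * |expO n s i m k l|) *
          (c * p2 (-(c₀ * (|expO n s i m k l| + |expB p s α i m k l|))) * (β l k + ω i m)) :=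
          mul_le_mul' le_rfl hb
      _ = 2 * c ^ 3 * K * (p2 (c₀ / 2 * |expO n s i m k l| +
          -(c₀ * (|expO n s i m k l| + |expB p s α i m k l|))) * (β l k + ω i m)) := by
          rw [p2_add]; ring
      _ ≤ _ := by
          gcongr
          refine p2_mono ?_
          nlinarith [abs_nonneg (expB p s α i m k l), abs_nonneg (expO n s i m k l)]
  have hS1 : ∀ i m : ℤ, ∑' l, ∑' k, W i m l k ≤ K₁ := fun i m => by
    rw [ENNReal.tsum_comm]
    exact hKs₁ (-i - m) (-i + m * (p - 1))
  have hS2 : ∀ l k : ℤ, ∑' i, ∑' m, W i m l k ≤ K₂ := fun l k => by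
    refine le_of_eq_of_le (tsum_congr fun i => tsum_congr fun m => ?_)
      (hKs₂ (k * (n - 2 * s) + l * 1) (k * (-(2 * s)) + l * (1 - α)))
    simp only [hW, expO, expB]
    rw [show (k * (n - 2 * s) + l * 1 + (-i - m) : ℝ) =
        i * (-1) + m * (-1) + (k * (n - 2 * s) + l * 1) by ring,
      show (k * (-(2 * s)) + l * (1 - α) + (-i + m * (p - 1)) : ℝ) =
        i * (-1) + m * (p - 1) + (k * (-(2 * s)) + l * (1 - α)) by ring]
  calc blockSum p q (majorant s c U μ) E
      ≤ ∑' i, ∑' m, 2 * c ^ 3 * K * ∑' l, ∑' k, W i m l k * (β l k + ω i m) :=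
        ENNReal.tsum_le_tsum fun i => ENNReal.tsum_le_tsum fun m => hterm i m
    _ = 2 * c ^ 3 * K * (∑' i, ∑' m, ∑' l, ∑' k, W i m l k * β l k +
          ∑' i, ∑' m, (∑' l, ∑' k, W i m l k) * ω i m) := by
        simp only [mul_add, ENNReal.tsum_add, ENNReal.tsum_mul_left, ENNReal.tsum_mul_right]
    _ ≤ 2 * c ^ 3 * K * (K₂ * 1 + K₁ * 1) := by
        gcongr
        · calc ∑' i, ∑' m, ∑' l, ∑' k, W i m l k * β l k
              = ∑' l, ∑' k, (∑' i, ∑' m, W i m l k) * β l k := by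
                have e1 : ∀ i, ∑' m, ∑' l, ∑' k, W i m l k * β l k =
                    ∑' l, ∑' k, ∑' m, W i m l k * β l k := fun i => by
                  rw [ENNReal.tsum_comm]
                  exact tsum_congr fun l => ENNReal.tsum_comm
                simp only [e1]
                rw [ENNReal.tsum_comm]
                refine tsum_congr fun l => ?_
                rw [ENNReal.tsum_comm]
                simp only [ENNReal.tsum_mul_right]
            _ ≤ ∑' l, ∑' k, K₂ * β l k := ENNReal.tsum_le_tsum fun l =>
                ENNReal.tsum_le_tsum fun k => mul_le_mul' (hS2 l k) le_rfl
            _ ≤ K₂ * 1 := by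
                simp only [ENNReal.tsum_mul_left]; gcongr
        · calc _ ≤ ∑' i, ∑' m, K₁ * ω i m := ENNReal.tsum_le_tsum fun i =>
                ENNReal.tsum_le_tsum fun m => mul_le_mul' (hS1 i m) le_rfl
            _ ≤ K₁ * 1 := by
                simp only [ENNReal.tsum_mul_left]; gcongr; exact B.total
    _ = _ := by ring

lemma mixedLp_eq_mixedL {p q : ℝ} (hp : 0 < p) (hq : 0 < q) (u : ℝ → Rn n → ℝ) :
    mixedLp (ENNReal.ofReal q) (ENNReal.ofReal p) u = mixedL p q fun z => ‖u z.1 z.2‖ₑ := by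
  have hp' : ENNReal.ofReal p ≠ 0 := by simpa using hp
  rw [mixedLp, eLp, if_neg ofReal_ne_top, mixedL, toReal_ofReal hq.le]
  congr 1
  refine lintegral_congr fun t => ?_
  rw [eLpNorm_eq_lintegral_rpow_enorm_toReal hp' ofReal_ne_top, toReal_ofReal hp.le,
    ← ENNReal.rpow_mul]
  congr 1; ring

lemma mixedL_mono {p q : ℝ} (hp : 0 < p) (hq : 0 < q) {ρ σ : ℝ × Rn n → ℝ≥0∞}
    (h : ∀ z, ρ z ≤ σ z) : mixedL p q ρ ≤ mixedL p q σ :=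
  ENNReal.rpow_le_rpow (lintegral_mono fun t => ENNReal.rpow_le_rpow (lintegral_mono fun x =>
    ENNReal.rpow_le_rpow (h _) hp.le) (by positivity)) (by positivity)

lemma blockSum_const_mul {p q : ℝ} {a : ℝ≥0∞} (ha : a ≠ ∞) (ρ : ℝ × Rn n → ℝ≥0∞)
    (E : ℤ → ℤ → Set (ℝ × Rn n)) : blockSum p q (fun z => a * ρ z) E = a * blockSum p q ρ E := by
  simp only [blockSum, ← ENNReal.tsum_mul_left]
  refine tsum_congr fun i => tsum_congr fun m => ?_
  rw [lintegral_const_mul' _ _ ha]; ring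

lemma seqNormE_ofReal {α : ℝ} (hα : 0 ≤ α) (lam : ℕ → ℝ) :
    seqNormE (ENNReal.ofReal α) lam = (∑' j, ENNReal.ofReal |lam j| ^ α) ^ (1 / α) := by
  rw [seqNormE, if_neg ofReal_ne_top, toReal_ofReal hα]

lemma Pieces.enorm_density_le {s : ℝ} {f : ℕ → Rn n → ℂ} {c : ℝ≥0∞} {U : ℤ → ℕ → ℝ × Rn n → ℂ}
    {N : ℤ → ℕ → ℝ≥0∞} (P : Pieces n s f c U N) (lam : ℕ → ℝ) (z : ℝ × Rn n) :
    ‖density lam f z.1 z.2‖ₑ ≤ majorant s c U (fun j => ENNReal.ofReal |lam j|) z := by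
  refine enorm_tsum_le_tsum_enorm.trans (ENNReal.tsum_le_tsum fun j => ?_)
  rw [enorm_mul, Real.enorm_eq_ofReal_abs, enorm_pow, enorm_norm]
  gcongr
  exact P.enorm_le j z.1 z.2

lemma exists_strichartz {p q s α : ℝ} (hn : 2 ≤ n) (hp : 1 < p) (hq : 1 < q)
    (hab : 1 / q < (n : ℝ) / (n - 1) * (1 / p)) (hs0 : 0 < s)
    (hs : 2 * s = n - (2 / q + n / p)) (hα : α = n / (1 / q + n / p)) :
    ∃ C : ℝ, 0 < C ∧ ∀ (f : ℕ → Rn n → ℂ) (lam : ℕ → ℝ),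
      OrthonormalHs s f → seqNormE (ENNReal.ofReal α) lam ≠ ∞ →
      mixedLp (ENNReal.ofReal q) (ENNReal.ofReal p) (density lam f)
        ≤ ENNReal.ofReal C * seqNormE (ENNReal.ofReal α) lam := by
  have hp0 : 0 < p := by linarith
  have hq0 : 0 < q := by linarith
  have hn0 : (0 : ℝ) < n := by positivity
  have hα0 : 0 < α := by rw [hα]; positivity
  set c := ENNReal.ofReal (cP n)
  obtain ⟨C, hC, h⟩ := exists_blockSum_majorant_le hn hp0 hq0 hab hs0 hs hα (c := c) ofReal_ne_top
  have hfin : p2 (p + q) * C ≠ ∞ := ENNReal.mul_ne_top (p2_ne_top _) hC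
  refine ⟨(p2 (p + q) * C).toReal + 1, by positivity, fun f lam hf hlam => ?_⟩
  obtain ⟨U, N, P⟩ : ∃ U N, Pieces n s f c U N := ⟨_, _, hf.pieces hn hs0.le⟩
  rw [mixedLp_eq_mixedL hp0 hq0]
  set A := seqNormE (ENNReal.ofReal α) lam with hA
  set μ : ℕ → ℝ≥0∞ := fun j => ENNReal.ofReal |lam j| with hμ
  have hAα : ∑' j, μ j ^ α = A ^ α := by
    rw [hA, seqNormE_ofReal hα0.le, ← ENNReal.rpow_mul, one_div_mul_cancel hα0.ne',
      ENNReal.rpow_one]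
  refine (mixedL_mono hp0 hq0 fun z => P.enorm_density_le lam z).trans ?_
  by_cases hA0 : A = 0
  · have hμ0 : ∀ j, μ j = 0 := fun j => by
      have h1 := ENNReal.le_tsum (f := fun j => μ j ^ α) j
      rw [hAα, hA0, ENNReal.zero_rpow_of_pos hα0] at h1
      have h2 := le_antisymm h1 zero_le
      rw [ENNReal.rpow_eq_zero_iff] at h2
      rcases h2 with h2 | h2
      · exact h2.1
      · linarith [h2.2]
    have : majorant s c U μ = fun _ => 0 := by
      funext z; simp [majorant, hμ0]
    rw [this]
    simp [mixedL, ENNReal.zero_rpow_of_pos hp0, ENNReal.zero_rpow_of_pos (div_pos hq0 hp0),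
      ENNReal.zero_rpow_of_pos (inv_pos.2 hq0)]
  have hscale : ∀ j, μ j = A * (μ j / A) := fun j => (ENNReal.mul_div_cancel hA0 hlam).symm
  have hfun : majorant s c U μ = fun z => A * majorant s c U (fun j => μ j / A) z := by
    funext z
    simp only [majorant, ← ENNReal.tsum_mul_left]
    refine tsum_congr fun j => ?_
    conv_lhs => rw [hscale j]
    rw [mul_assoc]
  have hsum : ∑' j, (μ j / A) ^ α ≤ 1 := by
    simp only [div_eq_mul_inv, ENNReal.mul_rpow_of_nonneg _ _ hα0.le, ENNReal.inv_rpow]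
    rw [ENNReal.tsum_mul_right, hAα]
    exact ENNReal.mul_inv_le_one _
  have hb := mixedL_le_of_blockSum_le (K := A * C) hp hq (P.measurable_majorant μ)
    fun E F B => by
      rw [hfun, blockSum_const_mul hlam]
      gcongr
      exact h f _ _ P _ (fun j => ENNReal.div_ne_top ofReal_ne_top hA0) hsum E F B
  calc _ ≤ p2 (p + q) * (A * C) := hb
    _ = (p2 (p + q) * C) * A := by ring
    _ ≤ _ := by
      gcongr
      exact (ENNReal.ofReal_toReal hfin).symm.le.trans (ENNReal.ofReal_le_ofReal (by linarith))

open scoped FourierTransform in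
lemma exists_FT_eq {g : Rn n → ℂ} (hg : ContDiff ℝ (⊤ : ℕ∞) g) (hc : HasCompactSupport g) :
    ∃ f, FT f = g := by
  let S : SchwartzMap (Rn n) ℂ := hc.toSchwartzMap hg
  have hS : (𝓕 (𝓕⁻ S : SchwartzMap (Rn n) ℂ) : SchwartzMap (Rn n) ℂ) = S :=
    FourierTransform.fourier_fourierInv_eq S
  obtain ⟨h, hF⟩ : ∃ h : Rn n → ℂ, 𝓕 h = g :=
    ⟨⇑(𝓕⁻ S : SchwartzMap (Rn n) ℂ), by rw [← SchwartzMap.fourier_coe, hS]; rfl⟩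
  have h2 : (0 : ℝ) < 2 * π := by positivity
  refine ⟨fun x => (((2 * π) ^ n)⁻¹ : ℝ) • h ((2 * π)⁻¹ • x), ?_⟩
  ext ξ
  rw [← hF, Real.fourier_eq', FT]
  have key := Measure.integral_comp_inv_smul_of_nonneg (volume : Measure (Rn n))
    (fun y : Rn n => (((2 * π) ^ n)⁻¹ : ℝ) •
      (Complex.exp ((↑(-2 * π * inner ℝ y ξ) : ℂ) * Complex.I) • h y)) h2.le
  conv_rhs at key => rw [integral_smul, smul_smul, finrank_euclideanSpace_fin,
    mul_inv_cancel₀ (by positivity), one_smul]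
  rw [← key]
  refine integral_congr_ae (Eventually.of_forall fun x => ?_)
  simp only [mul_smul_comm, smul_eq_mul]
  congr 3
  rw [dotC_eq_inner, inner_smul_left]
  push_cast
  simp only [conj_trivial]
  push_cast
  have : (π : ℂ) ≠ 0 := by exact_mod_cast pi_ne_zero
  field_simp

/-- A smooth bump equal to `1` on the ball of radius `1/8` about `a`, supported in radius `1/4`. -/
def bumpAt (a : Rn n) : ContDiffBump a := ⟨1 / 8, 1 / 4, by norm_num, by norm_num⟩

lemma bumpAt_eq_zero {a ξ : Rn n} (h : 1 / 4 ≤ dist ξ a) : bumpAt a ξ = 0 :=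
  (bumpAt a).zero_of_le_dist h

lemma integrable_bumpAt (a : Rn n) : Integrable (bumpAt a) :=
  (bumpAt a).continuous.integrable_of_hasCompactSupport (bumpAt a).hasCompactSupport

lemma volume_real_ball_le_integral_bumpAt (a : Rn n) :
    volume.real (Metric.closedBall (0 : Rn n) (1 / 8)) ≤ ∫ ξ, bumpAt a ξ := by
  rw [measureReal_def, Measure.addHaar_closedBall_center, ← Measure.addHaar_closedBall_center _ a,
    ← measureReal_def]
  have h1 : volume.real (Metric.closedBall a (1 / 8))
      = ∫ ξ, (Metric.closedBall a (1 / 8)).indicator (fun _ => (1 : ℝ)) ξ := by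
    rw [integral_indicator_const _ measurableSet_closedBall]; simp
  rw [h1]
  refine integral_mono_of_nonneg (Eventually.of_forall fun ξ => ?_) (integrable_bumpAt a)
    (Eventually.of_forall fun ξ => ?_)
  · exact indicator_nonneg (fun _ _ => zero_le_one) _
  · by_cases h : ξ ∈ Metric.closedBall a (1 / 8)
    · simp only [indicator_of_mem h]
      exact ((bumpAt a).one_of_mem_closedBall h).ge
    · simp only [indicator_of_notMem h]
      exact (bumpAt a).nonneg

/-- The squared `Ḣ^s` mass of the bump at `a`, up to the factor `(2π)^{-n}`. -/
def bumpMass (s : ℝ) (a : Rn n) : ℝ := ∫ ξ, ‖ξ‖ ^ (2 * s) * bumpAt a ξ ^ 2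

lemma continuous_bumpMass_integrand {s : ℝ} (hs : 0 ≤ s) (a : Rn n) :
    Continuous fun ξ : Rn n => ‖ξ‖ ^ (2 * s) * bumpAt a ξ ^ 2 :=
  (continuous_norm.rpow_const fun _ => Or.inr (by positivity)).mul ((bumpAt a).continuous.pow 2)

lemma bumpMass_pos {s : ℝ} (hs : 0 ≤ s) {a : Rn n} (ha : a ≠ 0) : 0 < bumpMass s a := by
  refine (continuous_bumpMass_integrand hs a).integral_pos_of_hasCompactSupport_nonneg_nonzero
    (x := a) ?_ (fun ξ => by positivity) ?_
  · have := (bumpAt a).hasCompactSupport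
    refine HasCompactSupport.mul_left (this.comp_left (g := fun y : ℝ => y ^ 2) (by simp))
  · have : bumpAt a a = 1 := (bumpAt a).one_of_mem_closedBall
      (Metric.mem_closedBall_self (by norm_num [bumpAt]))
    rw [this]
    have : 0 < ‖a‖ := norm_pos_iff.2 ha
    positivity

lemma bumpMass_le {s B : ℝ} (hs : 0 ≤ s) {a : Rn n} (hB : ‖a‖ + 1 / 4 ≤ B) :
    bumpMass s a ≤ B ^ (2 * s) * volume.real (Metric.ball (0 : Rn n) (1 / 4)) := by
  have h1 : B ^ (2 * s) * volume.real (Metric.ball (0 : Rn n) (1 / 4))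
      = ∫ ξ, (Metric.ball a (1 / 4)).indicator (fun _ => B ^ (2 * s)) ξ := by
    rw [integral_indicator_const _ measurableSet_ball, smul_eq_mul, mul_comm, measureReal_def,
      ← Measure.addHaar_ball_center _ a, ← measureReal_def]
  rw [h1]
  refine integral_mono_of_nonneg (Eventually.of_forall fun ξ => by positivity)
    ((integrable_indicator_iff measurableSet_ball).2
      (integrableOn_const (measure_ball_lt_top.ne))) (Eventually.of_forall fun ξ => ?_)
  by_cases h : ξ ∈ Metric.ball a (1 / 4)
  · simp only [indicator_of_mem h]
    have h2 : ‖ξ‖ ≤ B := by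
      have := norm_le_norm_add_norm_sub' ξ a
      rw [Metric.mem_ball, dist_eq_norm] at h
      linarith
    have h3 : bumpAt a ξ ^ 2 ≤ 1 := pow_le_one₀ (bumpAt a).nonneg (bumpAt a).le_one
    calc ‖ξ‖ ^ (2 * s) * bumpAt a ξ ^ 2 ≤ B ^ (2 * s) * 1 :=
          mul_le_mul (rpow_le_rpow (norm_nonneg _) h2 (by positivity)) h3 (by positivity)
            (rpow_nonneg ((norm_nonneg _).trans h2) _)
      _ = _ := mul_one _
  · simp only [indicator_of_notMem h]
    rw [Metric.mem_ball, not_lt] at h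
    simp [bumpAt_eq_zero h]

/-- If the phase `θ` varies by at most `1/2` on the support of `g ≥ 0`, there is no cancellation. -/
lemma half_integral_le_norm_integral_exp {X : Type*} [MeasurableSpace X] {μ : Measure X}
    {θ : X → ℝ} {g : X → ℝ} (hθ : Measurable θ) (hg : Integrable g μ) (hg0 : ∀ x, 0 ≤ g x)
    (θ₀ : ℝ) (h : ∀ x, g x ≠ 0 → |θ x - θ₀| ≤ 1 / 2) :
    (∫ x, g x ∂μ) / 2 ≤ ‖∫ x, Complex.exp (Complex.I * θ x) * g x ∂μ‖ := by
  have hi : Integrable (fun x => Complex.exp (Complex.I * θ x) * g x) μ :=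
    hg.ofReal.bdd_mul (c := 1) (by fun_prop)
      (Eventually.of_forall fun x => (norm_exp_I_mul_ofReal' _ rfl).le)
  have hd : ‖∫ x, (Complex.exp (Complex.I * θ x) * g x - Complex.exp (Complex.I * θ₀) * g x) ∂μ‖
      ≤ ∫ x, 1 / 2 * g x ∂μ := by
    refine norm_integral_le_of_norm_le (hg.const_mul _) (Eventually.of_forall fun x => ?_)
    by_cases hx : g x = 0
    · simp [hx]
    · have e : Complex.exp (Complex.I * θ x) * g x - Complex.exp (Complex.I * θ₀) * g x
          = Complex.exp (Complex.I * θ₀) * (Complex.exp (Complex.I * (θ x - θ₀ : ℝ)) - 1) * g x := by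
        rw [mul_sub, ← Complex.exp_add, ← mul_add]
        push_cast
        rw [add_sub_cancel]
        ring
      rw [e, norm_mul, norm_mul, norm_exp_I_mul_ofReal' θ₀ rfl, one_mul, Complex.norm_real,
        norm_of_nonneg (hg0 x)]
      exact mul_le_mul_of_nonneg_right
        ((Real.norm_exp_I_mul_ofReal_sub_one_le).trans (h x hx)) (hg0 x)
  have hgC : Integrable (fun x => (g x : ℂ)) μ := hg.ofReal
  rw [integral_sub hi (hgC.const_mul _), integral_const_mul, integral_const_mul,
    integral_complex_ofReal] at hd
  have h0 : 0 ≤ ∫ x, g x ∂μ := integral_nonneg hg0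
  have h1 := norm_sub_norm_le (Complex.exp (Complex.I * θ₀) * (∫ x, g x ∂μ : ℝ))
    (∫ x, Complex.exp (Complex.I * θ x) * g x ∂μ)
  rw [norm_mul, norm_exp_I_mul_ofReal' θ₀ rfl, one_mul, Complex.norm_real, norm_of_nonneg h0,
    norm_sub_rev] at h1
  have := h1.trans hd
  linarith

/-- Wave packets: data whose Fourier transforms are the `Ḣ^s`-normalized bumps at `a k`. -/
lemma exists_wavePacket (s : ℝ) {ι : Type*} (a : ι → Rn n) :
    ∃ f : ι → Rn n → ℂ, ∀ k, FT (f k) = fun ξ =>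
      ((√((2 * π) ^ n / bumpMass s (a k)) * bumpAt (a k) ξ : ℝ) : ℂ) := by
  choose f hf using fun k => exists_FT_eq
    (g := fun ξ => ((√((2 * π) ^ n / bumpMass s (a k)) * bumpAt (a k) ξ : ℝ) : ℂ))
    (Complex.ofRealCLM.contDiff.comp ((contDiff_const).mul (bumpAt (a k)).contDiff))
    ((bumpAt (a k)).hasCompactSupport.comp_left
      (g := fun y : ℝ => ((√((2 * π) ^ n / bumpMass s (a k)) * y : ℝ) : ℂ)) (by simp))
  exact ⟨f, hf⟩

lemma rpow_neg_natCast_eq : (2 * π : ℝ) ^ (-(n : ℝ)) = ((2 * π) ^ n)⁻¹ := by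
  rw [Real.rpow_neg (by positivity), Real.rpow_natCast]

/-- Wave packets at unit-separated frequencies are orthonormal in `Ḣ^s`. -/
lemma orthonormalHs_wavePacket {s : ℝ} (hs : 0 ≤ s) {a : ℕ → Rn n} (ha : ∀ k, a k ≠ 0)
    (hsep : ∀ j k, j ≠ k → 1 ≤ dist (a j) (a k)) {f : ℕ → Rn n → ℂ}
    (hf : ∀ k, FT (f k) = fun ξ => ((√((2 * π) ^ n / bumpMass s (a k)) * bumpAt (a k) ξ : ℝ) : ℂ)) :
    OrthonormalHs s f := by
  intro j k
  simp only [hf]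
  rcases eq_or_ne j k with rfl | hjk
  · have hI := bumpMass_pos hs (ha j)
    have : (∫ ξ : Rn n, ((‖ξ‖ ^ (2 * s) : ℝ) : ℂ) *
        (((√((2 * π) ^ n / bumpMass s (a j)) * bumpAt (a j) ξ : ℝ) : ℂ) *
          (starRingEnd ℂ) ((√((2 * π) ^ n / bumpMass s (a j)) * bumpAt (a j) ξ : ℝ) : ℂ)))
        = (((2 * π) ^ n : ℝ) : ℂ) := by
      have e : ((2 * π) ^ n : ℝ) = ∫ ξ : Rn n, (2 * π) ^ n / bumpMass s (a j) *
          (‖ξ‖ ^ (2 * s) * bumpAt (a j) ξ ^ 2) := by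
        rw [integral_const_mul]
        change _ = _ * bumpMass s (a j)
        field_simp
      rw [congrArg Complex.ofReal e, ← integral_complex_ofReal]
      refine integral_congr_ae (Eventually.of_forall fun ξ => ?_)
      simp only [Complex.conj_ofReal, ← Complex.ofReal_mul]
      congr 1
      have := Real.mul_self_sqrt (show 0 ≤ (2 * π) ^ n / bumpMass s (a j) by positivity)
      linear_combination ‖ξ‖ ^ (2 * s) * bumpAt (a j) ξ ^ 2 * this
    rw [this, if_pos rfl, rpow_neg_natCast_eq, Complex.real_smul, ← Complex.ofReal_mul,
      inv_mul_cancel₀ (by positivity), Complex.ofReal_one]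
  · rw [if_neg hjk, integral_eq_zero_of_ae, smul_zero]
    refine Eventually.of_forall fun ξ => ?_
    rcases le_or_gt (1 / 4) (dist ξ (a j)) with h | h
    · simp [bumpAt_eq_zero h]
    · have : 1 / 4 ≤ dist ξ (a k) := by
        have := dist_triangle_left (a j) (a k) ξ
        linarith [hsep j k hjk]
      simp [bumpAt_eq_zero this]

lemma abs_phase_sub_le {B t : ℝ} {x ξ a : Rn n} (hB : ‖a‖ + 1 / 4 ≤ B) (hx : ‖x‖ ≤ 1 / 4)
    (ht : |t| ≤ 1 / (8 * B)) (hξ : dist ξ a < 1 / 4) :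
    |(inner ℝ x ξ - t * ‖ξ‖ ^ 2) - (inner ℝ x a - t * ‖a‖ ^ 2)| ≤ 1 / 2 := by
  rw [dist_eq_norm] at hξ
  have hB0 : 0 < B := by linarith [norm_nonneg a]
  have hξB : ‖ξ‖ ≤ B := by linarith [norm_le_norm_add_norm_sub' ξ a]
  have e : (inner ℝ x ξ - t * ‖ξ‖ ^ 2) - (inner ℝ x a - t * ‖a‖ ^ 2)
      = inner ℝ x (ξ - a) - t * ((‖ξ‖ - ‖a‖) * (‖ξ‖ + ‖a‖)) := by rw [inner_sub_right]; ring
  have h1 : |inner ℝ x (ξ - a)| ≤ 1 / 4 * (1 / 4) :=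
    (abs_real_inner_le_norm _ _).trans (mul_le_mul hx hξ.le (norm_nonneg _) (by norm_num))
  have h2 : |(‖ξ‖ - ‖a‖) * (‖ξ‖ + ‖a‖)| ≤ 1 / 4 * (2 * B) := by
    rw [abs_mul, abs_of_nonneg (show 0 ≤ ‖ξ‖ + ‖a‖ by positivity)]
    exact mul_le_mul ((abs_norm_sub_norm_le _ _).trans hξ.le) (by linarith [norm_nonneg a])
      (by positivity) (by norm_num)
  have h3 : |t * ((‖ξ‖ - ‖a‖) * (‖ξ‖ + ‖a‖))| ≤ 1 / (8 * B) * (1 / 4 * (2 * B)) := by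
    rw [abs_mul]
    exact mul_le_mul ht h2 (abs_nonneg _) (by positivity)
  have h4 : 1 / (8 * B) * (1 / 4 * (2 * B)) = 1 / 16 := by field_simp; norm_num
  rw [e]
  exact (abs_sub _ _).trans (by linarith)

/-- A wave packet does not disperse near the origin of space-time. -/
lemma exists_le_norm_schrodinger_sq (n : ℕ) {s : ℝ} (hs : 0 ≤ s) :
    ∃ c : ℝ, 0 < c ∧ ∀ (a : Rn n) (f : Rn n → ℂ) (B t : ℝ) (x : Rn n), a ≠ 0 →
      (FT f = fun ξ => ((√((2 * π) ^ n / bumpMass s a) * bumpAt a ξ : ℝ) : ℂ)) →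
      ‖a‖ + 1 / 4 ≤ B → ‖x‖ ≤ 1 / 4 → |t| ≤ 1 / (8 * B) →
      c * B ^ (-(2 * s)) ≤ ‖schrodinger f t x‖ ^ 2 := by
  set V := volume.real (Metric.ball (0 : Rn n) (1 / 4)) with hV
  set v := volume.real (Metric.closedBall (0 : Rn n) (1 / 8)) with hv
  have hV0 : 0 < V := ENNReal.toReal_pos (Metric.measure_ball_pos _ _ (by norm_num)).ne'
    measure_ball_lt_top.ne
  have hv0 : 0 < v := ENNReal.toReal_pos (Metric.measure_closedBall_pos _ _ (by norm_num)).ne'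
    measure_closedBall_lt_top.ne
  refine ⟨((2 * π) ^ n)⁻¹ * v ^ 2 / (4 * V), by positivity, ?_⟩
  intro a f B t x ha hf hB hx ht
  have hB0 : 0 < B := by linarith [norm_nonneg a]
  have hI := bumpMass_pos hs ha
  set M := bumpMass s a
  set c := √((2 * π) ^ n / M) with hc
  have hc2 : c ^ 2 = (2 * π) ^ n / M := Real.sq_sqrt (by positivity)
  have hu : schrodinger f t x = (((2 * π) ^ n)⁻¹ : ℝ) • ∫ ξ : Rn n,
      Complex.exp (Complex.I * ((inner ℝ x ξ - t * ‖ξ‖ ^ 2 : ℝ) : ℂ)) *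
        ((c * bumpAt a ξ : ℝ) : ℂ) := by
    rw [schrodinger, prop, rpow_neg_natCast_eq, hf]
    simp only [dotC_eq_inner, one_mul]
    push_cast
    rfl
  have hlow := half_integral_le_norm_integral_exp (μ := (volume : Measure (Rn n)))
    (θ := fun ξ : Rn n => inner ℝ x ξ - t * ‖ξ‖ ^ 2) (g := fun ξ => c * bumpAt a ξ)
    (by fun_prop) ((integrable_bumpAt a).const_mul c)
    (fun ξ => mul_nonneg (Real.sqrt_nonneg _) (bumpAt a).nonneg) (inner ℝ x a - t * ‖a‖ ^ 2)
    (fun ξ hξ => abs_phase_sub_le hB hx ht (by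
      by_contra! h
      exact hξ (by rw [bumpAt_eq_zero h, mul_zero])))
  rw [integral_const_mul] at hlow
  have hcv : c * v / 2 ≤ c * (∫ ξ, bumpAt a ξ) / 2 := by
    have := mul_le_mul_of_nonneg_left (volume_real_ball_le_integral_bumpAt a)
      (Real.sqrt_nonneg ((2 * π) ^ n / M))
    linarith
  have hsq := pow_le_pow_left₀ (by positivity) (hcv.trans hlow) 2
  rw [hu, norm_smul, norm_of_nonneg (by positivity), mul_pow ((2 * π) ^ n)⁻¹]
  have hM := bumpMass_le hs hB
  calc ((2 * π) ^ n)⁻¹ * v ^ 2 / (4 * V) * B ^ (-(2 * s))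
      = ((2 * π) ^ n)⁻¹ * v ^ 2 / 4 * (B ^ (2 * s) * V)⁻¹ := by
        rw [Real.rpow_neg hB0.le, mul_inv]; field_simp
    _ ≤ ((2 * π) ^ n)⁻¹ * v ^ 2 / 4 * M⁻¹ := by
        gcongr
    _ = (((2 * π) ^ n)⁻¹) ^ 2 * (c * v / 2) ^ 2 := by
        rw [div_pow, mul_pow c v, hc2]; field_simp; norm_num
    _ ≤ _ := by gcongr

/-- The lattice point `k + (1,…,1)`. -/
def center (k : Fin n → ℕ) : Rn n := WithLp.toLp 2 fun i => (k i : ℝ) + 1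

lemma center_ne_zero (hn : 1 ≤ n) (k : Fin n → ℕ) : center k ≠ 0 := by
  intro h
  have : center k ⟨0, hn⟩ = 0 := by rw [h]; rfl
  simp only [center] at this
  linarith [(k ⟨0, hn⟩).cast_nonneg (α := ℝ)]

lemma one_le_dist_center {k l : Fin n → ℕ} (h : k ≠ l) : 1 ≤ dist (center k) (center l) := by
  obtain ⟨i, hi⟩ := Function.ne_iff.1 h
  rw [dist_eq_norm]
  refine le_trans ?_ (PiLp.norm_apply_le (center k - center l) i)
  have e : (center k - center l) i = (((k i : ℤ) - l i : ℤ) : ℝ) := by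
    simp [center]
  rw [e, Real.norm_eq_abs, ← Int.cast_abs]
  have : (1 : ℤ) ≤ |(k i : ℤ) - l i| := Int.one_le_abs (by omega)
  exact_mod_cast this

lemma norm_center_le (hn : 1 ≤ n) {k : Fin n → ℕ} {R : ℕ} (h : ∀ i, k i < R) :
    ‖center k‖ ≤ n * R := by
  rw [EuclideanSpace.norm_eq, Real.sqrt_le_left (by positivity)]
  have h1 : ∀ i, ‖center k i‖ ^ 2 ≤ (R : ℝ) ^ 2 := fun i => by
    have : (k i : ℝ) + 1 ≤ R := by exact_mod_cast h i
    rw [show center k i = (k i : ℝ) + 1 from rfl, Real.norm_of_nonneg (by positivity)]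
    exact pow_le_pow_left₀ (by positivity) this 2
  calc ∑ i, ‖center k i‖ ^ 2 ≤ ∑ _i : Fin n, (R : ℝ) ^ 2 := Finset.sum_le_sum fun i _ => h1 i
    _ = n * (R : ℝ) ^ 2 := by simp
    _ ≤ n ^ 2 * (R : ℝ) ^ 2 := by
        gcongr
        exact_mod_cast Nat.le_self_pow two_ne_zero n
    _ = (n * R) ^ 2 := by ring

lemma le_mixedL {p q : ℝ} (hp : 0 < p) (hq : 0 < q) {I : Set ℝ} {K : Set (Rn n)}
    (hI : MeasurableSet I) (hK : MeasurableSet K) {D : ℝ≥0∞} {ρ : ℝ × Rn n → ℝ≥0∞}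
    (h : ∀ t ∈ I, ∀ x ∈ K, D ≤ ρ (t, x)) :
    D * volume K ^ (1 / p) * volume I ^ (1 / q) ≤ mixedL p q ρ := by
  have hx : ∀ t ∈ I, D ^ p * volume K ≤ ∫⁻ x, ρ (t, x) ^ p := fun t ht => by
    calc D ^ p * volume K = ∫⁻ _ in K, D ^ p := by rw [setLIntegral_const]
      _ ≤ ∫⁻ x in K, ρ (t, x) ^ p :=
          setLIntegral_mono' hK fun x hxK => ENNReal.rpow_le_rpow (h t ht x hxK) hp.le
      _ ≤ _ := setLIntegral_le_lintegral _ _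
  have ht : (D ^ p * volume K) ^ (q / p) * volume I
      ≤ ∫⁻ t, (∫⁻ x, ρ (t, x) ^ p) ^ (q / p) := by
    calc (D ^ p * volume K) ^ (q / p) * volume I
        = ∫⁻ _ in I, (D ^ p * volume K) ^ (q / p) := by rw [setLIntegral_const]
      _ ≤ ∫⁻ t in I, (∫⁻ x, ρ (t, x) ^ p) ^ (q / p) :=
          setLIntegral_mono' hI fun t ht => ENNReal.rpow_le_rpow (hx t ht) (by positivity)
      _ ≤ _ := setLIntegral_le_lintegral _ _
  have e : D * volume K ^ (1 / p) * volume I ^ (1 / q)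
      = ((D ^ p * volume K) ^ (q / p) * volume I) ^ (1 / q) := by
    rw [ENNReal.mul_rpow_of_nonneg _ _ (by positivity), ← ENNReal.rpow_mul,
      ENNReal.mul_rpow_of_nonneg _ _ (by positivity), ← ENNReal.rpow_mul,
      show q / p * (1 / q) = 1 / p by field_simp, mul_one_div_cancel hp.ne', ENNReal.rpow_one]
  rw [e]
  exact ENNReal.rpow_le_rpow ht (by positivity)

lemma exists_finset_card_eq_pow (e : ℕ ≃ (Fin n → ℕ)) (R : ℕ) :
    ∃ S : Finset ℕ, S.card = R ^ n ∧ ∀ j ∈ S, ∀ i, e j i < R := by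
  refine ⟨(Fintype.piFinset fun _ : Fin n => Finset.range R).map e.symm.toEmbedding, by simp, ?_⟩
  intro j hj
  simpa using hj

lemma seqNormE_indicator {α : ℝ} (hα : 0 < α) (S : Finset ℕ) :
    seqNormE (ENNReal.ofReal α) ((S : Set ℕ).indicator 1) = (S.card : ℝ≥0∞) ^ (1 / α) := by
  rw [seqNormE_ofReal hα.le, tsum_eq_sum (s := S)]
  · congr 1
    rw [Finset.sum_congr rfl (g := fun _ => 1) fun j hj => by simp [hj]]
    simp
  · intro j hj
    simp [hj, hα]

lemma density_indicator (S : Finset ℕ) (f : ℕ → Rn n → ℂ) (t : ℝ) (x : Rn n) :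
    density ((S : Set ℕ).indicator 1) f t x = ∑ j ∈ S, ‖schrodinger (f j) t x‖ ^ 2 := by
  rw [density, density2, tsum_eq_sum (s := S)]
  · exact Finset.sum_congr rfl fun j hj => by simp [hj]
  · intro j hj
    simp [hj]

/-- Superposing the wave packets with frequencies in a box of side `R` gives a lower bound for
the constant in any orthonormal Strichartz inequality. -/
lemma exists_mul_rpow_le_of_strichartz {p q s α : ℝ} (hn : 1 ≤ n) (hp : 0 < p) (hq : 0 < q)
    (hs0 : 0 ≤ s) (hα : 0 < α) {C : ℝ} (hC : 0 < C)
    (h : ∀ (f : ℕ → Rn n → ℂ) (lam : ℕ → ℝ),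
      OrthonormalHs s f → seqNormE (ENNReal.ofReal α) lam ≠ ∞ →
      mixedLp (ENNReal.ofReal q) (ENNReal.ofReal p) (density lam f)
        ≤ ENNReal.ofReal C * seqNormE (ENNReal.ofReal α) lam) :
    ∃ c : ℝ, 0 < c ∧ ∀ R : ℕ, 1 ≤ R →
      c * (R : ℝ) ^ (n - 2 * s - 1 / q) ≤ C * (R : ℝ) ^ (n / α) := by
  have : Nonempty (Fin n) := ⟨⟨0, hn⟩⟩
  obtain ⟨e⟩ : Nonempty (ℕ ≃ (Fin n → ℕ)) := nonempty_equiv_of_countable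
  obtain ⟨f, hf⟩ := exists_wavePacket s fun j => center (e j)
  have hort : OrthonormalHs s f := orthonormalHs_wavePacket hs0 (fun j => center_ne_zero hn _)
    (fun j k hjk => one_le_dist_center (e.injective.ne hjk)) hf
  obtain ⟨c, hc, hlow⟩ := exists_le_norm_schrodinger_sq n hs0
  set K := Metric.closedBall (0 : Rn n) (1 / 4)
  set V := volume.real K with hV
  have hV0 : 0 < V := ENNReal.toReal_pos (Metric.measure_closedBall_pos _ _ (by norm_num)).ne'
    measure_closedBall_lt_top.ne
  have hVe : volume K = ENNReal.ofReal V := (ENNReal.ofReal_toReal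
    measure_closedBall_lt_top.ne).symm
  have hn0 : (1 : ℝ) ≤ n := by exact_mod_cast hn
  refine ⟨c * (2 * n) ^ (-(2 * s)) * V ^ (1 / p) * (8 * n : ℝ) ^ (-(1 / q)), by positivity, ?_⟩
  intro R hR
  have hR0 : (1 : ℝ) ≤ R := by exact_mod_cast hR
  set B : ℝ := 2 * n * R with hB
  have hnR : 1 ≤ (n : ℝ) * R := one_le_mul_of_one_le_of_one_le hn0 hR0
  obtain ⟨S, hS, hSR⟩ := exists_finset_card_eq_pow e R
  have hnorm := seqNormE_indicator hα S
  have hmain := h f _ hort (by rw [hnorm]; finiteness)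
  rw [hnorm, mixedLp_eq_mixedL hp hq] at hmain
  have hD := le_mixedL hp hq (measurableSet_Icc (a := -(1 / (8 * B))) (b := 1 / (8 * B)))
    (K := K) measurableSet_closedBall
    (D := ENNReal.ofReal ((R : ℝ) ^ n * (c * B ^ (-(2 * s)))))
    (ρ := fun z => ‖density ((S : Set ℕ).indicator 1) f z.1 z.2‖ₑ) fun t ht x hx => by
      rw [density_indicator, ← ofReal_norm]
      refine ENNReal.ofReal_le_ofReal (le_trans ?_ (le_abs_self _))
      calc (R : ℝ) ^ n * (c * B ^ (-(2 * s))) = ∑ _j ∈ S, c * B ^ (-(2 * s)) := by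
            rw [Finset.sum_const, hS, nsmul_eq_mul]; push_cast; rfl
        _ ≤ _ := Finset.sum_le_sum fun j hj => hlow _ _ B t x (center_ne_zero hn _) (hf j)
            (by have := norm_center_le hn (hSR j hj); linarith) (by simpa [K] using hx)
            (abs_le.2 ht)
  have hle := hD.trans hmain
  rw [Real.volume_Icc, hVe, hS, ← ENNReal.ofReal_natCast,
    ENNReal.ofReal_rpow_of_nonneg hV0.le (by positivity),
    ENNReal.ofReal_rpow_of_nonneg (by rw [sub_neg_eq_add]; positivity) (by positivity),
    ENNReal.ofReal_rpow_of_nonneg (by positivity) (by positivity),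
    ← ENNReal.ofReal_mul (by positivity), ← ENNReal.ofReal_mul (by positivity),
    ← ENNReal.ofReal_mul hC.le, ENNReal.ofReal_le_ofReal_iff (by positivity)] at hle
  have hRpos : (0 : ℝ) < R := by linarith
  have e1 : ((R ^ n : ℕ) : ℝ) ^ (1 / α) = (R : ℝ) ^ (n / α) := by
    rw [Nat.cast_pow, ← Real.rpow_natCast, ← Real.rpow_mul hRpos.le, mul_one_div]
  have e2 : (1 / (8 * B) - -(1 / (8 * B))) ^ (1 / q)
      = (8 * n : ℝ) ^ (-(1 / q)) * (R : ℝ) ^ (-(1 / q)) := by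
    rw [← Real.mul_rpow (by positivity) hRpos.le, Real.rpow_neg (by positivity),
      ← Real.inv_rpow (by positivity)]
    congr 1
    rw [hB]; field_simp; norm_num
  have e3 : B ^ (-(2 * s)) = (2 * n : ℝ) ^ (-(2 * s)) * (R : ℝ) ^ (-(2 * s)) :=
    Real.mul_rpow (by positivity) hRpos.le
  have e4 : (R : ℝ) ^ (n - 2 * s - 1 / q)
      = (R : ℝ) ^ n * (R : ℝ) ^ (-(2 * s)) * (R : ℝ) ^ (-(1 / q)) := by
    rw [← Real.rpow_natCast, ← Real.rpow_add hRpos, ← Real.rpow_add hRpos]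
    ring_nf
  rw [e1, e2, e3] at hle
  rw [e4]
  refine le_trans (le_of_eq ?_) hle
  ring

lemma not_exists_strichartz {p q s α : ℝ} (hn : 1 ≤ n) (hp : 0 < p) (hq : 0 < q)
    (hs0 : 0 ≤ s) (hs : 2 * s = n - (2 / q + n / p)) (hα : n / (1 / q + n / p) < α) :
    ¬ ∃ C : ℝ, 0 < C ∧ ∀ (f : ℕ → Rn n → ℂ) (lam : ℕ → ℝ),
      OrthonormalHs s f → seqNormE (ENNReal.ofReal α) lam ≠ ∞ →
      mixedLp (ENNReal.ofReal q) (ENNReal.ofReal p) (density lam f)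
        ≤ ENNReal.ofReal C * seqNormE (ENNReal.ofReal α) lam := by
  rintro ⟨C, hC, h⟩
  have hα0 : 0 < α := lt_of_le_of_lt (by positivity) hα
  obtain ⟨c, hc, hR⟩ := exists_mul_rpow_le_of_strichartz hn hp hq hs0 hα0 hC h
  have hm : (n : ℝ) - 2 * s - 1 / q = 1 / q + n / p := by rw [hs]; ring
  rw [hm] at hR
  have hlt : 0 < 1 / q + n / p - n / α := by
    rw [div_lt_iff₀ (by positivity)] at hα
    rw [sub_pos, div_lt_iff₀ hα0, mul_comm]
    exact hα
  have ht := (tendsto_rpow_atTop hlt).comp tendsto_natCast_atTop_atTop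
  obtain ⟨R, hR1, hR2⟩ := ((eventually_ge_atTop 1).and (ht.eventually_gt_atTop (C / c))).exists
  have hRpos : (0 : ℝ) < R := by exact_mod_cast hR1
  rw [Function.comp_apply, div_lt_iff₀ hc, Real.rpow_sub hRpos, div_mul_eq_mul_div,
    lt_div_iff₀ (by positivity)] at hR2
  linarith [hR R hR1]

end OS

/-- (Bez–Hong–Lee–Nakamura–Sawano.)  Global orthonormal Strichartz
estimates in the interior of `OAB` at the sharp exponent `α = α*(p,q)` (where
`n/α* = 1/q + n/p`), with data orthonormal in `Ḣ^s(ℝⁿ)`, `2s = n - (2/q + n/p)`;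
moreover the estimate fails for every `α > α*(p,q)`. -/
theorem global_OAB (n : ℕ) (hn : 1 ≤ n) (p q s : ℝ)
    (hpq : IntOAB n (1 / p) (1 / q))
    (hs : 2 * s = n - (2 / q + n / p)) :
    (∃ C : ℝ, 0 < C ∧ ∀ (f : ℕ → Rn n → ℂ) (lam : ℕ → ℝ),
      OrthonormalHs s f → seqNormE (ENNReal.ofReal ((n : ℝ) / (1 / q + n / p))) lam ≠ ∞ →
      mixedLp (ENNReal.ofReal q) (ENNReal.ofReal p) (density lam f)
        ≤ ENNReal.ofReal C * seqNormE (ENNReal.ofReal ((n : ℝ) / (1 / q + n / p))) lam) ∧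
    ∀ α : ℝ, (n : ℝ) / (1 / q + n / p) < α →
      ¬ ∃ C : ℝ, 0 < C ∧ ∀ (f : ℕ → Rn n → ℂ) (lam : ℕ → ℝ),
        OrthonormalHs s f → seqNormE (ENNReal.ofReal α) lam ≠ ∞ →
        mixedLp (ENNReal.ofReal q) (ENNReal.ofReal p) (density lam f)
          ≤ ENNReal.ofReal C * seqNormE (ENNReal.ofReal α) lam := by
  obtain ⟨⟨ha0, ha1⟩, ⟨hb0, hb1⟩, hab, hsum⟩ := hpq
  have hp0 : 0 < p := one_div_pos.1 ha0
  have hq0 : 0 < q := one_div_pos.1 hb0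
  have hp : 1 < p := by rwa [div_lt_one hp0] at ha1
  have hq : 1 < q := by rwa [div_lt_one hq0] at hb1
  have hs0 : 0 < s := by
    have e : 2 / q + n / p = 2 * (1 / q) + n * (1 / p) := by ring
    rw [e] at hs
    linarith
  have hn2 : 2 ≤ n := by
    rcases hn.lt_or_eq with h | rfl
    · exact h
    · norm_num at hab
      linarith [inv_pos.2 hq0]
  exact ⟨exists_strichartz hn2 hp hq hab hs0 hs rfl,
    fun α hα => not_exists_strichartz hn hp0 hq0 hs0.le hs hα⟩
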